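/- arXiv:2109.12672 — 2 statements merged into one kernel-verified Lean document; each statement's English description precedes it below -/
import Mathlib

section
/- Let k be an algebraically closed field of characteristic zero and let F be a homogeneous polynomial of degree 3 in four variables over k whose projective zero locus is a smooth surface, i.e. the four partial derivatives of F have no common zero in k⁴ other than the origin. Then the number of lines contained in the surface — that is, the number of 2-dimensional k-linear subspaces W of k⁴ such that F vanishes at every vector of W — is exactly 27. -/
namespace CS

variable {k : Type*} [Field k] {V : Type*} [AddCommGroup V] [Module k V]

/-- symmetric trilinear form defining a smooth cubic -/
structure Cub (T : V →ₗ[k] V →ₗ[k] V →ₗ[k] k) : Prop where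
  s1 : ∀ x y z, T x y z = T y x z
  s2 : ∀ x y z, T x y z = T x z y
  ns : ∀ v, (∀ w, T v v w = 0) → v = 0

/-- lines on the cubic -/
def IsLine (T : V →ₗ[k] V →ₗ[k] V →ₗ[k] k) (W : Submodule k V) : Prop :=
  Module.finrank k W = 2 ∧ ∀ v ∈ W, T v v v = 0

/-- factorisation of binary quadratic forms -/
lemma quad_factor [IsAlgClosed k] [CharZero k] (A B C : k) :
    ∃ a1 b1 a2 b2 : k, A = a1 * a2 ∧ B = a1 * b2 + a2 * b1 ∧ C = b1 * b2 := by
  by_cases hA : A = 0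
  · exact ⟨0, 1, B, C, by simp [hA], by simp, by simp⟩
  · obtain ⟨s, hs⟩ := IsAlgClosed.exists_pow_nat_eq (B ^ 2 - 4 * A * C) (n := 2) (by norm_num)
    refine ⟨A, (B - s) / 2, 1, (B + s) / (2 * A), by simp, by field_simp; ring, ?_⟩
    field_simp
    linear_combination hs

lemma quad_zero [IsAlgClosed k] [CharZero k] (A B C : k) :
    ∃ x y : k, (x ≠ 0 ∨ y ≠ 0) ∧ A * x ^ 2 + B * x * y + C * y ^ 2 = 0 := by
  obtain ⟨a1, b1, a2, b2, rfl, rfl, rfl⟩ := quad_factor A B C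
  by_cases h : a1 = 0 ∧ b1 = 0
  · exact ⟨1, 0, by simp, by simp [h.1]⟩
  · exact ⟨b1, -a1, by rw [neg_ne_zero]; tauto, by ring⟩

variable {T : V →ₗ[k] V →ₗ[k] V →ₗ[k] k}

/-- expansion of the cubic form along a line -/
lemma Cub.expand (hT : Cub T) (u v : V) (x y : k) :
    T (x • u + y • v) (x • u + y • v) (x • u + y • v) =
      x ^ 3 * T u u u + 3 * x ^ 2 * y * T u u v + 3 * x * y ^ 2 * T u v v + y ^ 3 * T v v v := by
  have h1 : T v u u = T u u v := by rw [hT.s1, hT.s2]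
  have h2 : T u v u = T u u v := by rw [hT.s2]
  have h3 : T v u v = T u v v := by rw [hT.s1]
  have h4 : T v v u = T u v v := by rw [hT.s2, hT.s1]
  simp only [map_add, map_smul, LinearMap.add_apply, LinearMap.smul_apply, smul_eq_mul,
    h1, h2, h3, h4]
  ring

lemma Cub.expand2 (hT : Cub T) (u v w : V) (x y : k) :
    T (x • u + y • v) (x • u + y • v) w =
      x ^ 2 * T u u w + 2 * x * y * T u v w + y ^ 2 * T v v w := by
  have h1 : T v u w = T u v w := by rw [hT.s1]
  simp only [map_add, map_smul, LinearMap.add_apply, LinearMap.smul_apply, smul_eq_mul, h1]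
  ring

/-- if the cubic vanishes on a subspace, so does its polarization -/
lemma Cub.polar [CharZero k] (hT : Cub T) {u v : V}
    (h : ∀ x y : k, T (x • u + y • v) (x • u + y • v) (x • u + y • v) = 0) :
    T u u v = 0 ∧ T u v v = 0 := by
  have h0 := h 1 0
  have h1 := h 0 1
  have h2 := h 1 1
  have h3 := h 1 (-1)
  rw [hT.expand] at h0 h1 h2 h3
  constructor
  · have : 6 * T u u v = 0 := by linear_combination h2 - h3 - 2 * h1
    simpa using this
  · have : 6 * T u v v = 0 := by linear_combination h2 + h3 - 2 * h0
    simpa using this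

lemma IsLine.polar [CharZero k] (hT : Cub T) {W : Submodule k V} (hW : IsLine T W) {u v : V}
    (hu : u ∈ W) (hv : v ∈ W) : T u u v = 0 :=
  (hT.polar fun _ _ => hW.2 _ (W.add_mem (W.smul_mem _ hu) (W.smul_mem _ hv))).1

lemma IsLine.polar3 [CharZero k] (hT : Cub T) {W : Submodule k V} (hW : IsLine T W) {u v w : V}
    (hu : u ∈ W) (hv : v ∈ W) (hw : w ∈ W) : T u v w = 0 := by
  have h := hW.polar hT (W.add_mem hu hv) hw
  have e := hT.expand2 u v w 1 1
  simp only [one_smul, hW.polar hT hu hw, hW.polar hT hv hw, h] at e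
  have : 2 * T u v w = 0 := by linear_combination -e
  simpa using this

/-- The plane section by `h = 0` splits into three linear forms. -/
structure Tri (T : V →ₗ[k] V →ₗ[k] V →ₗ[k] k) (h L0 L1 L2 : Module.Dual k V) : Prop where
  hne : h ≠ 0
  eq : ∀ v, h v = 0 → T v v v = L0 v * L1 v * L2 v

lemma Tri.swap {h L0 L1 L2 : Module.Dual k V} (t : Tri T h L0 L1 L2) : Tri T h L1 L0 L2 :=
  ⟨t.hne, fun v hv => by rw [t.eq v hv]; ring⟩

lemma Tri.rot {h L0 L1 L2 : Module.Dual k V} (t : Tri T h L0 L1 L2) : Tri T h L1 L2 L0 :=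
  ⟨t.hne, fun v hv => by rw [t.eq v hv]; ring⟩

lemma Tri.polar [CharZero k] (hT : Cub T) {h L0 L1 L2 : Module.Dual k V}
    (t : Tri T h L0 L1 L2) {R v : V}
    (hR : h R = 0) (hv : h v = 0) (h0 : L0 R = 0) (h1 : L1 R = 0) : T R R v = 0 := by
  have e1 := t.eq ((1 : k) • R + (1 : k) • v) (by simp [hR, hv])
  have e2 := t.eq ((1 : k) • R + (-1 : k) • v) (by simp [hR, hv])
  have e3 := t.eq R hR
  have e4 := t.eq v hv
  rw [hT.expand] at e1 e2
  simp only [map_add, map_smul, smul_eq_mul, h0, h1] at e1 e2 e3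
  have : 6 * T R R v = 0 := by linear_combination e1 - e2 - 2 * e4
  simpa using this

lemma Tri.no [IsAlgClosed k] [CharZero k] (hT : Cub T) {h L0 L1 L2 : Module.Dual k V}
    (t : Tri T h L0 L1 L2) {P Q : V} (hPQ : LinearIndependent k ![P, Q])
    (hP : h P = 0) (hQ : h Q = 0) (hP0 : L0 P = 0) (hQ0 : L0 Q = 0)
    (hP1 : L1 P = 0) (hQ1 : L1 Q = 0) : False := by
  obtain ⟨w, hw⟩ : ∃ w, h w ≠ 0 := by
    by_contra! hc
    exact t.hne (LinearMap.ext hc)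
  obtain ⟨x, y, hxy, e⟩ := quad_zero (T P P w) (2 * T P Q w) (T Q Q w)
  have hR : x • P + y • Q = 0 := by
    apply hT.ns
    intro v
    have hv : h (v - (h v / h w) • w) = 0 := by simp [hw]
    have e1 := t.polar hT (R := x • P + y • Q) (by simp [hP, hQ]) hv (by simp [hP0, hQ0])
      (by simp [hP1, hQ1])
    have e2 := hT.expand2 P Q w x y
    rw [map_sub, map_smul, e2, smul_eq_mul] at e1
    linear_combination e1 + (h v / h w) * e
  have := LinearIndependent.pair_iff.1 hPQ x y hR
  tauto

lemma finrank_inf_ker [FiniteDimensional k V] (X : Submodule k V) (L : Module.Dual k V) :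
    Module.finrank k X ≤ Module.finrank k (X ⊓ LinearMap.ker L : Submodule k V) + 1 := by
  have h1 := LinearMap.finrank_range_add_finrank_ker (L.domRestrict X)
  have h2 : Module.finrank k (LinearMap.range (L.domRestrict X)) ≤ 1 := by
    simpa using Submodule.finrank_le (LinearMap.range (L.domRestrict X))
  have h3 : Module.finrank k (LinearMap.ker (L.domRestrict X)) =
      Module.finrank k (X ⊓ LinearMap.ker L : Submodule k V) := by
    rw [← Submodule.map_comap_subtype, Submodule.finrank_map_subtype_eq]
    rfl
  omega

lemma exists_pair [FiniteDimensional k V] (X : Submodule k V) (hX : 2 ≤ Module.finrank k X) :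
    ∃ P Q, P ∈ X ∧ Q ∈ X ∧ LinearIndependent k ![P, Q] := by
  obtain ⟨f, hf⟩ := exists_linearIndependent_of_le_finrank hX
  refine ⟨f 0, f 1, (f 0).2, (f 1).2, ?_⟩
  have h2 := hf.map' X.subtype (by simp)
  have e : ![(f 0 : V), (f 1 : V)] = X.subtype ∘ f := by
    ext i
    fin_cases i <;> rfl
  rw [e]
  exact h2

variable [IsAlgClosed k] [CharZero k]

lemma Tri.finrank3 (hV : Module.finrank k V = 4) (hT : Cub T) {h L0 L1 L2 : Module.Dual k V}
    (t : Tri T h L0 L1 L2) :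
    Module.finrank k (LinearMap.ker h ⊓ LinearMap.ker L0 ⊓ LinearMap.ker L1 : Submodule k V) ≤ 1 := by
  have : FiniteDimensional k V := Module.finite_of_finrank_pos (by omega)
  by_contra! hc
  obtain ⟨P, Q, hP, hQ, hi⟩ := exists_pair _ hc
  simp only [Submodule.mem_inf, LinearMap.mem_ker] at hP hQ
  exact t.no hT hi hP.1.1 hQ.1.1 hP.1.2 hQ.1.2 hP.2 hQ.2

lemma Tri.finrank2 (hV : Module.finrank k V = 4) (hT : Cub T) {h L0 L1 L2 : Module.Dual k V}
    (t : Tri T h L0 L1 L2) :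
    Module.finrank k (LinearMap.ker h ⊓ LinearMap.ker L0 : Submodule k V) = 2 := by
  have : FiniteDimensional k V := Module.finite_of_finrank_pos (by omega)
  have h1 := t.finrank3 hV hT
  have h2 := finrank_inf_ker (LinearMap.ker h ⊓ LinearMap.ker L0) L1
  have h3 := finrank_inf_ker (LinearMap.ker h) L0
  have h4 := finrank_inf_ker ⊤ h
  rw [top_inf_eq, finrank_top] at h4
  omega

lemma Tri.ker_finrank (hV : Module.finrank k V = 4) (hT : Cub T) {h L0 L1 L2 : Module.Dual k V}
    (t : Tri T h L0 L1 L2) :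
    Module.finrank k (LinearMap.ker h : Submodule k V) = 3 := by
  have : FiniteDimensional k V := Module.finite_of_finrank_pos (by omega)
  have h1 := t.finrank2 hV hT
  have h3 := finrank_inf_ker (LinearMap.ker h) L0
  have h4 := finrank_inf_ker ⊤ h
  rw [top_inf_eq, finrank_top] at h4
  omega

lemma Tri.isLine (hV : Module.finrank k V = 4) (hT : Cub T) {h L0 L1 L2 : Module.Dual k V}
    (t : Tri T h L0 L1 L2) : IsLine T (LinearMap.ker h ⊓ LinearMap.ker L0) := by
  refine ⟨t.finrank2 hV hT, fun v hv => ?_⟩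
  simp only [Submodule.mem_inf, LinearMap.mem_ker] at hv
  rw [t.eq v hv.1, hv.2]; ring

lemma Tri.ne (hV : Module.finrank k V = 4) (hT : Cub T) {h L0 L1 L2 : Module.Dual k V}
    (t : Tri T h L0 L1 L2) :
    LinearMap.ker h ⊓ LinearMap.ker L0 ≠ LinearMap.ker h ⊓ LinearMap.ker L1 := by
  intro he
  have h1 := t.finrank3 hV hT
  have h2 := t.finrank2 hV hT
  have h3 : LinearMap.ker h ⊓ LinearMap.ker L0 ⊓ LinearMap.ker L1 = LinearMap.ker h ⊓ LinearMap.ker L0 := by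
    rw [inf_eq_left, he]; exact inf_le_right
  rw [h3] at h1
  omega

lemma Tri.mem (hV : Module.finrank k V = 4) (hT : Cub T) {h L0 L1 L2 : Module.Dual k V}
    (t : Tri T h L0 L1 L2) {W : Submodule k V} (hW : IsLine T W) (hle : W ≤ LinearMap.ker h) :
    W = LinearMap.ker h ⊓ LinearMap.ker L0 ∨ W = LinearMap.ker h ⊓ LinearMap.ker L1 ∨
      W = LinearMap.ker h ⊓ LinearMap.ker L2 := by
  have : FiniteDimensional k V := Module.finite_of_finrank_pos (by omega)
  have key : ∀ L L' L'' : Module.Dual k V, Tri T h L L' L'' → W ≤ LinearMap.ker L →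
      W = LinearMap.ker h ⊓ LinearMap.ker L := by
    intro L L' L'' t' hL
    apply Submodule.eq_of_le_of_finrank_eq (le_inf hle hL)
    rw [hW.1, t'.finrank2 hV hT]
  by_contra! hc
  have hex : ∀ i : Fin 3, ∃ v ∈ W, (![L0, L1, L2] i) v ≠ 0 := by
    intro i
    by_contra! hno
    fin_cases i
    · exact hc.1 (key _ _ _ t fun v hv => hno v hv)
    · exact hc.2.1 (key _ _ _ t.rot fun v hv => hno v hv)
    · exact hc.2.2 (key _ _ _ t.rot.rot fun v hv => hno v hv)
  obtain ⟨v, hv, hv'⟩ := Module.Dual.exists_forall_mem_ne_zero_of_forall_exists W _ hex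
  have e := t.eq v (hle hv)
  rw [hW.2 v hv] at e
  have h0 := hv' 0
  have h1 := hv' 1
  have h2 := hv' 2
  simp at h0 h1 h2
  simp [h0, h1, h2] at e

end CS

namespace CS
variable {k : Type*} [Field k] {V : Type*} [AddCommGroup V] [Module k V]

/-- the quintic whose zeros are the tritangent planes through a line -/
def DD (T : V →ₗ[k] V →ₗ[k] V →ₗ[k] k) (e1 e2 w : V) : k :=
  4 * T w w w * (T e1 e1 w * T e2 e2 w - T e1 e2 w ^ 2) -
    3 * (T e1 e1 w * T e2 w w ^ 2 - 2 * T e1 e2 w * T e1 w w * T e2 w w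
      + T e2 e2 w * T e1 w w ^ 2)

/-- the directional derivative of `DD` -/
def D1 (T : V →ₗ[k] V →ₗ[k] V →ₗ[k] k) (e1 e2 w z : V) : k :=
  4 * (3 * T w w z) * (T e1 e1 w * T e2 e2 w - T e1 e2 w ^ 2) +
  4 * T w w w * (T e1 e1 z * T e2 e2 w + T e1 e1 w * T e2 e2 z - 2 * T e1 e2 w * T e1 e2 z) -
    3 * (T e1 e1 z * T e2 w w ^ 2 + T e1 e1 w * (2 * T e2 w w * (2 * T e2 w z))
      - 2 * T e1 e2 z * T e1 w w * T e2 w w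
      - 2 * T e1 e2 w * (2 * T e1 w z) * T e2 w w
      - 2 * T e1 e2 w * T e1 w w * (2 * T e2 w z)
      + T e2 e2 z * T e1 w w ^ 2 + T e2 e2 w * (2 * T e1 w w * (2 * T e1 w z)))

variable {T : V →ₗ[k] V →ₗ[k] V →ₗ[k] k}

/-- the trilinear form vanishes on the span of `e1, e2` -/
structure Iso (T : V →ₗ[k] V →ₗ[k] V →ₗ[k] k) (e1 e2 : V) : Prop where
  h111 : T e1 e1 e1 = 0
  h112 : T e1 e1 e2 = 0
  h122 : T e1 e2 e2 = 0
  h222 : T e2 e2 e2 = 0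

lemma exp_eez (hT : Cub T) (e1 e2 z : V) (p q r t : k) :
    T (p • e1 + q • e2) (r • e1 + t • e2) z =
      p * r * T e1 e1 z + (p * t + q * r) * T e1 e2 z + q * t * T e2 e2 z := by
  have h1 := hT.s1 e2 e1 z
  simp only [map_add, map_smul, LinearMap.add_apply, LinearMap.smul_apply, smul_eq_mul, h1]
  ring

lemma exp_eez0 (hT : Cub T) {e1 e2 : V} (hi : Iso T e1 e2) (p q r t x y : k) :
    T (p • e1 + q • e2) (r • e1 + t • e2) (x • e1 + y • e2) = 0 := by
  have h1 : T e1 e2 e1 = 0 := by rw [hT.s2, hi.h112]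
  have h2 : T e2 e2 e1 = 0 := by rw [hT.s2, hT.s1, hi.h122]
  rw [exp_eez hT]
  simp [hi.h111, hi.h112, hi.h122, hi.h222, h1, h2]

lemma exp_eew (hT : Cub T) {e1 e2 : V} (hi : Iso T e1 e2) (w : V) (p q r t x y : k) :
    T (p • e1 + q • e2) (r • e1 + t • e2) (w + (x • e1 + y • e2)) =
      p * r * T e1 e1 w + (p * t + q * r) * T e1 e2 w + q * t * T e2 e2 w := by
  rw [map_add, exp_eez0 hT hi, exp_eez hT, add_zero]

lemma exp_ewz (e1 e2 w z : V) (p q : k) :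
    T (p • e1 + q • e2) w z = p * T e1 w z + q * T e2 w z := by
  simp only [map_add, map_smul, LinearMap.add_apply, LinearMap.smul_apply, smul_eq_mul]

lemma exp_euz (hT : Cub T) (e1 e2 w z : V) (p q x y : k) :
    T (p • e1 + q • e2) (w + (x • e1 + y • e2)) z =
      p * T e1 w z + q * T e2 w z + (p * x * T e1 e1 z + (p * y + q * x) * T e1 e2 z
        + q * y * T e2 e2 z) := by
  rw [map_add, LinearMap.add_apply, exp_ewz, exp_eez hT]

lemma exp_eww (hT : Cub T) {e1 e2 : V} (hi : Iso T e1 e2) (w : V) (p q x y : k) :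
    T (p • e1 + q • e2) (w + (x • e1 + y • e2)) (w + (x • e1 + y • e2)) =
      p * T e1 w w + q * T e2 w w + 2 * (p * x * T e1 e1 w + (p * y + q * x) * T e1 e2 w
        + q * y * T e2 e2 w) := by
  rw [map_add (T (p • e1 + q • e2)), LinearMap.add_apply, exp_eew hT hi, map_add,
    hT.s2 _ w (x • e1 + y • e2), exp_eez hT, exp_ewz]
  ring

lemma exp_wwz (hT : Cub T) (e1 e2 w z : V) (x y : k) :
    T (w + (x • e1 + y • e2)) (w + (x • e1 + y • e2)) z =
      T w w z + 2 * (x * T e1 w z + y * T e2 w z) + (x ^ 2 * T e1 e1 z + 2 * x * y * T e1 e2 z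
        + y ^ 2 * T e2 e2 z) := by
  rw [map_add T, LinearMap.add_apply, LinearMap.add_apply, exp_euz hT, map_add,
    LinearMap.add_apply, hT.s1 w (x • e1 + y • e2), exp_ewz]
  ring

lemma exp_www (hT : Cub T) {e1 e2 : V} (hi : Iso T e1 e2) (w : V) (x y : k) :
    T (w + (x • e1 + y • e2)) (w + (x • e1 + y • e2)) (w + (x • e1 + y • e2)) =
      T w w w + 3 * (x * T e1 w w + y * T e2 w w) + 3 * (x ^ 2 * T e1 e1 w + 2 * x * y * T e1 e2 w
        + y ^ 2 * T e2 e2 w) := by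
  rw [exp_wwz hT e1 e2 w (w + (x • e1 + y • e2))]
  have a1 : T w w e1 = T e1 w w := by rw [hT.s2, hT.s1]
  have a2 : T w w e2 = T e2 w w := by rw [hT.s2, hT.s1]
  have a3 : T e1 w e1 = T e1 e1 w := by rw [hT.s2]
  have a4 : T e1 w e2 = T e1 e2 w := by rw [hT.s2]
  have a5 : T e2 w e1 = T e1 e2 w := by rw [hT.s2, hT.s1]
  have a6 : T e2 w e2 = T e2 e2 w := by rw [hT.s2]
  have a7 : T e1 e2 e1 = 0 := by rw [hT.s2, hi.h112]
  have a8 : T e2 e2 e1 = 0 := by rw [hT.s2, hT.s1, hi.h122]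
  simp only [map_add, map_smul, smul_eq_mul, a1, a2, a3, a4, a5, a6, a7, a8, hi.h111, hi.h112,
    hi.h122, hi.h222]
  ring

lemma DD_inv (hT : Cub T) {e1 e2 : V} (hi : Iso T e1 e2) (w : V) (p q r t x y : k) :
    DD T (p • e1 + q • e2) (r • e1 + t • e2) (w + (x • e1 + y • e2)) =
      (p * t - q * r) ^ 2 * DD T e1 e2 w := by
  simp only [DD, exp_eew hT hi, exp_eww hT hi, exp_www hT hi]
  ring

lemma D1_inv (hT : Cub T) {e1 e2 : V} (hi : Iso T e1 e2) (w z : V) (p q r t x y : k) :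
    D1 T (p • e1 + q • e2) (r • e1 + t • e2) (w + (x • e1 + y • e2)) z =
      (p * t - q * r) ^ 2 * D1 T e1 e2 w z := by
  simp only [D1, exp_eew hT hi, exp_eww hT hi, exp_www hT hi, exp_eez hT, exp_euz hT, exp_wwz hT]
  ring

lemma Iso.change (hT : Cub T) {e1 e2 : V} (hi : Iso T e1 e2) (p q r t : k) :
    Iso T (p • e1 + q • e2) (r • e1 + t • e2) := by
  constructor <;> exact exp_eez0 hT hi _ _ _ _ _ _

lemma exists_det_one {p q : k} (h : p ≠ 0 ∨ q ≠ 0) : ∃ r t : k, p * t - q * r = 1 := by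
  by_cases hp : p = 0
  · have hq : q ≠ 0 := by tauto
    exact ⟨-1 / q, 0, by field_simp; simp⟩
  · exact ⟨0, 1 / p, by field_simp; simp⟩

lemma DD_eq_zero_of_line (hT : Cub T) {e1 e2 : V} (hi : Iso T e1 e2) (w : V) {p q x y : k}
    (hpq : p ≠ 0 ∨ q ≠ 0)
    (h1 : T (p • e1 + q • e2) (p • e1 + q • e2) (w + (x • e1 + y • e2)) = 0)
    (h2 : T (p • e1 + q • e2) (w + (x • e1 + y • e2)) (w + (x • e1 + y • e2)) = 0)
    (h3 : T (w + (x • e1 + y • e2)) (w + (x • e1 + y • e2)) (w + (x • e1 + y • e2)) = 0) :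
    DD T e1 e2 w = 0 := by
  obtain ⟨r, t, hrt⟩ := exists_det_one hpq
  have h := DD_inv hT hi w p q r t x y
  rw [hrt, one_pow, one_mul] at h
  rw [← h, DD, h1, h2, h3]
  ring

lemma DD_smul (e1 e2 w : V) (s : k) : DD T e1 e2 (s • w) = s ^ 5 * DD T e1 e2 w := by
  simp only [DD, map_smul, LinearMap.smul_apply, smul_eq_mul]
  ring

open Polynomial in
/-- the quintic along an affine line -/
noncomputable def pol (T : V →ₗ[k] V →ₗ[k] V →ₗ[k] k) (e1 e2 w z : V) : k[X] :=
  let a : k[X] := C (T e1 e1 z) * X + C (T e1 e1 w)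
  let b : k[X] := C (T e1 e2 z) * X + C (T e1 e2 w)
  let c : k[X] := C (T e2 e2 z) * X + C (T e2 e2 w)
  let d : k[X] := C (T e1 z z) * X ^ 2 + C (2 * T e1 w z) * X + C (T e1 w w)
  let e : k[X] := C (T e2 z z) * X ^ 2 + C (2 * T e2 w z) * X + C (T e2 w w)
  let g : k[X] := C (T z z z) * X ^ 3 + C (3 * T w z z) * X ^ 2 + C (3 * T w w z) * X + C (T w w w)
  C 4 * g * (a * c - b * b) - C 3 * (a * (e * e) - C 2 * b * d * e + c * (d * d))

lemma exp2 (hT : Cub T) (e w z : V) (x : k) :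
    T e (w + x • z) (w + x • z) = T e z z * x ^ 2 + 2 * T e w z * x + T e w w := by
  simp only [map_add, map_smul, LinearMap.add_apply, LinearMap.smul_apply, smul_eq_mul,
    hT.s2 e z w]
  ring

lemma exp3 (hT : Cub T) (w z : V) (x : k) :
    T (w + x • z) (w + x • z) (w + x • z) =
      T z z z * x ^ 3 + 3 * T w z z * x ^ 2 + 3 * T w w z * x + T w w w := by
  have := hT.expand w z 1 x
  simp only [one_smul] at this
  rw [this]
  ring

lemma exp3' (hT : Cub T) (w z : V) (x : k) :
    T (w + x • z) (w + x • z) z = T z z z * x ^ 2 + 2 * T w z z * x + T w w z := by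
  simp only [map_add, map_smul, LinearMap.add_apply, LinearMap.smul_apply, smul_eq_mul,
    hT.s1 z w]
  ring

lemma pol_eval (hT : Cub T) (e1 e2 w z : V) (x : k) :
    (pol T e1 e2 w z).eval x = DD T e1 e2 (w + x • z) := by
  simp only [DD, exp3 hT, pol]
  simp only [exp2 hT]
  simp only [map_add, map_smul, smul_eq_mul]
  simp
  ring

open Polynomial in
lemma pol_deriv (hT : Cub T) (e1 e2 w z : V) (x : k) :
    (derivative (pol T e1 e2 w z)).eval x = D1 T e1 e2 (w + x • z) z := by
  simp only [D1, exp3 hT, exp3' hT, pol]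
  simp only [exp2 hT]
  simp only [map_add, map_smul, smul_eq_mul, LinearMap.add_apply, LinearMap.smul_apply]
  simp
  ring

open Polynomial in
lemma pol_natDegree (e1 e2 w z : V) (h : DD T e1 e2 z ≠ 0) :
    (pol T e1 e2 w z).natDegree = 5 := by
  unfold pol
  simp only []
  compute_degree
  · intro h0
    apply h
    simp only [DD]
    linear_combination h0
  all_goals norm_num

end CS

namespace CS
open Module
variable {k : Type*} [Field k] {V : Type*} [AddCommGroup V] [Module k V]
variable {T : V →ₗ[k] V →ₗ[k] V →ₗ[k] k}

lemma basis_of_frame (hV : finrank k V = 4) (e : Fin 4 → V) (c : Fin 4 → Dual k V)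
    (h : ∀ i j, c i (e j) = if i = j then 1 else 0) :
    ∃ b : Basis (Fin 4) k V, (∀ i, b i = e i) ∧ ∀ i, b.coord i = c i := by
  have : FiniteDimensional k V := Module.finite_of_finrank_pos (by omega)
  have li : LinearIndependent k e := by
    rw [Fintype.linearIndependent_iff]
    intro g hg i
    have := congrArg (c i) hg
    simpa [h] using this
  let b := basisOfLinearIndependentOfCardEqFinrank li (by simp [hV])
  have hb : ∀ i, b i = e i := fun i => by simp [b]
  refine ⟨b, hb, fun i => b.ext fun j => ?_⟩
  rw [hb, h, ← hb]
  simp [Finsupp.single_apply, eq_comm]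

lemma frame_change (hV : finrank k V = 4) (b : Basis (Fin 4) k V) {p q r t : k} (x y : k)
    (hd : p * t - q * r = 1) :
    ∃ b' : Basis (Fin 4) k V, b' 0 = p • b 0 + q • b 1 ∧ b' 1 = r • b 0 + t • b 1 ∧
      b' 2 = b 2 + (x • b 0 + y • b 1) ∧ b' 3 = b 3 ∧ b'.coord 2 = b.coord 2 ∧
      b'.coord 3 = b.coord 3 := by
  obtain ⟨b', h1, h2⟩ := basis_of_frame hV
    ![p • b 0 + q • b 1, r • b 0 + t • b 1, b 2 + (x • b 0 + y • b 1), b 3]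
    ![t • (b.coord 0 - x • b.coord 2) - r • (b.coord 1 - y • b.coord 2),
      p • (b.coord 1 - y • b.coord 2) - q • (b.coord 0 - x • b.coord 2), b.coord 2, b.coord 3] (by
      intro i j
      fin_cases i <;> fin_cases j <;> simp <;> first | ring1 | linear_combination hd)
  exact ⟨b', h1 0, h1 1, h1 2, h1 3, h2 2, h2 3⟩

lemma expand_plane (hT : Cub T) {e1 e2 : V} (hi : Iso T e1 e2) (w : V) (x y s : k) :
    T (x • e1 + y • e2 + s • w) (x • e1 + y • e2 + s • w) (x • e1 + y • e2 + s • w) =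
      s * (3 * (x ^ 2 * T e1 e1 w + 2 * x * y * T e1 e2 w + y ^ 2 * T e2 e2 w) +
        3 * s * (x * T e1 w w + y * T e2 w w) + s ^ 2 * T w w w) := by
  have h := hT.expand (x • e1 + y • e2) w 1 s
  rw [one_smul, exp_eez0 hT hi, exp_eez hT, exp_ewz] at h
  rw [h]
  ring

lemma basis_sum3 (b : Basis (Fin 4) k V) (v : V) (hv : b.coord 3 v = 0) :
    v = b.coord 0 v • b 0 + b.coord 1 v • b 1 + b.coord 2 v • b 2 := by
  have h := b.sum_repr v
  rw [Fin.sum_univ_four] at h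
  simp only [Basis.coord_apply] at hv ⊢
  rw [hv, zero_smul, add_zero] at h
  exact h.symm

lemma basis_sum4 (b : Basis (Fin 4) k V) (v : V) :
    v = b.coord 0 v • b 0 + b.coord 1 v • b 1 + b.coord 2 v • b 2 + b.coord 3 v • b 3 := by
  have h := b.sum_repr v
  rw [Fin.sum_univ_four] at h
  exact h.symm

lemma exists_ker2 {a1 b1 a2 b2 : k} (h : a1 * b2 - a2 * b1 = 0) :
    ∃ y s : k, (y ≠ 0 ∨ s ≠ 0) ∧ a1 * y + b1 * s = 0 ∧ a2 * y + b2 * s = 0 := by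
  by_cases h1 : a1 = 0 ∧ b1 = 0
  · by_cases h2 : a2 = 0 ∧ b2 = 0
    · exact ⟨1, 0, by simp [h1, h2]⟩
    · exact ⟨b2, -a2, by rw [neg_ne_zero]; tauto, by simp [h1], by ring⟩
  · exact ⟨b1, -a1, by rw [neg_ne_zero]; tauto, by ring, by linear_combination -h⟩

variable [IsAlgClosed k] [CharZero k]

lemma nice1 (hT : Cub T) (b : Basis (Fin 4) k V) (hi : Iso T (b 0) (b 1))
    (ha : T (b 0) (b 0) (b 2) = 0) (hb : T (b 0) (b 1) (b 2) = 0) (hd : T (b 0) (b 2) (b 2) = 0) :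
    (∃ L1 L2, Tri T (b.coord 3) (b.coord 2) L1 L2) ∧ D1 T (b 0) (b 1) (b 2) (b 3) ≠ 0 := by
  obtain ⟨a1, b1, a2, b2, h1, h2, h3⟩ := quad_factor (3 * T (b 1) (b 1) (b 2))
    (3 * T (b 1) (b 2) (b 2)) (T (b 2) (b 2) (b 2))
  have t : Tri T (b.coord 3) (b.coord 2) (a1 • b.coord 1 + b1 • b.coord 2)
      (a2 • b.coord 1 + b2 • b.coord 2) := by
    refine ⟨fun h => ?_, fun v hv => ?_⟩
    · have := congrArg (fun f => f (b 3)) h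
      simp at this
    · conv_lhs => rw [basis_sum3 b v hv]
      rw [expand_plane hT hi, ha, hb, hd]
      simp only [LinearMap.add_apply, LinearMap.smul_apply, smul_eq_mul]
      linear_combination (b.coord 2 v) * ((b.coord 1 v) ^ 2 * h1 +
        (b.coord 1 v) * (b.coord 2 v) * h2 + (b.coord 2 v) ^ 2 * h3)
  refine ⟨⟨_, _, t⟩, ?_⟩
  have hdisc : a1 * b2 - a2 * b1 ≠ 0 := by
    intro h
    obtain ⟨y, s, hys, e1, e2⟩ := exists_ker2 h
    refine t.rot.no hT (P := b 0) (Q := y • b 1 + s • b 2) ?_ (by simp) (by simp) (by simp)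
      (by simpa using e1) (by simp) (by simpa using e2)
    rw [LinearIndependent.pair_iff]
    intro u v huv
    have c0 := congrArg (b.coord 0) huv
    have c1 := congrArg (b.coord 1) huv
    have c2 := congrArg (b.coord 2) huv
    simp at c0 c1 c2
    tauto
  have ha1 : T (b 0) (b 0) (b 3) ≠ 0 := by
    intro h
    refine b.ne_zero 0 (hT.ns _ fun w => ?_)
    rw [basis_sum4 b w]
    simp [hi.h111, hi.h112, ha, h]
  have : 3 * D1 T (b 0) (b 1) (b 2) (b 3) = - T (b 0) (b 0) (b 3) * (a1 * b2 - a2 * b1) ^ 2 := by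
    have e : (a1 * b2 - a2 * b1) ^ 2 = (3 * T (b 1) (b 2) (b 2)) ^ 2 -
      4 * (3 * T (b 1) (b 1) (b 2)) * T (b 2) (b 2) (b 2) := by rw [h1, h2, h3]; ring
    rw [e, D1, ha, hb, hd]
    ring
  intro h0
  rw [h0, mul_zero] at this
  simp [ha1, hdisc] at this

lemma nice2 (hT : Cub T) (b : Basis (Fin 4) k V) (hi : Iso T (b 0) (b 1))
    (hd : T (b 0) (b 2) (b 2) = 0) (he : T (b 1) (b 2) (b 2) = 0) (hg : T (b 2) (b 2) (b 2) = 0) :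
    (∃ L1 L2, Tri T (b.coord 3) (b.coord 2) L1 L2) ∧ D1 T (b 0) (b 1) (b 2) (b 3) ≠ 0 := by
  obtain ⟨a1, b1, a2, b2, h1, h2, h3⟩ := quad_factor (3 * T (b 0) (b 0) (b 2))
    (6 * T (b 0) (b 1) (b 2)) (3 * T (b 1) (b 1) (b 2))
  have t : Tri T (b.coord 3) (b.coord 2) (a1 • b.coord 0 + b1 • b.coord 1)
      (a2 • b.coord 0 + b2 • b.coord 1) := by
    refine ⟨fun h => ?_, fun v hv => ?_⟩
    · have := congrArg (fun f => f (b 3)) h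
      simp at this
    · conv_lhs => rw [basis_sum3 b v hv]
      rw [expand_plane hT hi, he, hg, hd]
      simp only [LinearMap.add_apply, LinearMap.smul_apply, smul_eq_mul]
      linear_combination (b.coord 2 v) * ((b.coord 0 v) ^ 2 * h1 +
        (b.coord 0 v) * (b.coord 1 v) * h2 + (b.coord 1 v) ^ 2 * h3)
  refine ⟨⟨_, _, t⟩, ?_⟩
  have hdisc : a1 * b2 - a2 * b1 ≠ 0 := by
    intro h
    obtain ⟨y, s, hys, e1, e2⟩ := exists_ker2 h
    refine t.rot.no hT (P := b 2) (Q := y • b 0 + s • b 1) ?_ (by simp) (by simp) (by simp)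
      (by simpa using e1) (by simp) (by simpa using e2)
    rw [LinearIndependent.pair_iff]
    intro u v huv
    have c0 := congrArg (b.coord 0) huv
    have c1 := congrArg (b.coord 1) huv
    have c2 := congrArg (b.coord 2) huv
    simp at c0 c1 c2
    tauto
  have ha1 : T (b 2) (b 2) (b 3) ≠ 0 := by
    intro h
    refine b.ne_zero 2 (hT.ns _ fun w => ?_)
    have z0 : T (b 2) (b 2) (b 0) = 0 := by rw [hT.s2, hT.s1, hd]
    have z1 : T (b 2) (b 2) (b 1) = 0 := by rw [hT.s2, hT.s1, he]
    rw [basis_sum4 b w]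
    simp [z0, z1, hg, h]
  have : 3 * D1 T (b 0) (b 1) (b 2) (b 3) = - T (b 2) (b 2) (b 3) * (a1 * b2 - a2 * b1) ^ 2 := by
    have e : (a1 * b2 - a2 * b1) ^ 2 = (6 * T (b 0) (b 1) (b 2)) ^ 2 -
      4 * (3 * T (b 0) (b 0) (b 2)) * (3 * T (b 1) (b 1) (b 2)) := by rw [h1, h2, h3]; ring
    rw [e, D1, he, hg, hd]
    ring
  intro h0
  rw [h0, mul_zero] at this
  simp [ha1, hdisc] at this

/-- Zeros of the quintic give split plane sections, and are simple. -/
lemma root_split (hV : finrank k V = 4) (hT : Cub T) (b : Basis (Fin 4) k V)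
    (hi : Iso T (b 0) (b 1)) (h0 : DD T (b 0) (b 1) (b 2) = 0) :
    (∃ L1 L2, Tri T (b.coord 3) (b.coord 2) L1 L2) ∧ D1 T (b 0) (b 1) (b 2) (b 3) ≠ 0 := by
  obtain ⟨v, hv, hMv⟩ := Matrix.exists_mulVec_eq_zero_iff.2
    (show (!![T (b 0) (b 0) (b 2), T (b 0) (b 1) (b 2), T (b 0) (b 2) (b 2);
        T (b 0) (b 1) (b 2), T (b 1) (b 1) (b 2), T (b 1) (b 2) (b 2);
        3 * T (b 0) (b 2) (b 2), 3 * T (b 1) (b 2) (b 2), 4 * T (b 2) (b 2) (b 2)]).det = 0 by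
      rw [Matrix.det_fin_three, ← h0, DD]
      simp
      ring)
  have r0 := congrFun hMv 0
  have r1 := congrFun hMv 1
  have r2 := congrFun hMv 2
  simp [Matrix.mulVec, dotProduct, Fin.sum_univ_three] at r0 r1 r2
  -- reduction to a convenient basis
  suffices H : ∃ p q r t x y : k, p * t - q * r = 1 ∧ ∀ b' : Basis (Fin 4) k V,
      Iso T (b' 0) (b' 1) →
      b' 0 = p • b 0 + q • b 1 → b' 1 = r • b 0 + t • b 1 → b' 2 = b 2 + (x • b 0 + y • b 1) →
      (∃ L1 L2, Tri T (b'.coord 3) (b'.coord 2) L1 L2) ∧ D1 T (b' 0) (b' 1) (b' 2) (b' 3) ≠ 0 by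
    obtain ⟨p, q, r, t, x, y, hd, H⟩ := H
    obtain ⟨b', h1, h2, h3, h4, h5, h6⟩ := frame_change hV b x y hd
    have := H b' (by rw [h1, h2]; exact hi.change hT _ _ _ _) h1 h2 h3
    rw [h5, h6, h1, h2, h3, h4, D1_inv hT hi, hd, one_pow, one_mul] at this
    exact this
  by_cases hv2 : v 2 = 0
  · have hv' : v 0 ≠ 0 ∨ v 1 ≠ 0 := by
      by_contra! hc
      apply hv
      ext i
      fin_cases i
      · exact hc.1
      · exact hc.2
      · exact hv2
    obtain ⟨r, t, hd⟩ := exists_det_one hv'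
    rw [hv2] at r0 r1 r2
    refine ⟨v 0, v 1, r, t, 0, 0, hd, fun b' hi' h1 h2 h3 => nice1 hT b' hi' ?_ ?_ ?_⟩
    · rw [h1, h3, exp_eew hT hi]
      linear_combination v 0 * r0 + v 1 * r1
    · rw [h1, h2, h3, exp_eew hT hi]
      linear_combination r * r0 + t * r1
    · rw [h1, h3, exp_eww hT hi]
      have : (3 : k) ≠ 0 := by norm_num
      apply mul_left_cancel₀ this
      linear_combination r2
  · refine ⟨1, 0, 0, 1, v 0 / (2 * v 2), v 1 / (2 * v 2), by ring,
      fun b' hi' h1 h2 h3 => nice2 hT b' hi' ?_ ?_ ?_⟩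
    · rw [h1, h3, exp_eww hT hi]
      field_simp
      linear_combination r0
    · rw [h2, h3, exp_eww hT hi]
      field_simp
      linear_combination r1
    · rw [h3, exp_www hT hi]
      field_simp
      linear_combination 3 * v 0 * r0 + 3 * v 1 * r1 + v 2 * r2

end CS

namespace CS
open Module
variable {k : Type*} [Field k] {V : Type*} [AddCommGroup V] [Module k V]
variable {T : V →ₗ[k] V →ₗ[k] V →ₗ[k] k}

lemma exists_adapted (hV : finrank k V = 4) (W : Submodule k V) (hW : finrank k W = 2) :
    ∃ b : Basis (Fin 4) k V, b 0 ∈ W ∧ b 1 ∈ W := by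
  have : FiniteDimensional k V := Module.finite_of_finrank_pos (by omega)
  obtain ⟨C, hC⟩ := W.exists_isCompl
  have h2 : finrank k C = 2 := by
    have := Submodule.finrank_add_eq_of_isCompl hC
    omega
  let bW := finBasisOfFinrankEq k W hW
  let bC := finBasisOfFinrankEq k C h2
  let b := ((bW.prod bC).map (Submodule.prodEquivOfIsCompl W C hC)).reindex finSumFinEquiv
  have e0 : finSumFinEquiv.symm (0 : Fin (2 + 2)) = Sum.inl (0 : Fin 2) := by decide
  have e1 : finSumFinEquiv.symm (1 : Fin (2 + 2)) = Sum.inl (1 : Fin 2) := by decide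
  refine ⟨b, ?_, ?_⟩
  · have : b 0 = (bW 0 : V) := by
      simp only [b, Basis.reindex_apply]
      erw [e0]
      simp
    rw [this]; exact (bW 0).2
  · have : b 1 = (bW 1 : V) := by
      simp only [b, Basis.reindex_apply]
      erw [e1]
      simp
    rw [this]; exact (bW 1).2

lemma eq_span_pair [FiniteDimensional k V] {W : Submodule k V} (hW : finrank k W = 2) {P Q : V} (hP : P ∈ W)
    (hQ : Q ∈ W) (hi : LinearIndependent k ![P, Q]) : W = Submodule.span k {P, Q} := by
  symm
  apply Submodule.eq_of_le_of_finrank_eq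
  · rw [Submodule.span_le]
    intro x hx
    rcases hx with rfl | rfl <;> assumption
  · have := finrank_span_eq_card hi
    rw [Matrix.range_cons_cons_empty] at this
    rw [this, hW]; simp

lemma le_of_pair [FiniteDimensional k V] {W X : Submodule k V} (hW : finrank k W = 2) {P Q : V}
    (hP : P ∈ W) (hQ : Q ∈ W) (hi : LinearIndependent k ![P, Q]) (hPX : P ∈ X) (hQX : Q ∈ X) :
    W ≤ X := by
  rw [eq_span_pair hW hP hQ hi, Submodule.span_le]
  intro x hx
  rcases hx with rfl | rfl <;> assumption

lemma basis_pair (b : Basis (Fin 4) k V) : LinearIndependent k ![b 0, b 1] := by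
  rw [LinearIndependent.pair_iff]
  intro s t h
  have c0 := congrArg (b.coord 0) h
  have c1 := congrArg (b.coord 1) h
  simp at c0 c1
  exact ⟨c0, c1⟩

lemma mem_adapted (b : Basis (Fin 4) k V) {W : Submodule k V}
    (hW : finrank k W = 2) (h0 : b 0 ∈ W) (h1 : b 1 ∈ W) (v : V) :
    v ∈ W ↔ b.coord 2 v = 0 ∧ b.coord 3 v = 0 := by
  have : FiniteDimensional k V := b.finiteDimensional_of_finite
  constructor
  · intro hv
    have h := le_of_pair (X := LinearMap.ker (b.coord 2) ⊓ LinearMap.ker (b.coord 3)) hW h0 h1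
      (basis_pair b) (by simp) (by simp) hv
    simpa using h
  · rintro ⟨h2, h3⟩
    rw [basis_sum4 b v, h2, h3]
    simpa using W.add_mem (W.smul_mem _ h0) (W.smul_mem _ h1)

lemma inf_ne_bot_of_le (hV : finrank k V = 4) {X W W' : Submodule k V} (hX : finrank k X = 3)
    (hW : finrank k W = 2) (hW' : finrank k W' = 2) (h : W ≤ X) (h' : W' ≤ X) : W ⊓ W' ≠ ⊥ := by
  have : FiniteDimensional k V := Module.finite_of_finrank_pos (by omega)
  intro hb
  have h1 := Submodule.finrank_sup_add_finrank_inf_eq W W'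
  have h2 := Submodule.finrank_mono (sup_le h h')
  rw [hb, finrank_bot] at h1
  omega

variable [IsAlgClosed k] [CharZero k]

lemma isLine_iso (hT : Cub T) {W : Submodule k V} (hW : IsLine T W) {x y : V} (hx : x ∈ W)
    (hy : y ∈ W) : Iso T x y :=
  ⟨hW.polar3 hT hx hx hx, hW.polar3 hT hx hx hy, hW.polar3 hT hx hy hy, hW.polar3 hT hy hy hy⟩

lemma exists_good (hV : finrank k V = 4) (hT : Cub T) {W : Submodule k V} (hW : IsLine T W) :
    ∃ b : Basis (Fin 4) k V, b 0 ∈ W ∧ b 1 ∈ W ∧ DD T (b 0) (b 1) (b 3) ≠ 0 := by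
  obtain ⟨b, h0, h1⟩ := exists_adapted hV W hW.1
  by_cases hD : DD T (b 0) (b 1) (b 3) = 0
  swap
  · exact ⟨b, h0, h1, hD⟩
  obtain ⟨c, hc, -⟩ := basis_of_frame hV ![b 0, b 1, b 3, b 2]
    ![b.coord 0, b.coord 1, b.coord 3, b.coord 2]
    (by intro i j; fin_cases i <;> fin_cases j <;> simp)
  have c0 : c 0 = b 0 := hc 0
  have c1 : c 1 = b 1 := hc 1
  have c2 : c 2 = b 3 := hc 2
  have c3 : c 3 = b 2 := hc 3
  have hi : Iso T (c 0) (c 1) := by rw [c0, c1]; exact isLine_iso hT hW h0 h1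
  have hr := (root_split hV hT c hi (by rw [c0, c1, c2]; exact hD)).2
  have hp : pol T (c 0) (c 1) (c 2) (c 3) ≠ 0 := by
    intro h
    apply hr
    have := pol_deriv hT (c 0) (c 1) (c 2) (c 3) 0
    rw [h] at this
    simpa using this.symm
  obtain ⟨x, hx⟩ : ∃ x, (pol T (c 0) (c 1) (c 2) (c 3)).eval x ≠ 0 := by
    by_contra! hcon
    exact hp (Polynomial.funext fun x => by simpa using hcon x)
  rw [pol_eval hT] at hx
  obtain ⟨d, hd, -⟩ := basis_of_frame hV ![c 0, c 1, c 3, c 2 + x • c 3]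
    ![c.coord 0, c.coord 1, c.coord 3 - x • c.coord 2, c.coord 2]
    (by intro i j; fin_cases i <;> fin_cases j <;> simp)
  have d0 : d 0 = c 0 := hd 0
  have d1 : d 1 = c 1 := hd 1
  have d3 : d 3 = c 2 + x • c 3 := hd 3
  exact ⟨d, by rw [d0, c0]; exact h0, by rw [d1, c1]; exact h1, by rw [d0, d1, d3]; exact hx⟩

/-- lines different from `ℓ` meeting `ℓ` -/
def Nb (T : V →ₗ[k] V →ₗ[k] V →ₗ[k] k) (ℓ : Submodule k V) : Set (Submodule k V) :=
  {W | IsLine T W ∧ W ≠ ℓ ∧ W ⊓ ℓ ≠ ⊥}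

theorem count10 (hV : finrank k V = 4) (hT : Cub T) {ℓ : Submodule k V} (hl : IsLine T ℓ) :
    (∃ h L0 L1 L2, Tri T h L0 L1 L2 ∧ ℓ = LinearMap.ker h ⊓ LinearMap.ker L0) ∧
      (Nb T ℓ).ncard = 10 := by
  classical
  have : FiniteDimensional k V := Module.finite_of_finrank_pos (by omega)
  obtain ⟨b, h0, h1, hD⟩ := exists_good hV hT hl
  have hi := isLine_iso hT hl h0 h1
  have hmem := mem_adapted b hl.1 h0 h1
  let δ := pol T (b 0) (b 1) (b 2) (b 3)
  have hdeg : δ.natDegree = 5 := pol_natDegree _ _ _ _ hD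
  have hδ : δ ≠ 0 := by
    intro h
    rw [h] at hdeg
    simp at hdeg
  -- at every root the plane section splits and the root is simple
  have key : ∀ x : k, δ.eval x = 0 → (∃ L1 L2, Tri T (b.coord 3 - x • b.coord 2) (b.coord 2) L1 L2) ∧
      (Polynomial.derivative δ).eval x ≠ 0 := by
    intro x hx
    rw [pol_eval hT] at hx
    obtain ⟨c, hc, hc'⟩ := basis_of_frame hV ![b 0, b 1, b 2 + x • b 3, b 3]
      ![b.coord 0, b.coord 1, b.coord 2, b.coord 3 - x • b.coord 2]
      (by intro i j; fin_cases i <;> fin_cases j <;> simp)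
    have c0 : c 0 = b 0 := hc 0
    have c1 : c 1 = b 1 := hc 1
    have c2 : c 2 = b 2 + x • b 3 := hc 2
    have c3 : c 3 = b 3 := hc 3
    have c2' : c.coord 2 = b.coord 2 := hc' 2
    have c3' : c.coord 3 = b.coord 3 - x • b.coord 2 := hc' 3
    have := root_split hV hT c (by rw [c0, c1]; exact hi) (by rw [c0, c1, c2]; exact hx)
    rw [c0, c1, c2, c3, c2', c3', ← pol_deriv hT] at this
    exact this
  have hker : ∀ x : k, ℓ = LinearMap.ker (b.coord 3 - x • b.coord 2) ⊓ LinearMap.ker (b.coord 2) := by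
    intro x
    ext v
    rw [hmem v]
    simp only [Submodule.mem_inf, LinearMap.mem_ker, LinearMap.sub_apply, LinearMap.smul_apply,
      smul_eq_mul]
    constructor
    · rintro ⟨h2, h3⟩
      simp only [h2, h3]; simp
    · rintro ⟨h2, h3⟩
      rw [h3] at h2 ⊢
      simpa using h2
  have hnodup : δ.roots.Nodup := by
    rw [Multiset.nodup_iff_count_le_one]
    intro x
    rw [Polynomial.count_roots]
    by_contra! hc
    have h2 := (Polynomial.one_lt_rootMultiplicity_iff_isRoot hδ).1 hc
    exact (key x h2.1).2 h2.2
  have hcard : δ.roots.toFinset.card = 5 := by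
    rw [Multiset.toFinset_card_of_nodup hnodup, ← hdeg]
    exact (IsAlgClosed.splits δ).natDegree_eq_card_roots.symm
  have hroot : ∀ x, x ∈ δ.roots.toFinset ↔ δ.eval x = 0 := by
    intro x
    simp [hδ]
  choose! L1 L2 hL using fun x hx => (key x hx).1
  constructor
  · obtain ⟨x, hx⟩ : δ.roots.toFinset.Nonempty := by
      rw [← Finset.card_pos]; omega
    rw [hroot] at hx
    exact ⟨_, _, _, _, hL x hx, hker x⟩
  let A : k → Submodule k V := fun x =>
    LinearMap.ker (b.coord 3 - x • b.coord 2) ⊓ LinearMap.ker (L1 x)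
  let B : k → Submodule k V := fun x =>
    LinearMap.ker (b.coord 3 - x • b.coord 2) ⊓ LinearMap.ker (L2 x)
  have hset : Nb T ℓ = ↑(δ.roots.toFinset.biUnion fun x => ({A x, B x} : Finset (Submodule k V))) := by
    ext W
    simp only [Finset.coe_biUnion, Set.mem_iUnion, Finset.mem_coe, Finset.mem_insert,
      Finset.mem_singleton, exists_prop]
    constructor
    · rintro ⟨hW, hne, hmeetx⟩
      obtain ⟨P, hP, hP0⟩ := Submodule.exists_mem_ne_zero_of_ne_bot hmeetx
      obtain ⟨hPW, hPl⟩ := Submodule.mem_inf.1 hP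
      obtain ⟨Q, hQ, hQl⟩ : ∃ Q ∈ W, Q ∉ ℓ := by
        by_contra! hc
        exact hne (Submodule.eq_of_le_of_finrank_eq hc (by rw [hW.1, hl.1]))
      have hPQ : LinearIndependent k ![P, Q] := by
        rw [LinearIndependent.pair_iff]
        intro s t hst
        have ht : t = 0 := by
          by_contra ht
          apply hQl
          have : t • Q ∈ ℓ := by
            rw [eq_neg_of_add_eq_zero_right hst]
            exact ℓ.neg_mem (ℓ.smul_mem _ hPl)
          exact (Submodule.smul_mem_iff ℓ ht).1 this
        rw [ht, zero_smul, add_zero] at hst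
        exact ⟨(smul_eq_zero.1 hst).resolve_right hP0, ht⟩
      have eP := basis_sum4 b P
      rw [((hmem P).1 hPl).1, ((hmem P).1 hPl).2, zero_smul, zero_smul, add_zero, add_zero] at eP
      have eQ : Q = (b.coord 2 Q • b 2 + b.coord 3 Q • b 3) +
          (b.coord 0 Q • b 0 + b.coord 1 Q • b 1) := by
        rw [add_comm, ← add_assoc]; exact basis_sum4 b Q
      set p := b.coord 0 P
      set q := b.coord 1 P
      set s := b.coord 2 Q with hs
      set t := b.coord 3 Q with ht
      have hpq : p ≠ 0 ∨ q ≠ 0 := by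
        by_contra! hc
        rw [hc.1, hc.2] at eP
        simp at eP
        exact hP0 eP
      have hDw : DD T (b 0) (b 1) (s • b 2 + t • b 3) = 0 := by
        refine DD_eq_zero_of_line hT hi _ hpq (x := b.coord 0 Q) (y := b.coord 1 Q) ?_ ?_ ?_
        · rw [← eQ, ← eP]; exact hW.polar3 hT hPW hPW hQ
        · rw [← eQ, ← eP]; exact hW.polar3 hT hPW hQ hQ
        · rw [← eQ]; exact hW.polar3 hT hQ hQ hQ
      have hs0 : s ≠ 0 := by
        intro hs0
        rw [hs0, zero_smul, zero_add, DD_smul] at hDw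
        have ht0 : t = 0 := by simpa [hD] using hDw
        exact hQl ((hmem Q).2 ⟨hs0, ht0⟩)
      have hx : δ.eval (t / s) = 0 := by
        rw [pol_eval hT]
        have e : s • b 2 + t • b 3 = s • (b 2 + (t / s) • b 3) := by
          rw [smul_add, smul_smul, mul_div_cancel₀ _ hs0]
        rw [e, DD_smul] at hDw
        simpa [hs0] using hDw
      refine ⟨t / s, (hroot _).2 hx, ?_⟩
      have hle : W ≤ LinearMap.ker (b.coord 3 - (t / s) • b.coord 2) := by
        apply le_of_pair hW.1 hPW hQ hPQ
        · rw [LinearMap.mem_ker, LinearMap.sub_apply, LinearMap.smul_apply,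
            ((hmem P).1 hPl).1, ((hmem P).1 hPl).2]
          simp
        · rw [LinearMap.mem_ker, LinearMap.sub_apply, LinearMap.smul_apply, ← hs, ← ht, smul_eq_mul]
          field_simp
          simp
      rcases (hL _ hx).mem hV hT hW hle with h | h | h
      · exact absurd (h.trans (hker _).symm) hne
      · exact Or.inl h
      · exact Or.inr h
    · rintro ⟨x, hx, hW⟩
      rw [hroot] at hx
      have t := hL x hx
      have hle : ℓ ≤ LinearMap.ker (b.coord 3 - x • b.coord 2) := by
        rw [hker x]; exact inf_le_left
      rcases hW with rfl | rfl
      · refine ⟨t.swap.isLine hV hT, ?_, ?_⟩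
        · rw [hker x]; exact (t.ne hV hT).symm
        · exact inf_ne_bot_of_le hV (t.ker_finrank hV hT) (t.swap.isLine hV hT).1 hl.1
            inf_le_left hle
      · refine ⟨t.rot.rot.isLine hV hT, ?_, ?_⟩
        · rw [hker x]; exact t.rot.rot.ne hV hT
        · exact inf_ne_bot_of_le hV (t.ker_finrank hV hT) (t.rot.rot.isLine hV hT).1 hl.1
            inf_le_left hle
  rw [hset, Set.ncard_coe_finset, Finset.card_biUnion]
  · rw [Finset.sum_congr rfl (g := fun _ => 2), Finset.sum_const, hcard]
    · rfl
    · intro x hx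
      rw [hroot] at hx
      exact Finset.card_pair ((hL x hx).rot.ne hV hT)
  · intro x hx y hy hxy
    show Disjoint ({A x, B x} : Finset (Submodule k V)) {A y, B y}
    rw [Finset.disjoint_left]
    intro W hWx hWy
    have hWN : W ∈ Nb T ℓ := by
      rw [hset]
      exact Finset.mem_coe.2 (Finset.mem_biUnion.2 ⟨x, Finset.mem_coe.1 hx, hWx⟩)
    have hlx : W ≤ LinearMap.ker (b.coord 3 - x • b.coord 2) := by
      rcases Finset.mem_insert.1 hWx with h | h
      · rw [h]; exact inf_le_left
      · rw [Finset.mem_singleton.1 h]; exact inf_le_left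
    have hly : W ≤ LinearMap.ker (b.coord 3 - y • b.coord 2) := by
      rcases Finset.mem_insert.1 hWy with h | h
      · rw [h]; exact inf_le_left
      · rw [Finset.mem_singleton.1 h]; exact inf_le_left
    apply hWN.2.1
    apply Submodule.eq_of_le_of_finrank_eq _ (by rw [hWN.1.1, hl.1])
    intro v hv
    have e1 := hlx hv
    have e2 := hly hv
    rw [LinearMap.mem_ker, LinearMap.sub_apply, LinearMap.smul_apply, smul_eq_mul] at e1 e2
    have e3 : (x - y) * b.coord 2 v = 0 := by linear_combination e2 - e1
    have e4 : b.coord 2 v = 0 := (mul_eq_zero.1 e3).resolve_left (sub_ne_zero.2 hxy)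
    rw [hmem]
    refine ⟨e4, ?_⟩
    rw [e4] at e1
    simpa using e1

end CS

namespace CS
open Module
variable {k : Type*} [Field k] {V : Type*} [AddCommGroup V] [Module k V]
variable {T : V →ₗ[k] V →ₗ[k] V →ₗ[k] k}
variable [IsAlgClosed k] [CharZero k]

lemma Tri.disj (hV : finrank k V = 4) (hT : Cub T) {h L0 L1 L2 : Dual k V}
    (t : Tri T h L0 L1 L2) {W : Submodule k V} (hW : IsLine T W)
    (h0 : W ⊓ (LinearMap.ker h ⊓ LinearMap.ker L0) ≠ ⊥)
    (h1 : W ⊓ (LinearMap.ker h ⊓ LinearMap.ker L1) ≠ ⊥) : W ≤ LinearMap.ker h := by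
  have : FiniteDimensional k V := Module.finite_of_finrank_pos (by omega)
  obtain ⟨P, hP, hP0⟩ := Submodule.exists_mem_ne_zero_of_ne_bot h0
  obtain ⟨Q, hQ, hQ0⟩ := Submodule.exists_mem_ne_zero_of_ne_bot h1
  simp only [Submodule.mem_inf, LinearMap.mem_ker] at hP hQ
  by_cases hi : LinearIndependent k ![P, Q]
  · exact le_of_pair hW.1 hP.1 hQ.1 hi hP.2.1 hQ.2.1
  · rw [LinearIndependent.pair_iff' hP0] at hi
    push Not at hi
    obtain ⟨a, rfl⟩ := hi
    have ha : a ≠ 0 := by rintro rfl; simp at hQ0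
    have hL1 : L1 P = 0 := by simpa [ha] using hQ.2.2
    by_contra hle
    obtain ⟨w, hw, hhw⟩ := SetLike.not_le_iff_exists.1 hle
    rw [LinearMap.mem_ker] at hhw
    apply hP0
    apply hT.ns
    intro v
    have hv : h (v - (h v / h w) • w) = 0 := by simp [hhw]
    have e1 := t.polar hT hP.2.1 hv hP.2.2 hL1
    rw [map_sub, map_smul, hW.polar hT hP.1 hw] at e1
    simpa using e1

lemma Tri.eight (hV : finrank k V = 4) (hT : Cub T) {h L0 L1 L2 : Dual k V}
    (t : Tri T h L0 L1 L2) (S : Set (Submodule k V))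
    (hS : S = {LinearMap.ker h ⊓ LinearMap.ker L0, LinearMap.ker h ⊓ LinearMap.ker L1,
      LinearMap.ker h ⊓ LinearMap.ker L2}) :
    (Nb T (LinearMap.ker h ⊓ LinearMap.ker L0) \ S).ncard = 8 := by
  have hN := (count10 hV hT (t.isLine hV hT)).2
  set N := Nb T (LinearMap.ker h ⊓ LinearMap.ker L0) with hNd
  have hk := t.ker_finrank hV hT
  have m1 : LinearMap.ker h ⊓ LinearMap.ker L1 ∈ N :=
    ⟨t.rot.isLine hV hT, (t.ne hV hT).symm,
      inf_ne_bot_of_le hV hk (t.rot.isLine hV hT).1 (t.isLine hV hT).1 inf_le_left inf_le_left⟩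
  have m2 : LinearMap.ker h ⊓ LinearMap.ker L2 ∈ N :=
    ⟨t.rot.rot.isLine hV hT, t.rot.rot.ne hV hT,
      inf_ne_bot_of_le hV hk (t.rot.rot.isLine hV hT).1 (t.isLine hV hT).1 inf_le_left inf_le_left⟩
  have e : N \ S = N \ {LinearMap.ker h ⊓ LinearMap.ker L1, LinearMap.ker h ⊓ LinearMap.ker L2} := by
    ext W
    simp only [hS, Set.mem_diff, Set.mem_insert_iff, Set.mem_singleton_iff]
    constructor
    · tauto
    · rintro ⟨a, b⟩
      refine ⟨a, ?_⟩
      rintro (c | c)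
      · exact a.2.1 c
      · exact b c
  rw [e, Set.ncard_diff (by intro x hx; rcases hx with rfl | rfl <;> assumption), hN,
    Set.ncard_pair (t.rot.ne hV hT)]

theorem count27 (hV : finrank k V = 4) (hT : Cub T) {ℓ : Submodule k V} (hl : IsLine T ℓ) :
    {W | IsLine T W}.ncard = 27 := by
  have : FiniteDimensional k V := Module.finite_of_finrank_pos (by omega)
  obtain ⟨⟨h, L0, L1, L2, t, -⟩, -⟩ := count10 hV hT hl
  set W0 := LinearMap.ker h ⊓ LinearMap.ker L0 with hW0
  set W1 := LinearMap.ker h ⊓ LinearMap.ker L1 with hW1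
  set W2 := LinearMap.ker h ⊓ LinearMap.ker L2 with hW2
  set S : Set (Submodule k V) := {W0, W1, W2} with hS
  have c0 : (Nb T W0 \ S).ncard = 8 := t.eight hV hT S rfl
  have c1 : (Nb T W1 \ S).ncard = 8 := t.rot.eight hV hT S (by
    rw [hS]; ext; simp only [Set.mem_insert_iff, Set.mem_singleton_iff]; tauto)
  have c2 : (Nb T W2 \ S).ncard = 8 := t.rot.rot.eight hV hT S (by
    rw [hS]; ext; simp only [Set.mem_insert_iff, Set.mem_singleton_iff]; tauto)
  have n01 : W0 ≠ W1 := t.ne hV hT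
  have n12 : W1 ≠ W2 := t.rot.ne hV hT
  have n20 : W2 ≠ W0 := t.rot.rot.ne hV hT
  have cS : S.ncard = 3 := by
    rw [hS, Set.ncard_eq_three]
    exact ⟨W0, W1, W2, n01, n20.symm, n12, rfl⟩
  have hmem : ∀ W, IsLine T W → W ≤ LinearMap.ker h → W ∈ S := fun W hW hle => t.mem hV hT hW hle
  have d01 : Disjoint (Nb T W0 \ S) (Nb T W1 \ S) := by
    rw [Set.disjoint_left]
    rintro W ⟨a, b⟩ ⟨c, -⟩
    exact b (hmem W a.1 (t.disj hV hT a.1 a.2.2 c.2.2))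
  have d12 : Disjoint (Nb T W1 \ S) (Nb T W2 \ S) := by
    rw [Set.disjoint_left]
    rintro W ⟨a, b⟩ ⟨c, -⟩
    exact b (hmem W a.1 (t.rot.disj hV hT a.1 a.2.2 c.2.2))
  have d02 : Disjoint (Nb T W0 \ S) (Nb T W2 \ S) := by
    rw [Set.disjoint_left]
    rintro W ⟨a, b⟩ ⟨c, -⟩
    exact b (hmem W a.1 (t.rot.rot.disj hV hT a.1 c.2.2 a.2.2))
  have f0 : (Nb T W0 \ S).Finite := Set.finite_of_ncard_ne_zero (by omega)
  have f1 : (Nb T W1 \ S).Finite := Set.finite_of_ncard_ne_zero (by omega)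
  have f2 : (Nb T W2 \ S).Finite := Set.finite_of_ncard_ne_zero (by omega)
  have fS : S.Finite := Set.finite_of_ncard_ne_zero (by omega)
  have e : {W | IsLine T W} = S ∪ ((Nb T W0 \ S) ∪ ((Nb T W1 \ S) ∪ (Nb T W2 \ S))) := by
    ext W
    constructor
    · intro hW
      by_cases hWS : W ∈ S
      · exact Or.inl hWS
      right
      have hWm : W ⊓ LinearMap.ker h ≠ ⊥ := by
        intro hb
        have h1 := finrank_inf_ker W h
        rw [hb, hW.1, finrank_bot] at h1
        omega
      obtain ⟨P, hP, hP0⟩ := Submodule.exists_mem_ne_zero_of_ne_bot hWm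
      simp only [Submodule.mem_inf, LinearMap.mem_ker] at hP
      have e := t.eq P hP.2
      rw [hW.2 P hP.1] at e
      have key : ∀ L : Dual k V, L P = 0 → LinearMap.ker h ⊓ LinearMap.ker L ∈ S →
          W ∈ Nb T (LinearMap.ker h ⊓ LinearMap.ker L) \ S := by
        intro L hL hLS
        refine ⟨⟨hW, ?_, ?_⟩, hWS⟩
        · rintro rfl; exact hWS hLS
        · rw [Submodule.ne_bot_iff]
          exact ⟨P, ⟨hP.1, hP.2, hL⟩, hP0⟩
      rcases mul_eq_zero.1 e.symm with e | e
      · rcases mul_eq_zero.1 e with e | e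
        · exact Or.inl (key L0 e (by simp [hS, hW0]))
        · exact Or.inr (Or.inl (key L1 e (by simp [hS, hW1])))
      · exact Or.inr (Or.inr (key L2 e (by simp [hS, hW2])))
    · rintro ((rfl | rfl | rfl) | h | h | h)
      · exact t.isLine hV hT
      · exact t.rot.isLine hV hT
      · exact t.rot.rot.isLine hV hT
      · exact h.1.1
      · exact h.1.1
      · exact h.1.1
  have dS : Disjoint S ((Nb T W0 \ S) ∪ ((Nb T W1 \ S) ∪ (Nb T W2 \ S))) := by
    rw [Set.disjoint_left]
    rintro W a (b | b | b) <;> exact b.2 a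
  rw [e, Set.ncard_union_eq dS fS (f0.union (f1.union f2)),
    Set.ncard_union_eq (Set.disjoint_union_right.2 ⟨d01, d02⟩) f0 (f1.union f2),
    Set.ncard_union_eq d12 f1 f2, cS, c0, c1, c2]

end CS

namespace CS
open MvPolynomial

section jac
variable {k : Type*} [Field k] {n : ℕ}

lemma chain_rule (p : Fin n → MvPolynomial (Fin n) k) (H : MvPolynomial (Fin n) k) (j : Fin n) :
    pderiv j (aeval p H) = ∑ i, aeval p (pderiv i H) * pderiv j (p i) := by
  induction H using MvPolynomial.induction_on with
  | C a => simp [algebraMap_eq]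
  | add f g hf hg => simp only [map_add, hf, hg, add_mul, Finset.sum_add_distrib]
  | mul_X f l hf =>
    rw [map_mul, aeval_X, Derivation.leibniz, hf, smul_eq_mul, smul_eq_mul]
    simp only [Derivation.leibniz, smul_eq_mul, map_add, map_mul, aeval_X, add_mul,
      Finset.sum_add_distrib, pderiv_X]
    congr 1
    · rw [Finset.sum_eq_single l]
      · simp
      · intro b _ hb
        rw [Pi.single_eq_of_ne (Ne.symm hb)]; simp
      · simp
    · rw [Finset.mul_sum]
      exact Finset.sum_congr rfl fun i _ => by ring

lemma totalDegree_pderiv_le (H : MvPolynomial (Fin n) k) (i : Fin n) (d : ℕ)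
    (h : H.totalDegree ≤ d + 1) : (pderiv i H).totalDegree ≤ d := by
  refine Finset.sup_le fun m hm => ?_
  rw [mem_support_iff, coeff_pderiv] at hm
  have h1 : m + Finsupp.single i 1 ∈ H.support := by
    rw [mem_support_iff]; intro h0; simp [h0] at hm
  have h2 := le_totalDegree h1
  have h3 : ((m + Finsupp.single i 1).sum fun _ e => e) = (m.sum fun _ e => e) + 1 := by
    rw [Finsupp.sum_add_index' (by simp) (by simp)]; simp
  omega

theorem jacobian_criterion [CharZero k] (p : Fin n → MvPolynomial (Fin n) k)
    (hJ : (Matrix.of fun i j => pderiv j (p i)).det ≠ 0) :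
    Function.Injective (aeval p : MvPolynomial (Fin n) k →ₐ[k] MvPolynomial (Fin n) k) := by
  rw [injective_iff_map_eq_zero]
  suffices h : ∀ d : ℕ, ∀ H : MvPolynomial (Fin n) k, H.totalDegree ≤ d → aeval p H = 0 → H = 0 from
    fun H hH => h _ H le_rfl hH
  intro d
  induction d with
  | zero =>
    intro H hd h0
    rw [Nat.le_zero, totalDegree_eq_zero_iff_eq_C] at hd
    rw [hd] at h0 ⊢
    rw [aeval_C, algebraMap_eq] at h0
    exact h0
  | succ d ih =>
    intro H hd h0
    have hv : (fun i => aeval p (pderiv i H)) = 0 := by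
      apply Matrix.eq_zero_of_vecMul_eq_zero hJ
      ext1 j
      have := chain_rule p H j
      rw [h0, map_zero] at this
      exact this.symm
    have hp : ∀ i, pderiv i H = 0 := fun i =>
      ih _ (totalDegree_pderiv_le H i d hd) (congrFun hv i)
    have hC : H = C (coeff 0 H) := by
      ext m
      rw [coeff_C]
      split_ifs with hm
      · rw [hm]
      · obtain ⟨i, hi⟩ : ∃ i, m i ≠ 0 := by
          by_contra! hc
          exact hm (Finsupp.ext fun i => (hc i).symm)
        have e := coeff_pderiv (i := i) H (m - Finsupp.single i 1)
        rw [hp i, coeff_zero, tsub_add_cancel_of_le (by simp; omega)] at e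
        rcases mul_eq_zero.1 e.symm with e | e
        · exact e
        · exfalso; norm_cast at e
    rw [hC] at h0 ⊢
    rw [aeval_C, algebraMap_eq] at h0
    exact h0

end jac

/-- weak Nullstellensatz: a solution in an extension field yields one in `k` -/
lemma exists_sol {k : Type*} [Field k] [IsAlgClosed k] {σ : Type*} [Finite σ] {K : Type*} [Field K]
    [Algebra k K] (S : Set (MvPolynomial σ k)) (x : σ → K) (hx : ∀ p ∈ S, aeval x p = 0) :
    ∃ y : σ → k, ∀ p ∈ S, eval y p = 0 := by
  have hne : RingHom.ker (aeval x : MvPolynomial σ k →ₐ[k] K) ≠ ⊤ := RingHom.ker_ne_top _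
  obtain ⟨M, hM, hle⟩ := Ideal.exists_le_maximal _ hne
  obtain ⟨y, hy⟩ := isMaximal_iff_eq_vanishingIdeal_singleton.1 hM
  refine ⟨y, fun p hp => ?_⟩
  have : p ∈ M := hle (hx p hp)
  rw [hy, mem_vanishingIdeal_singleton_iff] at this
  simpa [aeval_eq_eval] using this

end CS

set_option linter.unusedSimpArgs false
namespace CS
open MvPolynomial

/-- trilinear form with coefficient tensor `t`, over a ring receiving `k` through `φ` -/
def TR {k R : Type*} [CommRing k] [CommRing R] (t : Fin 4 → Fin 4 → Fin 4 → k) (φ : k →+* R)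
    (u v w : Fin 4 → R) : R := ∑ i, ∑ j, ∑ l, φ (t i j l) * u i * v j * w l

section
variable {k R S : Type*} [CommRing k] [CommRing R] [CommRing S] {t : Fin 4 → Fin 4 → Fin 4 → k}

lemma TR_map (φ : k →+* R) (f : R →+* S) (u v w : Fin 4 → R) :
    f (TR t φ u v w) = TR t (f.comp φ) (fun i => f (u i)) (fun i => f (v i)) (fun i => f (w i)) := by
  simp [TR, map_sum]

lemma TR_s1 (h1 : ∀ i j l, t i j l = t j i l) (φ : k →+* R) (u v w : Fin 4 → R) :
    TR t φ u v w = TR t φ v u w := by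
  unfold TR
  rw [Finset.sum_comm]
  refine Finset.sum_congr rfl fun i _ => Finset.sum_congr rfl fun j _ =>
    Finset.sum_congr rfl fun l _ => ?_
  rw [h1]; ring

lemma TR_s2 (h2 : ∀ i j l, t i j l = t i l j) (φ : k →+* R) (u v w : Fin 4 → R) :
    TR t φ u v w = TR t φ u w v := by
  unfold TR
  refine Finset.sum_congr rfl fun i _ => ?_
  rw [Finset.sum_comm]
  refine Finset.sum_congr rfl fun j _ =>
    Finset.sum_congr rfl fun l _ => ?_
  rw [h2]; ring

lemma TR_lin (φ : k →+* R) (a b : R) (u v w x : Fin 4 → R) :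
    TR t φ (a • u + b • v) w x = a * TR t φ u w x + b * TR t φ v w x := by
  simp only [TR, Finset.mul_sum, ← Finset.sum_add_distrib, Pi.add_apply, Pi.smul_apply, smul_eq_mul]
  refine Finset.sum_congr rfl fun i _ => Finset.sum_congr rfl fun j _ =>
    Finset.sum_congr rfl fun l _ => by ring

lemma TR_expand (h1 : ∀ i j l, t i j l = t j i l) (h2 : ∀ i j l, t i j l = t i l j)
    (φ : k →+* R) (a b c d e f : R) (u v : Fin 4 → R) :
    TR t φ (a • u + b • v) (c • u + d • v) (e • u + f • v) =
      a * c * e * TR t φ u u u + (a * c * f + a * d * e + b * c * e) * TR t φ u u v +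
      (a * d * f + b * c * f + b * d * e) * TR t φ u v v + b * d * f * TR t φ v v v := by
  have l2 : ∀ (a b : R) (u v w x : Fin 4 → R),
    TR t φ w (a • u + b • v) x = a * TR t φ w u x + b * TR t φ w v x := by
    intro a b u v w x
    rw [TR_s1 h1, TR_lin, TR_s1 h1 φ u, TR_s1 h1 φ v]
  have l3 : ∀ (a b : R) (u v w x : Fin 4 → R),
    TR t φ w x (a • u + b • v) = a * TR t φ w x u + b * TR t φ w x v := by
    intro a b u v w x
    rw [TR_s2 h2, l2, TR_s2 h2 φ _ u, TR_s2 h2 φ _ v]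
  have e1 : TR t φ v u u = TR t φ u u v := by rw [TR_s1 h1, TR_s2 h2]
  have e2 : TR t φ u v u = TR t φ u u v := by rw [TR_s2 h2]
  have e3 : TR t φ v u v = TR t φ u v v := by rw [TR_s1 h1]
  have e4 : TR t φ v v u = TR t φ u v v := by rw [TR_s2 h2, TR_s1 h1]
  simp only [TR_lin, l2, l3, e1, e2, e3, e4]
  ring

lemma TR_single (φ : k →+* R) (i j l : Fin 4) :
    TR t φ (Pi.single i 1) (Pi.single j 1) (Pi.single l 1) = φ (t i j l) := by
  unfold TR
  rw [Finset.sum_eq_single i, Finset.sum_eq_single j, Finset.sum_eq_single l] <;> simp +contextual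

lemma TR_zero1 (φ : k →+* R) (v w : Fin 4 → R) : TR t φ 0 v w = 0 := by simp [TR]
lemma TR_zero2 (φ : k →+* R) (v w : Fin 4 → R) : TR t φ v 0 w = 0 := by simp [TR]
lemma TR_zero3 (φ : k →+* R) (v w : Fin 4 → R) : TR t φ v w 0 = 0 := by simp [TR]

lemma TR_pderiv {σ : Type*} (s : σ) (u v w : Fin 4 → MvPolynomial σ k) :
    pderiv s (TR t C u v w) = TR t C (fun i => pderiv s (u i)) v w +
      TR t C u (fun i => pderiv s (v i)) w + TR t C u v (fun i => pderiv s (w i)) := by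
  simp only [TR, map_sum, Derivation.leibniz, smul_eq_mul, pderiv_C, ← Finset.sum_add_distrib]
  refine Finset.sum_congr rfl fun i _ => Finset.sum_congr rfl fun j _ =>
    Finset.sum_congr rfl fun l _ => by ring

lemma TR_pderiv0 {σ : Type*} (s : σ) (u v w : Fin 4 → MvPolynomial σ k) (x : σ → k) :
    eval x (pderiv s (TR t C u v w)) =
     TR t (RingHom.id k) (fun i => eval x (pderiv s (u i))) (fun i => eval x (v i)) (fun i => eval x (w i)) +
     TR t (RingHom.id k) (fun i => eval x (u i)) (fun i => eval x (pderiv s (v i))) (fun i => eval x (w i)) +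
     TR t (RingHom.id k) (fun i => eval x (u i)) (fun i => eval x (v i)) (fun i => eval x (pderiv s (w i))) := by
  have hc : (eval x).comp (C : k →+* MvPolynomial σ k) = RingHom.id k := by ext; simp
  rw [TR_pderiv, map_add, map_add, TR_map, TR_map, TR_map, hc]

end

section field
variable {k : Type*} [Field k] {t : Fin 4 → Fin 4 → Fin 4 → k}

lemma jac_ne (h1 : ∀ i j l, t i j l = t j i l) (h2 : ∀ i j l, t i j l = t i l j) [CharZero k]
    (hA : t 0 0 2 = 0) (hB : t 0 0 3 ≠ 0)
    (hC : 4 * t 0 1 2 ^ 2 * t 1 1 3 - 4 * t 0 1 2 * t 0 1 3 * t 1 1 2 + t 0 0 3 * t 1 1 2 ^ 2 ≠ 0)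
    (u v : Fin 4 → MvPolynomial (Fin 4) k)
    (hu : u = ![1, 0, X 0, X 1]) (hv : v = ![0, 1, X 2, X 3]) :
    (Matrix.of fun i j => pderiv j (![TR t C u u u, TR t C u u v, TR t C u v v, TR t C v v v] i)).det
      ≠ 0 := by
  intro h0
  have h := congrArg (eval (0 : Fin 4 → k)) h0
  rw [RingHom.map_det, map_zero] at h
  have eu : (fun i => eval (0 : Fin 4 → k) (u i)) = Pi.single 0 1 := by
    ext i; fin_cases i <;> simp [hu]
  have ev : (fun i => eval (0 : Fin 4 → k) (v i)) = Pi.single 1 1 := by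
    ext i; fin_cases i <;> simp [hv]
  have du0 : (fun i => eval (0 : Fin 4 → k) (pderiv 0 (u i))) = Pi.single 2 1 := by
    ext i; fin_cases i <;> simp [hu, pderiv_X]
  have du1 : (fun i => eval (0 : Fin 4 → k) (pderiv 1 (u i))) = Pi.single 3 1 := by
    ext i; fin_cases i <;> simp [hu, pderiv_X]
  have du2 : (fun i => eval (0 : Fin 4 → k) (pderiv 2 (u i))) = 0 := by
    ext i; fin_cases i <;> simp [hu, pderiv_X]
  have du3 : (fun i => eval (0 : Fin 4 → k) (pderiv 3 (u i))) = 0 := by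
    ext i; fin_cases i <;> simp [hu, pderiv_X]
  have dv0 : (fun i => eval (0 : Fin 4 → k) (pderiv 0 (v i))) = 0 := by
    ext i; fin_cases i <;> simp [hv, pderiv_X]
  have dv1 : (fun i => eval (0 : Fin 4 → k) (pderiv 1 (v i))) = 0 := by
    ext i; fin_cases i <;> simp [hv, pderiv_X]
  have dv2 : (fun i => eval (0 : Fin 4 → k) (pderiv 2 (v i))) = Pi.single 2 1 := by
    ext i; fin_cases i <;> simp [hv, pderiv_X]
  have dv3 : (fun i => eval (0 : Fin 4 → k) (pderiv 3 (v i))) = Pi.single 3 1 := by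
    ext i; fin_cases i <;> simp [hv, pderiv_X]
  have a1 : ∀ x y z, t z x y = t x y z := fun x y z => by rw [h1, h2]
  have a2 : ∀ x y z, t x z y = t x y z := fun x y z => by rw [h2]
  have row0 : ∀ j, TR t (RingHom.id k) (fun i => eval 0 (pderiv j (u i))) (Pi.single 0 1) (Pi.single 0 1) +
      TR t (RingHom.id k) (Pi.single 0 1) (fun i => eval 0 (pderiv j (u i))) (Pi.single 0 1) +
      TR t (RingHom.id k) (Pi.single 0 1) (Pi.single 0 1) (fun i => eval 0 (pderiv j (u i))) =
      ![3 * t 0 0 2, 3 * t 0 0 3, 0, 0] j := by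
    intro j
    fin_cases j <;>
    simp only [Fin.zero_eta, Fin.mk_one, Fin.reduceFinMk, du0, du1, du2, du3, dv0, dv1,
        dv2, dv3, TR_single, TR_zero1, TR_zero2, TR_zero3, RingHom.id_apply, a1 0 0, a1 0 1, a1 1 0,
        a1 1 1, a2 0 0, a2 0 1, a2 1 0, a2 1 1, h1 1 0] <;>
    simp <;> ring
  have row1 : ∀ j, TR t (RingHom.id k) (fun i => eval 0 (pderiv j (u i))) (Pi.single 0 1) (Pi.single 1 1) +
      TR t (RingHom.id k) (Pi.single 0 1) (fun i => eval 0 (pderiv j (u i))) (Pi.single 1 1) +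
      TR t (RingHom.id k) (Pi.single 0 1) (Pi.single 0 1) (fun i => eval 0 (pderiv j (v i))) =
      ![2 * t 0 1 2, 2 * t 0 1 3, t 0 0 2, t 0 0 3] j := by
    intro j
    fin_cases j <;>
    simp only [Fin.zero_eta, Fin.mk_one, Fin.reduceFinMk, du0, du1, du2, du3, dv0, dv1,
        dv2, dv3, TR_single, TR_zero1, TR_zero2, TR_zero3, RingHom.id_apply, a1 0 0, a1 0 1, a1 1 0,
        a1 1 1, a2 0 0, a2 0 1, a2 1 0, a2 1 1, h1 1 0] <;>
    simp <;> ring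
  have row2 : ∀ j, TR t (RingHom.id k) (fun i => eval 0 (pderiv j (u i))) (Pi.single 1 1) (Pi.single 1 1) +
      TR t (RingHom.id k) (Pi.single 0 1) (fun i => eval 0 (pderiv j (v i))) (Pi.single 1 1) +
      TR t (RingHom.id k) (Pi.single 0 1) (Pi.single 1 1) (fun i => eval 0 (pderiv j (v i))) =
      ![t 1 1 2, t 1 1 3, 2 * t 0 1 2, 2 * t 0 1 3] j := by
    intro j
    fin_cases j <;>
    simp only [Fin.zero_eta, Fin.mk_one, Fin.reduceFinMk, du0, du1, du2, du3, dv0, dv1,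
        dv2, dv3, TR_single, TR_zero1, TR_zero2, TR_zero3, RingHom.id_apply, a1 0 0, a1 0 1, a1 1 0,
        a1 1 1, a2 0 0, a2 0 1, a2 1 0, a2 1 1, h1 1 0] <;>
    simp <;> ring
  have row3 : ∀ j, TR t (RingHom.id k) (fun i => eval 0 (pderiv j (v i))) (Pi.single 1 1) (Pi.single 1 1) +
      TR t (RingHom.id k) (Pi.single 1 1) (fun i => eval 0 (pderiv j (v i))) (Pi.single 1 1) +
      TR t (RingHom.id k) (Pi.single 1 1) (Pi.single 1 1) (fun i => eval 0 (pderiv j (v i))) =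
      ![0, 0, 3 * t 1 1 2, 3 * t 1 1 3] j := by
    intro j
    fin_cases j <;>
    simp only [Fin.zero_eta, Fin.mk_one, Fin.reduceFinMk, du0, du1, du2, du3, dv0, dv1,
        dv2, dv3, TR_single, TR_zero1, TR_zero2, TR_zero3, RingHom.id_apply, a1 0 0, a1 0 1, a1 1 0,
        a1 1 1, a2 0 0, a2 0 1, a2 1 0, a2 1 1, h1 1 0] <;>
    simp <;> ring
  have hm : (eval (0 : Fin 4 → k)).mapMatrix
      (Matrix.of fun i j => pderiv j (![TR t C u u u, TR t C u u v, TR t C u v v, TR t C v v v] i)) =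
      !![3 * t 0 0 2, 3 * t 0 0 3, 0, 0; 2 * t 0 1 2, 2 * t 0 1 3, t 0 0 2, t 0 0 3;
        t 1 1 2, t 1 1 3, 2 * t 0 1 2, 2 * t 0 1 3; 0, 0, 3 * t 1 1 2, 3 * t 1 1 3] := by
    ext i j
    fin_cases i
    · show eval 0 (pderiv j (TR t C u u u)) = (![3 * t 0 0 2, 3 * t 0 0 3, 0, 0] : Fin 4 → k) j
      rw [TR_pderiv0]
      simp only [eu, ev]
      exact row0 j
    · show eval 0 (pderiv j (TR t C u u v)) = (![2 * t 0 1 2, 2 * t 0 1 3, t 0 0 2, t 0 0 3] : Fin 4 → k) j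
      rw [TR_pderiv0]
      simp only [eu, ev]
      exact row1 j
    · show eval 0 (pderiv j (TR t C u v v)) = (![t 1 1 2, t 1 1 3, 2 * t 0 1 2, 2 * t 0 1 3] : Fin 4 → k) j
      rw [TR_pderiv0]
      simp only [eu, ev]
      exact row2 j
    · show eval 0 (pderiv j (TR t C v v v)) = (![0, 0, 3 * t 1 1 2, 3 * t 1 1 3] : Fin 4 → k) j
      rw [TR_pderiv0]
      simp only [eu, ev]
      exact row3 j
  rw [hm] at h
  have : t 0 0 3 * (4 * t 0 1 2 ^ 2 * t 1 1 3 - 4 * t 0 1 2 * t 0 1 3 * t 1 1 2 + t 0 0 3 * t 1 1 2 ^ 2) = 0 := by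
    simp [Matrix.det_succ_row_zero, Fin.sum_univ_succ, Fin.succAbove, hA] at h
    rcases h with h | h
    · rw [h, zero_mul]
    · linear_combination (t 0 0 3 / 3) * h
  rcases mul_eq_zero.1 this with h | h
  · exact hB h
  · exact hC h

end field

end CS

namespace CS
open MvPolynomial

lemma exists_valuation {k : Type*} [Field k] {K : Type*} [Field K]
    (ψ : MvPolynomial (Fin 4) k →+* K) (hψ : Function.Injective ψ) :
    ∃ B : ValuationSubring K, (∀ x, ψ x ∈ B) ∧ ∀ i, ψ (X i) ∈ B.nonunits := by
  let e : MvPolynomial (Fin 4) k ≃+* ψ.range :=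
    RingEquiv.ofBijective ψ.rangeRestrict
      ⟨fun x y h => hψ (congrArg Subtype.val h), ψ.rangeRestrict_surjective⟩
  let I : Ideal ψ.range :=
    (RingHom.ker (constantCoeff : MvPolynomial (Fin 4) k →+* k)).comap (e.symm : ψ.range →+* _)
  have hI : I ≠ ⊤ := Ideal.comap_ne_top _ (RingHom.ker_ne_top _)
  obtain ⟨B, hB, hB'⟩ := Ideal.image_subset_nonunits_valuationSubring I hI
  refine ⟨B, fun x => hB ⟨x, rfl⟩, fun i => hB' ⟨e (X i), ?_, rfl⟩⟩
  show constantCoeff (e.symm (e (X i))) = 0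
  simp

/-- the specialisation argument -/
lemma specialise {k : Type*} [Field k] {t : Fin 4 → Fin 4 → Fin 4 → k}
    (h1 : ∀ i j l, t i j l = t j i l) (h2 : ∀ i j l, t i j l = t i l j)
    {K : Type*} [Field K] (φ : k →+* K) (B : ValuationSubring K) (hφ : ∀ a, φ a ∈ B)
    (u v : Fin 4 → K) (hu0 : u 0 = 1) (hu1 : u 1 = 0) (hv0 : v 0 = 0) (hv1 : v 1 = 1)
    (q0 : TR t φ u u u ∈ B.nonunits) (q1 : TR t φ u u v ∈ B.nonunits)
    (q2 : TR t φ u v v ∈ B.nonunits) (q3 : TR t φ v v v ∈ B.nonunits) :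
    ∃ (φ' : k →+* IsLocalRing.ResidueField B) (a b : Fin 4 → IsLocalRing.ResidueField B)
      (i j : Fin 4), a i = 1 ∧ a j = 0 ∧ b i = 0 ∧ b j = 1 ∧ TR t φ' a a a = 0 ∧ TR t φ' a a b = 0 ∧
      TR t φ' a b b = 0 ∧ TR t φ' b b b = 0 := by
  let φB : k →+* B := φ.codRestrict B hφ
  obtain ⟨⟨i, j⟩, -, hmax⟩ := Finset.exists_max_image (Finset.univ : Finset (Fin 4 × Fin 4))
    (fun x => B.valuation (u x.1 * v x.2 - u x.2 * v x.1)) ⟨(0, 1), Finset.mem_univ _⟩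
  set M : K := u i * v j - u j * v i with hM
  have hmax' : ∀ a b, B.valuation (u a * v b - u b * v a) ≤ B.valuation M :=
    fun a b => hmax (a, b) (Finset.mem_univ _)
  have hM0 : M ≠ 0 := by
    intro h
    have := hmax' 0 1
    rw [h, hu0, hu1, hv0, hv1] at this
    simp at this
  have hdiv : ∀ a b, (u a * v b - u b * v a) / M ∈ B := by
    intro a b
    rw [← B.valuation_le_one_iff, map_div₀]
    exact div_le_one_of_le₀ (hmax' a b) zero_le
  let a : Fin 4 → B := fun l => ⟨_, hdiv l j⟩
  let b : Fin 4 → B := fun l => ⟨_, hdiv i l⟩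
  have mem : ∀ x : K, x ∈ B.nonunits → ∃ y : B, y ∈ IsLocalRing.maximalIdeal B ∧ (y : K) = x := by
    intro x hx
    rw [ValuationSubring.mem_nonunits_iff_exists_mem_maximalIdeal] at hx
    obtain ⟨hx, h⟩ := hx
    exact ⟨_, h, rfl⟩
  obtain ⟨y0, m0, e0⟩ := mem _ q0
  obtain ⟨y1, m1, e1⟩ := mem _ q1
  obtain ⟨y2, m2, e2⟩ := mem _ q2
  obtain ⟨y3, m3, e3⟩ := mem _ q3
  have ha : (fun l => ((a l : B) : K)) = (a 0 : K) • u + (a 1 : K) • v := by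
    ext l
    simp only [a, Pi.add_apply, Pi.smul_apply, smul_eq_mul, hu0, hu1, hv0, hv1]
    ring
  have hb : (fun l => ((b l : B) : K)) = (b 0 : K) • u + (b 1 : K) • v := by
    ext l
    simp only [b, Pi.add_apply, Pi.smul_apply, smul_eq_mul, hu0, hu1, hv0, hv1]
    ring
  have hcomp : (B.subtype).comp φB = φ := by ext; rfl
  have key : ∀ (c d e : Fin 4 → B), (fun l => ((c l : B) : K)) = (c 0 : K) • u + (c 1 : K) • v →
      (fun l => ((d l : B) : K)) = (d 0 : K) • u + (d 1 : K) • v →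
      (fun l => ((e l : B) : K)) = (e 0 : K) • u + (e 1 : K) • v →
      TR t φB c d e ∈ IsLocalRing.maximalIdeal B := by
    intro c d e hc hd he
    have : TR t φB c d e = c 0 * d 0 * e 0 * y0 +
        (c 0 * d 0 * e 1 + c 0 * d 1 * e 0 + c 1 * d 0 * e 0) * y1 +
        (c 0 * d 1 * e 1 + c 1 * d 0 * e 1 + c 1 * d 1 * e 0) * y2 + c 1 * d 1 * e 1 * y3 := by
      apply Subtype.ext
      have := TR_map (t := t) φB B.subtype c d e
      rw [hcomp] at this
      refine this.trans ?_
      have hx := TR_expand h1 h2 φ (c 0 : K) (c 1 : K) (d 0 : K) (d 1 : K) (e 0 : K) (e 1 : K) u v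
      rw [← hc, ← hd, ← he] at hx
      refine hx.trans ?_
      rw [← e0, ← e1, ← e2, ← e3]
      rfl
    rw [this]
    exact Ideal.add_mem _ (Ideal.add_mem _ (Ideal.add_mem _ (Ideal.mul_mem_left _ _ m0)
      (Ideal.mul_mem_left _ _ m1)) (Ideal.mul_mem_left _ _ m2)) (Ideal.mul_mem_left _ _ m3)
  have key2 : ∀ (c d e : Fin 4 → B), TR t φB c d e ∈ IsLocalRing.maximalIdeal B →
      TR t ((IsLocalRing.residue B).comp φB) (fun l => IsLocalRing.residue B (c l))
        (fun l => IsLocalRing.residue B (d l)) (fun l => IsLocalRing.residue B (e l)) = 0 := by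
    intro c d e h
    rw [← TR_map, IsLocalRing.residue_eq_zero_iff]
    exact h
  have ai : a i = 1 := Subtype.ext (div_self hM0)
  have bj : b j = 1 := Subtype.ext (div_self hM0)
  have aj : a j = 0 := Subtype.ext (by simp [a])
  have bi : b i = 0 := Subtype.ext (by simp [b])
  refine ⟨(IsLocalRing.residue B).comp φB, fun l => IsLocalRing.residue B (a l),
    fun l => IsLocalRing.residue B (b l), i, j, by simp [ai], by simp [aj], by simp [bi],
    by simp [bj], ?_, ?_, ?_, ?_⟩
  · exact key2 _ _ _ (key _ _ _ ha ha ha)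
  · exact key2 _ _ _ (key _ _ _ ha ha hb)
  · exact key2 _ _ _ (key _ _ _ ha hb hb)
  · exact key2 _ _ _ (key _ _ _ hb hb hb)

/-- back to `k` by the Nullstellensatz -/
lemma descend {k : Type*} [Field k] [IsAlgClosed k] {t : Fin 4 → Fin 4 → Fin 4 → k}
    {κ : Type*} [Field κ] (φ : k →+* κ) (a b : Fin 4 → κ) (i j : Fin 4)
    (ai : a i = 1) (aj : a j = 0) (bi : b i = 0) (bj : b j = 1)
    (q0 : TR t φ a a a = 0) (q1 : TR t φ a a b = 0) (q2 : TR t φ a b b = 0)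
    (q3 : TR t φ b b b = 0) :
    ∃ x y : Fin 4 → k, x i = 1 ∧ x j = 0 ∧ y i = 0 ∧ y j = 1 ∧ TR t (RingHom.id k) x x x = 0 ∧
      TR t (RingHom.id k) x x y = 0 ∧ TR t (RingHom.id k) x y y = 0 ∧
      TR t (RingHom.id k) y y y = 0 := by
  let _ : Algebra k κ := φ.toAlgebra
  let U : Fin 4 → MvPolynomial (Fin 4 ⊕ Fin 4) k := fun l => X (Sum.inl l)
  let V : Fin 4 → MvPolynomial (Fin 4 ⊕ Fin 4) k := fun l => X (Sum.inr l)
  let S : Set (MvPolynomial (Fin 4 ⊕ Fin 4) k) := {U i - 1, U j, V i, V j - 1, TR t C U U U,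
    TR t C U U V, TR t C U V V, TR t C V V V}
  let z : Fin 4 ⊕ Fin 4 → κ := Sum.elim a b
  have hT : ∀ c d e, aeval z (TR t C c d e) = TR t φ (fun l => aeval z (c l))
      (fun l => aeval z (d l)) (fun l => aeval z (e l)) := by
    intro c d e
    have := TR_map (t := t) C (aeval z : MvPolynomial (Fin 4 ⊕ Fin 4) k →ₐ[k] κ).toRingHom c d e
    have hc : (aeval z : MvPolynomial (Fin 4 ⊕ Fin 4) k →ₐ[k] κ).toRingHom.comp C = φ := by
      ext x; simp; rfl
    rw [hc] at this
    exact this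
  have hU : (fun l => aeval z (U l)) = a := by ext l; simp [U, z]
  have hV : (fun l => aeval z (V l)) = b := by ext l; simp [V, z]
  obtain ⟨y, hy⟩ := exists_sol S z (by
    intro p hp
    rcases hp with rfl | rfl | rfl | rfl | rfl | rfl | rfl | rfl
    · rw [map_sub, map_one, congrFun hU i, ai, sub_self]
    · rw [congrFun hU j, aj]
    · rw [congrFun hV i, bi]
    · rw [map_sub, map_one, congrFun hV j, bj, sub_self]
    · rw [hT, hU, q0]
    · rw [hT, hU, hV, q1]
    · rw [hT, hU, hV, q2]
    · rw [hT, hV, q3])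
  have hT' : ∀ c d e, eval y (TR t C c d e) = TR t (RingHom.id k) (fun l => eval y (c l))
      (fun l => eval y (d l)) (fun l => eval y (e l)) := by
    intro c d e
    have hc : (eval y).comp (C : k →+* MvPolynomial (Fin 4 ⊕ Fin 4) k) = RingHom.id k := by ext; simp
    rw [TR_map, hc]
  refine ⟨fun l => eval y (U l), fun l => eval y (V l), ?_, ?_, ?_, ?_, ?_, ?_, ?_, ?_⟩
  · have := hy (U i - 1) (by simp [S])
    rwa [map_sub, map_one, sub_eq_zero] at this
  · exact hy (U j) (by simp [S])
  · exact hy (V i) (by simp [S])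
  · have := hy (V j - 1) (by simp [S])
    rwa [map_sub, map_one, sub_eq_zero] at this
  · rw [← hT']; exact hy _ (by simp [S])
  · rw [← hT']; exact hy _ (by simp [S])
  · rw [← hT']; exact hy _ (by simp [S])
  · rw [← hT']; exact hy _ (by simp [S])

theorem exists_line_coord {k : Type*} [Field k] [IsAlgClosed k] [CharZero k]
    {t : Fin 4 → Fin 4 → Fin 4 → k}
    (h1 : ∀ i j l, t i j l = t j i l) (h2 : ∀ i j l, t i j l = t i l j)
    (hA : t 0 0 2 = 0) (hB : t 0 0 3 ≠ 0)
    (hC : 4 * t 0 1 2 ^ 2 * t 1 1 3 - 4 * t 0 1 2 * t 0 1 3 * t 1 1 2 + t 0 0 3 * t 1 1 2 ^ 2 ≠ 0) :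
    ∃ (x y : Fin 4 → k) (i j : Fin 4), x i = 1 ∧ x j = 0 ∧ y i = 0 ∧ y j = 1 ∧
      TR t (RingHom.id k) x x x = 0 ∧
      TR t (RingHom.id k) x x y = 0 ∧ TR t (RingHom.id k) x y y = 0 ∧
      TR t (RingHom.id k) y y y = 0 := by
  let u : Fin 4 → MvPolynomial (Fin 4) k := ![1, 0, X 0, X 1]
  let v : Fin 4 → MvPolynomial (Fin 4) k := ![0, 1, X 2, X 3]
  let p : Fin 4 → MvPolynomial (Fin 4) k := ![TR t C u u u, TR t C u u v, TR t C u v v, TR t C v v v]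
  have hinj := jacobian_criterion p (jac_ne h1 h2 hA hB hC u v rfl rfl)
  let K := FractionRing (MvPolynomial (Fin 4) k)
  let ι : MvPolynomial (Fin 4) k →+* K := algebraMap _ _
  have hι : Function.Injective ι := IsFractionRing.injective _ _
  let ψ : MvPolynomial (Fin 4) k →+* K :=
    ι.comp (aeval p : MvPolynomial (Fin 4) k →ₐ[k] MvPolynomial (Fin 4) k).toRingHom
  obtain ⟨B, hB1, hB2⟩ := exists_valuation ψ (hι.comp hinj)
  have hX : ∀ i, ψ (X i) = ι (p i) := fun i => congrArg ι (aeval_X p i)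
  have hCc : ∀ a, ψ (C a) = ι (C a) := fun a => congrArg ι (aeval_C p a)
  have hq : ∀ c d e, TR t (ι.comp C) (fun l => ι (c l)) (fun l => ι (d l)) (fun l => ι (e l)) =
      ι (TR t C c d e) := fun c d e => (TR_map _ _ _ _ _).symm
  obtain ⟨φ', a, b, i, j, ai, aj, bi, bj, q0, q1, q2, q3⟩ := specialise h1 h2 (ι.comp C) B
    (fun a => by have := hB1 (C a); rw [hCc] at this; exact this)
    (fun l => ι (u l)) (fun l => ι (v l)) (by simp [u]) (by simp [u]) (by simp [v]) (by simp [v])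
    (by rw [hq]; have := hB2 0; rw [hX] at this; exact this)
    (by rw [hq]; have := hB2 1; rw [hX] at this; exact this)
    (by rw [hq]; have := hB2 2; rw [hX] at this; exact this)
    (by rw [hq]; have := hB2 3; rw [hX] at this; exact this)
  obtain ⟨x, y, h⟩ := descend φ' a b i j ai aj bi bj q0 q1 q2 q3
  exact ⟨x, y, i, j, h⟩

end CS

namespace CS
open Module
variable {k : Type*} [Field k] {V : Type*} [AddCommGroup V] [Module k V]
variable {T : V →ₗ[k] V →ₗ[k] V →ₗ[k] k}

lemma T_sum (E : Fin 4 → V) (x y z : Fin 4 → k) :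
    T (∑ i, x i • E i) (∑ i, y i • E i) (∑ i, z i • E i) =
      TR (fun i j l => T (E i) (E j) (E l)) (RingHom.id k) x y z := by
  unfold TR
  rw [map_sum T, LinearMap.sum_apply, LinearMap.sum_apply]
  refine Finset.sum_congr rfl fun i _ => ?_
  rw [map_sum (T _), LinearMap.sum_apply]
  refine Finset.sum_congr rfl fun j _ => ?_
  rw [map_sum]
  refine Finset.sum_congr rfl fun l _ => ?_
  simp only [map_smul, LinearMap.smul_apply, smul_eq_mul, RingHom.id_apply]
  ring

lemma avoid [Infinite k] [FiniteDimensional k V] (p q r : Submodule k V) (hp : p ≠ ⊤) (hq : q ≠ ⊤)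
    (hr : r ≠ ⊤) : ∃ v, v ∉ p ∧ v ∉ q ∧ v ∉ r := by
  obtain ⟨v, hv⟩ := Submodule.exists_forall_notMem_of_forall_ne_top ![p, q, r] (by
    intro i; fin_cases i <;> assumption)
  exact ⟨v, hv 0, hv 1, hv 2⟩

variable [IsAlgClosed k] [CharZero k]

theorem exists_line (hV : finrank k V = 4) (hT : Cub T) : ∃ ℓ : Submodule k V, IsLine T ℓ := by
  have : FiniteDimensional k V := Module.finite_of_finrank_pos (by omega)
  have hspan : ∀ {n : ℕ} (f : Fin n → V), n < 4 → Submodule.span k (Set.range f) ≠ ⊤ := by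
    intro n f hn h
    have := finrank_range_le_card (R := k) f
    rw [Set.finrank, h, finrank_top, hV, Fintype.card_fin] at this
    omega
  have hker : ∀ v, v ≠ 0 → LinearMap.ker (T v v) ≠ ⊤ := by
    intro v hv h
    rw [LinearMap.ker_eq_top] at h
    exact hv (hT.ns v fun w => by rw [h]; rfl)
  let f := finBasisOfFinrankEq k V hV
  obtain ⟨e2, h2s, h2k, -⟩ := avoid (Submodule.span k (Set.range ![f 0, f 1]))
    (LinearMap.ker (T (f 0) (f 0))) _ (hspan _ (by norm_num)) (hker _ (f.ne_zero 0)) (hker _ (f.ne_zero 0))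
  rw [LinearMap.mem_ker] at h2k
  obtain ⟨x, y, hxy, hq⟩ := quad_zero (T (f 0) (f 0) e2) (2 * T (f 0) (f 1) e2) (T (f 1) (f 1) e2)
  have hy : y ≠ 0 := by
    rintro rfl
    simp [h2k] at hq
    simp [hq] at hxy
  obtain ⟨e0, he0⟩ : ∃ e0, e0 = x • f 0 + y • f 1 := ⟨_, rfl⟩
  obtain ⟨e1, he1⟩ : ∃ e1, e1 = f 0 := ⟨_, rfl⟩
  have hA : T e0 e0 e2 = 0 := by
    rw [he0, hT.expand2]; linear_combination hq
  have hf : LinearIndependent k ![f 0, f 1] := basis_pair f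
  have hi : ∀ s t : k, s • e0 + t • e1 = 0 → s = 0 ∧ t = 0 := by
    intro s t h
    have h' : (s * x + t) • f 0 + (s * y) • f 1 = 0 := by
      rw [← h, he0, he1]; module
    obtain ⟨a, b⟩ := LinearIndependent.pair_iff.1 hf _ _ h'
    have hs : s = 0 := (mul_eq_zero.1 b).resolve_right hy
    exact ⟨hs, by simpa [hs] using a⟩
  have he0n : e0 ≠ 0 := by
    intro h
    have := (hi 1 0 (by simp [h])).1
    exact one_ne_zero this
  have hC3 : T e1 e1 e2 ≠ 0 := by rw [he1]; exact h2k
  obtain ⟨z, hz⟩ : ∃ z, z = T e1 e1 e2 • e0 + (-2 * T e0 e1 e2) • e1 := ⟨_, rfl⟩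
  have hz0 : z ≠ 0 := by
    intro h
    exact hC3 (hi _ _ (hz.symm.trans h)).1
  obtain ⟨e3, h3s, h3k, h3z⟩ := avoid (Submodule.span k (Set.range ![e2, e1, e0]))
    _ _ (hspan _ (by norm_num)) (hker _ he0n) (hker _ hz0)
  rw [LinearMap.mem_ker] at h3k h3z
  have h2s' : e2 ∉ Submodule.span k (Set.range ![e1, e0]) := by
    intro h
    apply h2s
    refine Submodule.span_le.2 ?_ h
    rintro _ ⟨i, rfl⟩
    have m0 : f 0 ∈ Submodule.span k (Set.range ![f 0, f 1]) := Submodule.subset_span ⟨0, rfl⟩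
    have m1 : f 1 ∈ Submodule.span k (Set.range ![f 0, f 1]) := Submodule.subset_span ⟨1, rfl⟩
    fin_cases i
    · show e1 ∈ _
      rw [he1]; exact m0
    · show e0 ∈ _
      rw [he0]; exact Submodule.add_mem _ (Submodule.smul_mem _ _ m0) (Submodule.smul_mem _ _ m1)
  have hli : LinearIndependent k ![e3, e2, e1, e0] := by
    have h01 : LinearIndependent k ![e1, e0] := by
      rw [LinearIndependent.pair_iff]
      intro s t h
      have := hi t s (by rw [← h]; abel)
      tauto
    have h012 : LinearIndependent k ![e2, e1, e0] := linearIndependent_finCons.2 ⟨h01, h2s'⟩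
    exact linearIndependent_finCons.2 ⟨h012, h3s⟩
  let E : Fin 4 → V := ![e0, e1, e2, e3]
  have hE : LinearIndependent k E := by
    have := hli.comp Fin.rev Fin.rev_injective
    convert this using 1
    ext i; fin_cases i <;> rfl
  rw [hz, hT.expand2] at h3z
  obtain ⟨x, y, i, j, xi, xj, yi, yj, q0, q1, q2, q3⟩ := exists_line_coord
    (t := fun i j l => T (E i) (E j) (E l)) (fun i j l => hT.s1 _ _ _) (fun i j l => hT.s2 _ _ _)
    hA h3k (by
      show 4 * T e0 e1 e2 ^ 2 * T e1 e1 e3 - 4 * T e0 e1 e2 * T e0 e1 e3 * T e1 e1 e2 +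
        T e0 e0 e3 * T e1 e1 e2 ^ 2 ≠ 0
      intro h
      apply h3z
      linear_combination h)
  rw [← T_sum] at q0 q1 q2 q3
  set P := ∑ i, x i • E i with hP
  set Q := ∑ i, y i • E i with hQ
  have hPQ : LinearIndependent k ![P, Q] := by
    rw [LinearIndependent.pair_iff]
    intro s t h
    have h' : ∑ l, (s * x l + t * y l) • E l = 0 := by
      rw [← h, hP, hQ, Finset.smul_sum, Finset.smul_sum, ← Finset.sum_add_distrib]
      exact Finset.sum_congr rfl fun l _ => by module
    have hl := Fintype.linearIndependent_iff.1 hE _ h'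
    have hi' := hl i
    have hj' := hl j
    rw [xi, yi] at hi'
    rw [xj, yj] at hj'
    exact ⟨by simpa using hi', by simpa using hj'⟩
  refine ⟨Submodule.span k {P, Q}, ?_, ?_⟩
  · have := finrank_span_eq_card hPQ
    rw [Matrix.range_cons_cons_empty] at this
    rw [this]; simp
  · intro v hv
    obtain ⟨a, b, rfl⟩ := Submodule.mem_span_pair.1 hv
    rw [hT.expand, q0, q1, q2, q3]
    ring

end CS

namespace CS
open MvPolynomial

lemma pderiv_comm {k : Type*} [CommRing k] {σ : Type*} (i j : σ) (p : MvPolynomial σ k) :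
    pderiv i (pderiv j p) = pderiv j (pderiv i p) := by
  classical
  have h : ⁅(pderiv i : Derivation k (MvPolynomial σ k) (MvPolynomial σ k)),
      (pderiv j : Derivation k (MvPolynomial σ k) (MvPolynomial σ k))⁆ = 0 := by
    apply derivation_ext
    intro l
    rw [Derivation.commutator_apply, pderiv_X, pderiv_X]
    simp only [Pi.single_apply]
    split_ifs <;> simp
  have h' := congrArg (fun D => D p) h
  simp only [Derivation.commutator_apply] at h'
  exact sub_eq_zero.1 h'

/-- trilinear map with given tensor -/
noncomputable def triMap {k : Type*} [Field k] (t : Fin 4 → Fin 4 → Fin 4 → k) :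
    (Fin 4 → k) →ₗ[k] (Fin 4 → k) →ₗ[k] (Fin 4 → k) →ₗ[k] k :=
  ∑ i, ∑ j, ∑ l, t i j l • (LinearMap.proj (φ := fun _ : Fin 4 => k) i).smulRight
    ((LinearMap.proj (φ := fun _ : Fin 4 => k) j).smulRight
      (LinearMap.proj (φ := fun _ : Fin 4 => k) l))

lemma triMap_apply {k : Type*} [Field k] (t : Fin 4 → Fin 4 → Fin 4 → k) (u v w : Fin 4 → k) :
    triMap t u v w = TR t (RingHom.id k) u v w := by
  simp only [triMap, TR, LinearMap.sum_apply, LinearMap.smul_apply, LinearMap.smulRight_apply,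
    LinearMap.proj_apply, smul_eq_mul, RingHom.id_apply]
  refine Finset.sum_congr rfl fun i _ => Finset.sum_congr rfl fun j _ =>
    Finset.sum_congr rfl fun l _ => by ring

lemma euler_eval {k : Type*} [Field k] {G : MvPolynomial (Fin 4) k} {n : ℕ}
    (h : G.IsHomogeneous n) (v : Fin 4 → k) : ∑ i, v i * eval v (pderiv i G) = n * eval v G := by
  have := congrArg (eval v) h.sum_X_mul_pderiv
  simpa using this

section
variable {k : Type*} [Field k] [CharZero k] {F : MvPolynomial (Fin 4) k}

/-- coefficient tensor of a cubic form -/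
noncomputable def tens (F : MvPolynomial (Fin 4) k) (i j l : Fin 4) : k :=
  (1 / 6) * eval 0 (pderiv i (pderiv j (pderiv l F)))

lemma tens_s1 (i j l : Fin 4) : tens F i j l = tens F j i l := by
  unfold tens; rw [pderiv_comm]

lemma tens_s2 (i j l : Fin 4) : tens F i j l = tens F i l j := by
  unfold tens; rw [pderiv_comm j l]

lemma tens_polar (hF : F.IsHomogeneous 3) (v w : Fin 4 → k) :
    TR (tens F) (RingHom.id k) v v w = (1 / 3) * ∑ l, w l * eval v (pderiv l F) := by
  have h1 : ∀ l, (pderiv l F).IsHomogeneous 2 := fun l => hF.pderiv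
  have h2 : ∀ j l, (pderiv j (pderiv l F)).IsHomogeneous 1 := fun j l => (h1 l).pderiv
  have h3 : ∀ i j l, (pderiv i (pderiv j (pderiv l F))).IsHomogeneous 0 := fun i j l => (h2 j l).pderiv
  have h4 : ∀ i j l, eval v (pderiv i (pderiv j (pderiv l F))) = 6 * tens F i j l := by
    intro i j l
    have := (totalDegree_eq_zero_iff_eq_C).1 (Nat.le_zero.1 (h3 i j l).totalDegree_le)
    unfold tens
    rw [this]
    simp
  have e : ∀ l, ∑ j, ∑ i, tens F i j l * v i * v j = (1 / 3) * eval v (pderiv l F) := by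
    intro l
    have a := euler_eval (h1 l) v
    have b : ∀ j, ∑ i, v i * (6 * tens F i j l) = eval v (pderiv j (pderiv l F)) := by
      intro j
      have := euler_eval (h2 j l) v
      simpa [h4] using this
    simp only [← b] at a
    push_cast at a
    rw [← mul_right_inj' (two_ne_zero (α := k)), ← sub_eq_zero] 
    have c : 2 * (1 / 3 * eval v (pderiv l F)) = (1 / 3) * (2 * eval v (pderiv l F)) := by ring
    rw [c, ← a, sub_eq_zero]
    simp only [Finset.mul_sum]
    refine Finset.sum_congr rfl fun i _ => Finset.sum_congr rfl fun j _ => by ring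
  rw [Finset.mul_sum]
  have e' : ∀ l, 1 / 3 * (w l * eval v (pderiv l F)) = w l * (1 / 3 * eval v (pderiv l F)) :=
    fun l => by ring
  simp only [e', ← e, TR, RingHom.id_apply, Finset.mul_sum]
  rw [Finset.sum_comm]
  conv_lhs => enter [2, y]; rw [Finset.sum_comm]
  rw [Finset.sum_comm]
  refine Finset.sum_congr rfl fun i _ => Finset.sum_congr rfl fun j _ =>
    Finset.sum_congr rfl fun l _ => by ring

lemma tens_cubic (hF : F.IsHomogeneous 3) (v : Fin 4 → k) :
    TR (tens F) (RingHom.id k) v v v = eval v F := by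
  rw [tens_polar hF, euler_eval hF]
  push_cast
  ring

lemma tens_cub (hF : F.IsHomogeneous 3)
    (hs : ∀ v : Fin 4 → k, (∀ i : Fin 4, eval v (pderiv i F) = 0) → v = 0) :
    Cub (triMap (tens F)) where
  s1 x y z := by rw [triMap_apply, triMap_apply, TR_s1 tens_s1]
  s2 x y z := by rw [triMap_apply, triMap_apply, TR_s2 tens_s2]
  ns v h := by
    apply hs
    intro i
    have := h (Pi.single i 1)
    rw [triMap_apply, tens_polar hF, Finset.sum_eq_single i] at this
    · simpa using this
    · intro b _ hb
      simp [hb]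
    · simp

end
end CS

open MvPolynomial

/-- **Cayley–Salmon.** A smooth cubic surface in `ℙ³` over an algebraically closed field of
characteristic zero contains exactly 27 lines, where a line is a 2-dimensional linear
subspace `W ⊆ k⁴` on which the defining cubic form vanishes identically. -/
theorem cayley_salmon_27_lines
    (k : Type) [Field k] [IsAlgClosed k] [CharZero k]
    (F : MvPolynomial (Fin 4) k) (hhom : F.IsHomogeneous 3)
    (hsmooth : ∀ v : Fin 4 → k, (∀ i : Fin 4, eval v (pderiv i F) = 0) → v = 0) :
    {W : Submodule k (Fin 4 → k) |
        Module.finrank k W = 2 ∧ ∀ v ∈ W, eval v F = 0}.ncard = 27 := by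
  have hT := CS.tens_cub hhom hsmooth
  have hV : Module.finrank k (Fin 4 → k) = 4 := by simp
  obtain ⟨ℓ, hl⟩ := CS.exists_line hV hT
  have h := CS.count27 hV hT hl
  have e : {W | CS.IsLine (CS.triMap (CS.tens F)) W} = {W : Submodule k (Fin 4 → k) |
        Module.finrank k W = 2 ∧ ∀ v ∈ W, eval v F = 0} := by
    ext W
    simp only [CS.IsLine, Set.mem_setOf_eq, CS.triMap_apply, CS.tens_cubic hhom]
  rw [← e]
  exact h
end

section
/- Let k be an algebraically closed field of characteristic zero and let S ⊆ ℙ³ be a smooth cubic surface, the zero locus of a homogeneous cubic form F with no nonzero common zero of its partial derivatives. Let (ℓ₁,…,ℓ₆) be a six on S, i.e. an ordered 6-tuple of pairwise disjoint lines on S (2-dimensional subspaces Wᵢ ⊆ k⁴ contained in the zero set of F with Wᵢ ∩ Wⱼ = 0 for i ≠ j). Then there exists a unique ordered 6-tuple (ℓ′₁,…,ℓ′₆) of pairwise disjoint lines on S such that ℓᵢ and ℓ′ᵢ are disjoint for every i, and ℓᵢ meets ℓ′ⱼ (i.e. the corresponding 2-dimensional subspaces intersect nontrivially) whenever i ≠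 j. In other words, every six on S extends uniquely to a double six. -/
open MvPolynomial

/-- A *line* on the cubic surface defined by `F`: a 2-dimensional linear subspace of `k⁴`
on which `F` vanishes identically. -/
def IsLineOn {k : Type} [Field k] (F : MvPolynomial (Fin 4) k)
    (W : Submodule k (Fin 4 → k)) : Prop :=
  Module.finrank k W = 2 ∧ ∀ v ∈ W, eval v F = 0

set_option linter.unusedSectionVars false

section helpers
variable {k : Type} [Field k] [IsAlgClosed k] [CharZero k]

theorem quad_factor (a b c : k) : ∃ w z : k × k, w ≠ 0 ∧ ∀ s t : k,
    a * s ^ 2 + b * s * t + c * t ^ 2 = (s * w.2 - t * w.1) * (s * z.2 - t * z.1) := by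
  by_cases ha : a = 0
  · refine ⟨(1, 0), (c, -b), by simp, fun s t => ?_⟩
    subst ha; simp; ring
  · obtain ⟨r, hr⟩ := IsAlgClosed.exists_root
      (Polynomial.C a * Polynomial.X ^ 2 + Polynomial.C b * Polynomial.X + Polynomial.C c)
      (by rw [Polynomial.degree_quadratic ha]; norm_num)
    simp [Polynomial.IsRoot] at hr
    refine ⟨(r, 1), (-(b + a * r), a), by simp, fun s t => ?_⟩
    simp only
    linear_combination t ^ 2 * hr

theorem cubic_factor (a b c d : k) : ∃ w y z : k × k, w ≠ 0 ∧ y ≠ 0 ∧ ∀ s t : k,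
    a * s ^ 3 + b * s ^ 2 * t + c * s * t ^ 2 + d * t ^ 3 =
      (s * w.2 - t * w.1) * ((s * y.2 - t * y.1) * (s * z.2 - t * z.1)) := by
  by_cases ha : a = 0
  · obtain ⟨y, z, hy, h⟩ := quad_factor (-b) (-c) (-d)
    refine ⟨(1, 0), y, z, by simp, hy, fun s t => ?_⟩
    rw [← h]
    subst ha; simp; ring
  · obtain ⟨r, hr⟩ := IsAlgClosed.exists_root
      (Polynomial.C a * Polynomial.X ^ 3 + Polynomial.C b * Polynomial.X ^ 2
        + Polynomial.C c * Polynomial.X + Polynomial.C d)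
      (by rw [Polynomial.degree_cubic ha]; norm_num)
    simp [Polynomial.IsRoot] at hr
    obtain ⟨y, z, hy, h⟩ := quad_factor a (b + a * r) (c + b * r + a * r ^ 2)
    refine ⟨(r, 1), y, z, by simp, hy, fun s t => ?_⟩
    rw [← h]
    simp only
    linear_combination t ^ 3 * hr

/-- Existence of the polar form. -/
theorem exists_polar (F : MvPolynomial (Fin 4) k) (hhom : F.IsHomogeneous 3)
    (hsmooth : ∀ v : Fin 4 → k, (∀ i : Fin 4, eval v (pderiv i F) = 0) → v = 0) :
    ∃ B : (Fin 4 → k) →ₗ[k] (Fin 4 → k) →ₗ[k] (Fin 4 → k) →ₗ[k] k,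
      (∀ a b c, B a b c = B b a c) ∧ (∀ a b c, B a b c = B a c b) ∧
      (∀ v, eval v F = 0 ↔ B v v v = 0) ∧ (∀ v, (∀ w, B v v w = 0) → v = 0) := by
  have euler : ∀ (G : MvPolynomial (Fin 4) k) (n : ℕ), G.IsHomogeneous n → ∀ v : Fin 4 → k,
      ∑ i, v i * eval v (pderiv i G) = n * eval v G := by
    intro G n hG v
    have := congrArg (eval v) hG.sum_X_mul_pderiv
    simpa using this
  have hc : ∀ i j l, ∃ d : k, pderiv i (pderiv j (pderiv l F)) = C d := by
    intro i j l
    have h0 : (pderiv i (pderiv j (pderiv l F))).IsHomogeneous 0 := by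
      simpa using ((hhom.pderiv (i := l)).pderiv (i := j)).pderiv (i := i)
    exact ⟨_, (totalDegree_eq_zero_iff_eq_C.1 (by simpa using h0.totalDegree_le))⟩
  choose D hD using hc
  have comm : ∀ (i j) (G : MvPolynomial (Fin 4) k), pderiv i (pderiv j G) = pderiv j (pderiv i G) := by
    intro i j G
    have h : ⁅(pderiv i : Derivation k (MvPolynomial (Fin 4) k) (MvPolynomial (Fin 4) k)), (pderiv j : Derivation k (MvPolynomial (Fin 4) k) (MvPolynomial (Fin 4) k))⁆ = 0 := by
      apply MvPolynomial.derivation_ext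
      intro l
      rw [Derivation.commutator_apply]
      simp [pderiv_X, Pi.single_apply, apply_ite]
    have h2 := congrArg (fun d => d G) h
    simp only [Derivation.commutator_apply] at h2
    exact sub_eq_zero.1 (by simpa using h2)
  have s1 : ∀ i j l, D i j l = D j i l := by
    intro i j l
    apply C_injective (Fin 4) k
    rw [← hD, ← hD, comm]
  have s2 : ∀ i j l, D i j l = D i l j := by
    intro i j l
    apply C_injective (Fin 4) k
    rw [← hD, ← hD, comm j l]
  let B : (Fin 4 → k) →ₗ[k] (Fin 4 → k) →ₗ[k] (Fin 4 → k) →ₗ[k] k :=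
    ∑ i, ∑ j, ∑ l, D i j l • (LinearMap.proj (R := k) (φ := fun _ : Fin 4 => k) i).smulRight
      ((LinearMap.proj (R := k) (φ := fun _ : Fin 4 => k) j).smulRight (LinearMap.proj (R := k) (φ := fun _ : Fin 4 => k) l))
  have hB : ∀ a b c, B a b c = ∑ i, ∑ j, ∑ l, D i j l * (a i * (b j * c l)) := by
    intro a b c
    simp [B, LinearMap.sum_apply]
  have e1 : ∀ i v, ∑ j, ∑ l, D i j l * (v j * v l) = 2 * eval v (pderiv i F) := by
    intro i v
    have h2 := euler (pderiv i F) 2 (by simpa using hhom.pderiv (i := i)) v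
    rw [show ((2:ℕ):k) = 2 by norm_num] at h2
    rw [← h2]
    refine Finset.sum_congr rfl fun j _ => ?_
    have h1 := euler (pderiv j (pderiv i F)) 1 (by simpa using (hhom.pderiv (i := i)).pderiv (i := j)) v
    simp only [hD, eval_C, Nat.cast_one, one_mul] at h1
    rw [← h1, Finset.mul_sum]
    refine Finset.sum_congr rfl fun l _ => ?_
    rw [s2 l j i, s1 l i j, s2 i l j]; ring
  have b1 : ∀ a b c, B a b c = B b a c := by
    intro a b c
    rw [hB, hB, Finset.sum_comm]
    refine Finset.sum_congr rfl fun i _ => Finset.sum_congr rfl fun j _ => Finset.sum_congr rfl fun l _ => ?_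
    rw [s1]; ring
  have b2 : ∀ a b c, B a b c = B a c b := by
    intro a b c
    rw [hB, hB]
    refine Finset.sum_congr rfl fun i _ => ?_
    rw [Finset.sum_comm]
    refine Finset.sum_congr rfl fun j _ => Finset.sum_congr rfl fun l _ => ?_
    rw [s2]; ring
  have e2 : ∀ v w, B v v w = 2 * ∑ i, w i * eval v (pderiv i F) := by
    intro v w
    rw [b2, b1, hB, Finset.mul_sum]
    refine Finset.sum_congr rfl fun i _ => ?_
    rw [mul_left_comm, ← e1, Finset.mul_sum]
    refine Finset.sum_congr rfl fun j _ => ?_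
    rw [Finset.mul_sum]
    refine Finset.sum_congr rfl fun l _ => ?_
    ring
  refine ⟨B, b1, b2, ?_, ?_⟩
  · intro v
    rw [e2, euler F 3 hhom]
    simp
  · intro v hv
    apply hsmooth
    intro i
    have := hv (Pi.single i 1)
    rw [e2] at this
    simpa [Pi.single_apply] using this
end helpers



section geom
variable {k : Type} [Field k] [IsAlgClosed k] [CharZero k]
variable {V : Type} [AddCommGroup V] [Module k V] [FiniteDimensional k V]

/-- lines of the cubic with polar form `B` -/
def LineB (B : V →ₗ[k] V →ₗ[k] V →ₗ[k] k) (W : Submodule k V) : Prop :=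
  Module.finrank k W = 2 ∧ ∀ v ∈ W, B v v v = 0

/-- smooth symmetric trilinear form -/
structure Cub (B : V →ₗ[k] V →ₗ[k] V →ₗ[k] k) : Prop where
  s1 : ∀ a b c, B a b c = B b a c
  s2 : ∀ a b c, B a b c = B a c b
  ns : ∀ v, (∀ w, B v v w = 0) → v = 0

theorem LineB.pol2 {B : V →ₗ[k] V →ₗ[k] V →ₗ[k] k} (hB : Cub B) {W : Submodule k V}
    (hW : LineB B W) {a b : V} (ha : a ∈ W) (hb : b ∈ W) : B a a b = 0 := by
  have h1 := hW.2 _ (W.add_mem ha hb)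
  have h2 := hW.2 _ (W.sub_mem ha hb)
  simp only [map_add, map_sub, LinearMap.add_apply, LinearMap.sub_apply, hW.2 a ha, hW.2 b hb,
    hB.s2 a b a, hB.s1 b a a, hB.s2 b a b] at h1 h2
  linear_combination (h1 - h2) / 6

theorem LineB.pol {B : V →ₗ[k] V →ₗ[k] V →ₗ[k] k} (hB : Cub B) {W : Submodule k V}
    (hW : LineB B W) {a b c : V} (ha : a ∈ W) (hb : b ∈ W) (hc : c ∈ W) : B a b c = 0 := by
  have h1 := hW.pol2 hB (W.add_mem ha hb) hc
  simp only [map_add, LinearMap.add_apply, hW.pol2 hB ha hc, hW.pol2 hB hb hc, hB.s1 b a c] at h1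
  linear_combination h1 / 2

/-- coordinates adapted to three skew lines -/
structure Config (W₁ W₂ W₃ : Submodule k V) (e f : k × k →ₗ[k] V) : Prop where
  e_mem : ∀ x, e x ∈ W₁
  f_mem : ∀ x, f x ∈ W₂
  ef_mem : ∀ x, e x + f x ∈ W₃
  e_surj : ∀ v ∈ W₁, ∃ x, v = e x
  f_surj : ∀ v ∈ W₂, ∃ x, v = f x
  ef_surj : ∀ v ∈ W₃, ∃ x, v = e x + f x
  inj : ∀ x y, e x + f y = 0 → x = 0 ∧ y = 0
  surj : ∀ v, ∃ x y, v = e x + f y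

theorem isCompl_of_skew (hV : Module.finrank k V = 4) {W₁ W₂ : Submodule k V}
    (h1 : Module.finrank k W₁ = 2) (h2 : Module.finrank k W₂ = 2) (h : W₁ ⊓ W₂ = ⊥) :
    IsCompl W₁ W₂ := by
  refine ⟨disjoint_iff.2 h, codisjoint_iff.2 ?_⟩
  have := Submodule.finrank_sup_add_finrank_inf_eq W₁ W₂
  rw [h, finrank_bot] at this
  apply Submodule.eq_top_of_finrank_eq
  omega

theorem mem_range_of_inj {W : Submodule k V} (hW : Module.finrank k W = 2) (e : k × k →ₗ[k] V)
    (he : ∀ x, e x ∈ W) (hi : ∀ x, e x = 0 → x = 0) : ∀ v ∈ W, ∃ x, v = e x := by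
  have hr : LinearMap.range e = W := by
    apply Submodule.eq_of_le_of_finrank_eq
    · rintro _ ⟨x, rfl⟩; exact he x
    · rw [LinearMap.finrank_range_of_inj, hW]
      · simp
      · exact (injective_iff_map_eq_zero e).2 hi
  intro v hv
  rw [← hr] at hv
  obtain ⟨x, rfl⟩ := hv
  exact ⟨x, rfl⟩

theorem exists_config_of (hV : Module.finrank k V = 4) {W₁ W₂ W₃ : Submodule k V}
    (h1 : Module.finrank k W₁ = 2) (h2 : Module.finrank k W₂ = 2) (h3 : Module.finrank k W₃ = 2)
    (h12 : W₁ ⊓ W₂ = ⊥) (h13 : W₁ ⊓ W₃ = ⊥) (h23 : W₂ ⊓ W₃ = ⊥) (e : k × k →ₗ[k] V)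
    (he : ∀ x, e x ∈ W₁) (hei : ∀ x, e x = 0 → x = 0) :
    ∃ f : k × k →ₗ[k] V, Config W₁ W₂ W₃ e f := by
  have c12 := isCompl_of_skew hV h1 h2 h12
  have c23 := isCompl_of_skew hV h2 h3 h23
  have z12 : ∀ v, v ∈ W₁ → v ∈ W₂ → v = 0 := fun v a b => by
    have : v ∈ W₁ ⊓ W₂ := ⟨a, b⟩
    simpa [h12] using this
  have z13 : ∀ v, v ∈ W₁ → v ∈ W₃ → v = 0 := fun v a b => by
    have : v ∈ W₁ ⊓ W₃ := ⟨a, b⟩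
    simpa [h13] using this
  let P : V →ₗ[k] V := W₂.subtype ∘ₗ Submodule.projectionOnto W₂ W₃ c23
  let f : k × k →ₗ[k] V := -(P ∘ₗ e)
  have hf : ∀ x, f x ∈ W₂ := fun x => W₂.neg_mem (Submodule.projectionOnto W₂ W₃ c23 (e x)).2
  have hef : ∀ x, e x + f x ∈ W₃ := by
    intro x
    have hp : P (e x + f x) = 0 := by
      have : P (f x) = f x := by
        have := Submodule.projectionOnto_apply_left c23 ⟨f x, hf x⟩
        exact congrArg Subtype.val this
      rw [map_add, this]
      simp [f]
    rw [← Submodule.projectionOnto_apply_eq_zero_iff c23]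
    exact Subtype.ext hp
  have hfi : ∀ x, f x = 0 → x = 0 := by
    intro x hx
    apply hei
    have := hef x
    rw [hx, add_zero] at this
    exact z13 _ (he x) this
  refine ⟨f, he, hf, hef, mem_range_of_inj h1 e he hei, mem_range_of_inj h2 f hf hfi, ?_, ?_, ?_⟩
  · have := mem_range_of_inj h3 (e + f) hef ?_
    · simpa using this
    · intro x hx
      apply hei
      have h : e x = - f x := eq_neg_of_add_eq_zero_left hx
      exact z12 _ (he x) (h ▸ W₂.neg_mem (hf x))
  · intro x y hx
    have h : e x = - f y := eq_neg_of_add_eq_zero_left hx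
    have h0 : e x = 0 := z12 _ (he x) (h ▸ W₂.neg_mem (hf y))
    refine ⟨hei _ h0, hfi _ ?_⟩
    rw [h0] at hx; simpa using hx
  · intro v
    have hv : v ∈ W₁ ⊔ W₂ := by rw [c12.sup_eq_top]; trivial
    obtain ⟨a, ha, b, hb, rfl⟩ := Submodule.mem_sup.1 hv
    obtain ⟨x, rfl⟩ := mem_range_of_inj h1 e he hei a ha
    obtain ⟨y, rfl⟩ := mem_range_of_inj h2 f hf hfi b hb
    exact ⟨x, y, rfl⟩

theorem exists_config (hV : Module.finrank k V = 4) {W₁ W₂ W₃ : Submodule k V}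
    (h1 : Module.finrank k W₁ = 2) (h2 : Module.finrank k W₂ = 2) (h3 : Module.finrank k W₃ = 2)
    (h12 : W₁ ⊓ W₂ = ⊥) (h13 : W₁ ⊓ W₃ = ⊥) (h23 : W₂ ⊓ W₃ = ⊥) :
    ∃ e f : k × k →ₗ[k] V, Config W₁ W₂ W₃ e f := by
  let E : (k × k) ≃ₗ[k] W₁ := LinearEquiv.ofFinrankEq _ _ (by simp [h1])
  let e : k × k →ₗ[k] V := W₁.subtype ∘ₗ E.toLinearMap
  have he : ∀ x, e x ∈ W₁ := fun x => (E x).2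
  have hei : ∀ x, e x = 0 → x = 0 := by
    intro x hx
    exact E.map_eq_zero_iff.1 (Subtype.ext hx)
  exact ⟨e, exists_config_of hV h1 h2 h3 h12 h13 h23 e he hei⟩

theorem ind_span {w w' : k × k} (h : w.1 * w'.2 - w.2 * w'.1 ≠ 0) (x : k × k) :
    ∃ s t : k, x = s • w + t • w' := by
  refine ⟨(x.1 * w'.2 - x.2 * w'.1) / (w.1 * w'.2 - w.2 * w'.1),
    (w.1 * x.2 - w.2 * x.1) / (w.1 * w'.2 - w.2 * w'.1), ?_⟩
  ext <;> simp only [Prod.fst_add, Prod.snd_add, Prod.smul_fst, Prod.smul_snd, smul_eq_mul] <;>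
    rw [div_mul_eq_mul_div, div_mul_eq_mul_div, ← add_div, eq_div_iff h] <;> ring

theorem dep_smul {w w' : k × k} (hw' : w' ≠ 0) (h : w.1 * w'.2 - w.2 * w'.1 = 0) :
    ∃ s : k, w = s • w' := by
  by_cases h1 : w'.1 = 0
  · have h2 : w'.2 ≠ 0 := fun h2 => hw' (Prod.ext h1 h2)
    refine ⟨w.2 / w'.2, ?_⟩
    rw [h1] at h
    have : w.1 = 0 := by
      rcases mul_eq_zero.1 (show w.1 * w'.2 = 0 by linear_combination h) with h | h
      · exact h
      · exact absurd h h2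
    ext <;> simp [h1, this, h2]
  · refine ⟨w.1 / w'.1, ?_⟩
    ext
    · simp [h1]
    · simp; field_simp; linear_combination -h

theorem exists_indep {w : k × k} (hw : w ≠ 0) : ∃ w' : k × k, w.1 * w'.2 - w.2 * w'.1 ≠ 0 := by
  by_contra! hc
  apply hw
  have h1 := hc (0, 1)
  have h2 := hc (1, 0)
  ext <;> simp_all

theorem cross_expand (B : V →ₗ[k] V →ₗ[k] V →ₗ[k] k) (hB : Cub B) {W₁ W₂ W₃ : Submodule k V}
    {e f : k × k →ₗ[k] V} (hc : Config W₁ W₂ W₃ e f)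
    (l1 : LineB B W₁) (l2 : LineB B W₂) (l3 : LineB B W₃) (w w' : k × k) :
    B (f w) (f w) (e w') + 2 * B (e w) (f w) (f w') + (2 * B (e w) (f w) (e w') +
      B (e w) (e w) (f w')) = 0 := by
  have h := l3.pol2 hB (hc.ef_mem w) (hc.ef_mem w')
  have h1 := l1.pol2 hB (hc.e_mem w) (hc.e_mem w')
  have h2 := l2.pol2 hB (hc.f_mem w) (hc.f_mem w')
  simp only [map_add, LinearMap.add_apply, h1, h2, hB.s1 (f w) (e w)] at h
  linear_combination h

/-- simple roots -/
theorem no_double (B : V →ₗ[k] V →ₗ[k] V →ₗ[k] k) (hB : Cub B) {W₁ W₂ W₃ : Submodule k V}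
    {e f : k × k →ₗ[k] V} (hc : Config W₁ W₂ W₃ e f)
    (l1 : LineB B W₁) (l2 : LineB B W₂) (l3 : LineB B W₃) {w w' : k × k}
    (hi : w.1 * w'.2 - w.2 * w'.1 ≠ 0) (hg : B (e w) (e w) (f w) = 0)
    (hd : 2 * B (e w) (f w) (e w') + B (e w) (e w) (f w') = 0) : False := by
  have hx := cross_expand B hB hc l1 l2 l3 w w'
  have hg' : B (e w) (f w) (f w) = 0 := by
    have hy := cross_expand B hB hc l1 l2 l3 w w
    rw [hB.s2 (f w) (f w) (e w), hB.s1 (f w) (e w) (f w), hB.s2 (e w) (f w) (e w), hg] at hy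
    linear_combination hy / 3
  have p1 : ∀ x y, B (e w) (e x) (e y) = 0 := fun x y =>
    l1.pol hB (hc.e_mem _) (hc.e_mem _) (hc.e_mem _)
  have p2 : ∀ x y, B (f w) (f x) (f y) = 0 := fun x y =>
    l2.pol hB (hc.f_mem _) (hc.f_mem _) (hc.f_mem _)
  have key : ∃ u₀ u₁ : k, (u₀ ≠ 0 ∨ u₁ ≠ 0) ∧
      2 * B (e w) (f w) (e w') * u₀ + B (f w) (f w) (e w') * u₁ = 0 := by
    by_cases h : B (e w) (f w) (e w') = 0 
    · exact ⟨1, 0, by simp, by simp [h]⟩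
    · exact ⟨-B (f w) (f w) (e w'), 2 * B (e w) (f w) (e w'), by simp [h], by ring⟩
  obtain ⟨u₀, u₁, hu, hk⟩ := key
  have h0 : u₀ • e w + u₁ • f w = 0 := by
    apply hB.ns
    intro v
    obtain ⟨x, y, rfl⟩ := hc.surj v
    obtain ⟨s, t, rfl⟩ := ind_span hi x
    obtain ⟨s', t', rfl⟩ := ind_span hi y
    simp only [map_add, map_smul, LinearMap.add_apply, LinearMap.smul_apply, smul_eq_mul, p1, p2,
      hB.s1 (f w) (e w), hg, hg', hB.s2 (f w) (f w) (e w), hB.s2 (e w) (f w) (e w)]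
    linear_combination (t * u₁ - t' * u₀) * hk + t' * u₀ ^ 2 * hd + t' * u₀ * u₁ * (hx - hd)
  rw [← map_smul, ← map_smul] at h0
  obtain ⟨ha, hb⟩ := hc.inj _ _ h0
  have hw : w ≠ 0 := by rintro rfl; simp at hi
  rcases hu with hu | hu
  · exact (smul_ne_zero hu hw) ha
  · exact (smul_ne_zero hu hw) hb


theorem double_root_false (B : V →ₗ[k] V →ₗ[k] V →ₗ[k] k) (hB : Cub B) {W₁ W₂ W₃ : Submodule k V}
    {e f : k × k →ₗ[k] V} (hc : Config W₁ W₂ W₃ e f)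
    (l1 : LineB B W₁) (l2 : LineB B W₂) (l3 : LineB B W₃) {w z : k × k} {c : k} (hw : w ≠ 0)
    (h : ∀ x : k × k, B (e x) (e x) (f x) =
      c * (x.1 * w.2 - x.2 * w.1) ^ 2 * (x.1 * z.2 - x.2 * z.1)) : False := by
  obtain ⟨w', hi⟩ := exists_indep hw
  have h0 := h w
  have h1 := h (w + (1 : k) • w')
  have h2 := h (w + (-1 : k) • w')
  have h3 := h (w + (2 : k) • w')
  have h0' : B (e w) (e w) (f w) = 0 := by rw [h0]; ring
  refine no_double B hB hc l1 l2 l3 hi h0' ?_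
  simp only [map_add, map_smul, LinearMap.add_apply, LinearMap.smul_apply, smul_eq_mul,
    Prod.fst_add, Prod.snd_add, Prod.smul_fst, Prod.smul_snd,
    hB.s1 (e w') (e w), hB.s2 (e w) (e w') (f w)] at h1 h2 h3
  linear_combination (h1 - h2) * (2 / 3) - (h3 - 2 * (h1 + h2)) / 6 - h3 * 0 - h0' * (3 / 6)

theorem finrank_pair {a b : V} (h : ∀ s t : k, s • a + t • b = 0 → s = 0 ∧ t = 0) :
    Module.finrank k (Submodule.span k {a, b}) = 2 := by
  have := finrank_span_eq_card (LinearIndependent.pair_iff.2 h)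
  rw [Matrix.range_cons_cons_empty] at this
  simpa using this

/-- the transversal with parameter `w` -/
def trl (e f : k × k →ₗ[k] V) (w : k × k) : Submodule k V := Submodule.span k {e w, f w}

theorem mem_trl {e f : k × k →ₗ[k] V} {w : k × k} {v : V} :
    v ∈ trl e f w ↔ ∃ s t : k, v = e (s • w) + f (t • w) := by
  rw [trl, Submodule.mem_span_pair]
  simp [eq_comm]

theorem Config.inj' {W₁ W₂ W₃ : Submodule k V} {e f : k × k →ₗ[k] V} (hc : Config W₁ W₂ W₃ e f)
    {x y x' y' : k × k} (h : e x + f y = e x' + f y') : x = x' ∧ y = y' := by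
  have := hc.inj (x - x') (y - y') (by
    rw [map_sub, map_sub, sub_add_sub_comm, h, sub_self])
  exact ⟨sub_eq_zero.1 this.1, sub_eq_zero.1 this.2⟩

theorem meets_iff {W W' : Submodule k V} : W ⊓ W' ≠ ⊥ ↔ ∃ v, v ∈ W ∧ v ∈ W' ∧ v ≠ 0 := by
  rw [Submodule.ne_bot_iff]
  simp [and_assoc]

section
variable {B : V →ₗ[k] V →ₗ[k] V →ₗ[k] k} {W₁ W₂ W₃ : Submodule k V} {e f : k × k →ₗ[k] V}

theorem finrank_trl (hc : Config W₁ W₂ W₃ e f) {w : k × k} (hw : w ≠ 0) : Module.finrank k (trl e f w) = 2 := by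
  apply finrank_pair
  intro s t h
  rw [← map_smul, ← map_smul] at h
  obtain ⟨a, b⟩ := hc.inj _ _ h
  exact ⟨(smul_eq_zero.1 a).resolve_right hw, (smul_eq_zero.1 b).resolve_right hw⟩

theorem trl_inj (hc : Config W₁ W₂ W₃ e f) {w w' : k × k} (h : trl e f w = trl e f w') :
    w.1 * w'.2 - w.2 * w'.1 = 0 := by
  have : e w ∈ trl e f w' := by
    rw [← h]; exact mem_trl.2 ⟨1, 0, by simp⟩
  obtain ⟨s, t, hs⟩ := mem_trl.1 this
  have h2 : w = s • w' := (hc.inj' (y := 0) (by rw [← hs, map_zero, add_zero])).1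
  rw [h2]
  simp; ring

theorem trl_eq (hc : Config W₁ W₂ W₃ e f) {w w' : k × k} (hw : w ≠ 0) (hw' : w' ≠ 0) (h : w.1 * w'.2 - w.2 * w'.1 = 0) :
    trl e f w = trl e f w' := by
  obtain ⟨s, rfl⟩ := dep_smul hw' h
  apply Submodule.eq_of_le_of_finrank_eq
  · intro v hv
    obtain ⟨a, b, rfl⟩ := mem_trl.1 hv
    exact mem_trl.2 ⟨a * s, b * s, by simp [mul_smul]⟩
  · rw [finrank_trl hc hw, finrank_trl hc hw']

theorem eval_uw (hB : Cub B) (hc : Config W₁ W₂ W₃ e f)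
    (l1 : LineB B W₁) (l2 : LineB B W₂) (l3 : LineB B W₃) (u₀ u₁ : k) (w : k × k) :
    B (e (u₀ • w) + f (u₁ • w)) (e (u₀ • w) + f (u₁ • w)) (e (u₀ • w) + f (u₁ • w)) =
      3 * u₀ * u₁ * (u₀ - u₁) * B (e w) (e w) (f w) := by
  have hy := cross_expand B hB hc l1 l2 l3 w w
  have p1 := l1.2 _ (hc.e_mem w)
  have p2 := l2.2 _ (hc.f_mem w)
  rw [hB.s2 (f w) (f w) (e w), hB.s1 (f w) (e w) (f w), hB.s2 (e w) (f w) (e w)] at hy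
  simp only [map_add, map_smul, LinearMap.add_apply, LinearMap.smul_apply, smul_eq_mul, p1, p2,
      hB.s1 (f w) (e w), hB.s2 (f w) (f w) (e w), hB.s2 (e w) (f w) (e w)]
  linear_combination u₀ * u₁ ^ 2 * hy

theorem trl_iff (hB : Cub B) (hc : Config W₁ W₂ W₃ e f)
    (l1 : LineB B W₁) (l2 : LineB B W₂) (l3 : LineB B W₃) {m : Submodule k V} :
    (LineB B m ∧ W₁ ⊓ m ≠ ⊥ ∧ W₂ ⊓ m ≠ ⊥ ∧ W₃ ⊓ m ≠ ⊥) ↔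
      ∃ w, w ≠ 0 ∧ B (e w) (e w) (f w) = 0 ∧ m = trl e f w := by
  constructor
  · rintro ⟨lm, m1, m2, m3⟩
    obtain ⟨a, a1, am, a0⟩ := meets_iff.1 m1
    obtain ⟨b, b1, bm, b0⟩ := meets_iff.1 m2
    obtain ⟨c, c1, cm, c0⟩ := meets_iff.1 m3
    obtain ⟨x, rfl⟩ := hc.e_surj a a1
    obtain ⟨y, rfl⟩ := hc.f_surj b b1
    obtain ⟨w, rfl⟩ := hc.ef_surj c c1
    have hx : x ≠ 0 := by rintro rfl; simp at a0
    have hy : y ≠ 0 := by rintro rfl; simp at b0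
    have hw : w ≠ 0 := by rintro rfl; simp at c0
    have hfr : Module.finrank k (Submodule.span k {e x, f y}) = 2 := by
      apply finrank_pair
      intro s t h
      rw [← map_smul, ← map_smul] at h
      obtain ⟨a, b⟩ := hc.inj _ _ h
      exact ⟨(smul_eq_zero.1 a).resolve_right hx, (smul_eq_zero.1 b).resolve_right hy⟩
    have hm : Submodule.span k {e x, f y} = m := by
      apply Submodule.eq_of_le_of_finrank_eq
      · rw [Submodule.span_le]
        rintro v (rfl | rfl) <;> assumption
      · rw [hfr, lm.1]
    have cm' := cm
    rw [← hm, Submodule.mem_span_pair] at cm'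
    obtain ⟨s, t, hst⟩ := cm'
    rw [← map_smul, ← map_smul] at hst
    obtain ⟨hs, ht⟩ := hc.inj' hst
    have hs0 : s ≠ 0 := by rintro rfl; simp at hs; exact hw hs.symm
    have ht0 : t ≠ 0 := by rintro rfl; simp at ht; exact hw ht.symm
    have ew : e w ∈ m := by rw [← hs, map_smul]; exact m.smul_mem _ am
    have fw : f w ∈ m := by rw [← ht, map_smul]; exact m.smul_mem _ bm
    refine ⟨w, hw, lm.pol hB ew ew fw, ?_⟩
    symm
    apply Submodule.eq_of_le_of_finrank_eq
    · rw [trl, Submodule.span_le]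
      rintro v (rfl | rfl) <;> assumption
    · rw [finrank_trl hc hw, lm.1]
  · rintro ⟨w, hw, hg, rfl⟩
    have he : e w ≠ 0 := fun h => hw (hc.inj w 0 (by simp [h])).1
    have hf : f w ≠ 0 := fun h => hw (hc.inj 0 w (by simp [h])).2
    have hef : e w + f w ≠ 0 := fun h => hw (hc.inj w w h).2
    refine ⟨⟨finrank_trl hc hw, ?_⟩, meets_iff.2 ⟨e w, hc.e_mem w, ?_, he⟩,
      meets_iff.2 ⟨f w, hc.f_mem w, ?_, hf⟩, meets_iff.2 ⟨e w + f w, hc.ef_mem w, ?_, hef⟩⟩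
    · intro v hv
      obtain ⟨s, t, rfl⟩ := mem_trl.1 hv
      rw [eval_uw hB hc l1 l2 l3, hg, mul_zero]
    · exact mem_trl.2 ⟨1, 0, by simp⟩
    · exact mem_trl.2 ⟨0, 1, by simp⟩
    · exact mem_trl.2 ⟨1, 1, by simp⟩

theorem three_aux (hB : Cub B) (hc : Config W₁ W₂ W₃ e f)
    (l1 : LineB B W₁) (l2 : LineB B W₂) (l3 : LineB B W₃) : ∃ m₁ m₂ m₃ : Submodule k V, m₁ ≠ m₂ ∧ m₁ ≠ m₃ ∧ m₂ ≠ m₃ ∧ ∀ m,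
    (LineB B m ∧ W₁ ⊓ m ≠ ⊥ ∧ W₂ ⊓ m ≠ ⊥ ∧ W₃ ⊓ m ≠ ⊥) ↔ (m = m₁ ∨ m = m₂ ∨ m = m₃) := by
  obtain ⟨w, y, z, hw, hy, h⟩ := cubic_factor
    (B (e (1, 0)) (e (1, 0)) (f (1, 0)))
    (2 * B (e (1, 0)) (e (0, 1)) (f (1, 0)) + B (e (1, 0)) (e (1, 0)) (f (0, 1)))
    (B (e (0, 1)) (e (0, 1)) (f (1, 0)) + 2 * B (e (1, 0)) (e (0, 1)) (f (0, 1)))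
    (B (e (0, 1)) (e (0, 1)) (f (0, 1)))
  have hG : ∀ x : k × k, B (e x) (e x) (f x) = (x.1 * w.2 - x.2 * w.1) *
      ((x.1 * y.2 - x.2 * y.1) * (x.1 * z.2 - x.2 * z.1)) := by
    intro x
    rw [← h]
    have hx : x = x.1 • ((1 : k), (0 : k)) + x.2 • ((0 : k), (1 : k)) := by ext <;> simp
    rw [hx]
    simp only [map_add, map_smul, LinearMap.add_apply, LinearMap.smul_apply, smul_eq_mul,
      hB.s1 (e (0, 1)) (e (1, 0))]
    simp
    ring
  have dwy : w.1 * y.2 - w.2 * y.1 ≠ 0 := by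
    intro h0
    obtain ⟨c, rfl⟩ := dep_smul hy h0
    refine double_root_false B hB hc l1 l2 l3 (c := c) (z := z) hy fun x => ?_
    rw [hG]; simp; ring
  have dzw : z.1 * w.2 - z.2 * w.1 ≠ 0 := by
    intro h0
    obtain ⟨c, rfl⟩ := dep_smul hw h0
    refine double_root_false B hB hc l1 l2 l3 (c := c) (z := y) hw fun x => ?_
    rw [hG]; simp; ring
  have dzy : z.1 * y.2 - z.2 * y.1 ≠ 0 := by
    intro h0
    obtain ⟨c, rfl⟩ := dep_smul hy h0
    refine double_root_false B hB hc l1 l2 l3 (c := c) (z := w) hy fun x => ?_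
    rw [hG]; simp; ring
  have hz : z ≠ 0 := by rintro rfl; simp at dzw
  refine ⟨trl e f w, trl e f y, trl e f z, fun h => dwy (trl_inj hc h),
    fun h => dzw (trl_inj hc h.symm), fun h => dzy (trl_inj hc h.symm), fun m => ?_⟩
  rw [trl_iff hB hc l1 l2 l3]
  constructor
  · rintro ⟨x, hx, hg, rfl⟩
    rw [hG, mul_eq_zero, mul_eq_zero] at hg
    rcases hg with hg | hg | hg
    · exact Or.inl (trl_eq hc hx hw hg)
    · exact Or.inr (Or.inl (trl_eq hc hx hy hg))
    · exact Or.inr (Or.inr (trl_eq hc hx hz hg))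
  · rintro (rfl | rfl | rfl)
    · exact ⟨w, hw, by rw [hG]; ring, rfl⟩
    · exact ⟨y, hy, by rw [hG]; ring, rfl⟩
    · exact ⟨z, hz, by rw [hG]; ring, rfl⟩

end

theorem three (hV : Module.finrank k V = 4) {B : V →ₗ[k] V →ₗ[k] V →ₗ[k] k} (hB : Cub B)
    {W₁ W₂ W₃ : Submodule k V} (l1 : LineB B W₁) (l2 : LineB B W₂) (l3 : LineB B W₃)
    (h12 : W₁ ⊓ W₂ = ⊥) (h13 : W₁ ⊓ W₃ = ⊥) (h23 : W₂ ⊓ W₃ = ⊥) :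
    ∃ m₁ m₂ m₃ : Submodule k V, m₁ ≠ m₂ ∧ m₁ ≠ m₃ ∧ m₂ ≠ m₃ ∧ ∀ m,
    (LineB B m ∧ W₁ ⊓ m ≠ ⊥ ∧ W₂ ⊓ m ≠ ⊥ ∧ W₃ ⊓ m ≠ ⊥) ↔ (m = m₁ ∨ m = m₂ ∨ m = m₃) := by
  obtain ⟨e, f, hc⟩ := exists_config hV l1.1 l2.1 l3.1 h12 h13 h23
  exact three_aux hB hc l1 l2 l3

/-- distinct transversals of three skew lines are skew -/
theorem trans_disjoint (hV : Module.finrank k V = 4) {B : V →ₗ[k] V →ₗ[k] V →ₗ[k] k} (hB : Cub B)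
    {W₁ W₂ W₃ : Submodule k V} (l1 : LineB B W₁) (l2 : LineB B W₂) (l3 : LineB B W₃)
    (h12 : W₁ ⊓ W₂ = ⊥) (h13 : W₁ ⊓ W₃ = ⊥) (h23 : W₂ ⊓ W₃ = ⊥) {m m' : Submodule k V}
    (hm : LineB B m ∧ W₁ ⊓ m ≠ ⊥ ∧ W₂ ⊓ m ≠ ⊥ ∧ W₃ ⊓ m ≠ ⊥)
    (hm' : LineB B m' ∧ W₁ ⊓ m' ≠ ⊥ ∧ W₂ ⊓ m' ≠ ⊥ ∧ W₃ ⊓ m' ≠ ⊥) (hne : m ≠ m') :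
    m ⊓ m' = ⊥ := by
  obtain ⟨e, f, hc⟩ := exists_config hV l1.1 l2.1 l3.1 h12 h13 h23
  obtain ⟨w, hw, -, rfl⟩ := (trl_iff hB hc l1 l2 l3).1 hm
  obtain ⟨z, hz, -, rfl⟩ := (trl_iff hB hc l1 l2 l3).1 hm'
  by_contra hcon
  obtain ⟨v, v1, v2, v0⟩ := meets_iff.1 hcon
  obtain ⟨s, t, rfl⟩ := mem_trl.1 v1
  obtain ⟨s', t', h⟩ := mem_trl.1 v2
  obtain ⟨ha, hb⟩ := hc.inj' h
  have key : ∀ s s' : k, s • w = s' • z → s = 0 := by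
    intro s s' h
    by_contra hs
    apply hne
    refine trl_eq hc hw hz ?_
    have : s * (w.1 * z.2 - w.2 * z.1) = 0 := by
      have h1 := congrArg Prod.fst h
      have h2 := congrArg Prod.snd h
      simp at h1 h2
      linear_combination z.2 * h1 - z.1 * h2
    exact (mul_eq_zero.1 this).resolve_left hs
  apply v0
  rw [key _ _ ha, key _ _ hb]
  simp

theorem four (hV : Module.finrank k V = 4) {B : V →ₗ[k] V →ₗ[k] V →ₗ[k] k} (hB : Cub B)
    {W₁ W₂ W₃ W₄ : Submodule k V} (l1 : LineB B W₁) (l2 : LineB B W₂) (l3 : LineB B W₃)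
    (l4 : LineB B W₄)
    (h12 : W₁ ⊓ W₂ = ⊥) (h13 : W₁ ⊓ W₃ = ⊥) (h23 : W₂ ⊓ W₃ = ⊥)
    (h14 : W₁ ⊓ W₄ = ⊥) (h24 : W₂ ⊓ W₄ = ⊥) (h34 : W₃ ⊓ W₄ = ⊥) :
    ∃ m₁ m₂ : Submodule k V, m₁ ≠ m₂ ∧ ∀ m,
    (LineB B m ∧ W₁ ⊓ m ≠ ⊥ ∧ W₂ ⊓ m ≠ ⊥ ∧ W₃ ⊓ m ≠ ⊥ ∧ W₄ ⊓ m ≠ ⊥) ↔ (m = m₁ ∨ m = m₂) := by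
  obtain ⟨e, f, hc⟩ := exists_config hV l1.1 l2.1 l3.1 h12 h13 h23
  obtain ⟨f', hc'⟩ := exists_config_of hV l1.1 l2.1 l4.1 h12 h14 h24 e hc.e_mem
    (fun x hx => (hc.inj x 0 (by simp [hx])).1)
  have hfi : LinearMap.ker f = ⊥ := by
    rw [LinearMap.ker_eq_bot']
    exact fun x hx => (hc.inj 0 x (by simp [hx])).2
  obtain ⟨g, hg⟩ := LinearMap.exists_leftInverse_of_injective f hfi
  have hg' : ∀ x, g (f x) = x := fun x => LinearMap.congr_fun hg x
  let A : k × k →ₗ[k] k × k := g ∘ₗ f'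
  have hA : ∀ x, f' x = f (A x) := by
    intro x
    obtain ⟨y, hy⟩ := hc.f_surj _ (hc'.f_mem x)
    simp [A, hy, hg']
  have A_mem : ∀ x, e x + f (A x) ∈ W₄ := fun x => hA x ▸ hc'.ef_mem x
  have A_surj : ∀ v ∈ W₄, ∃ x, v = e x + f (A x) := by
    intro v hv
    obtain ⟨x, hx⟩ := hc'.ef_surj v hv
    exact ⟨x, hA x ▸ hx⟩
  clear_value A
  -- eigenvectors
  have eig : ∀ (x : k × k) (c : k), x ≠ 0 → A x = c • x → c ≠ 0 ∧ c ≠ 1 ∧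
      B (e x) (e x) (f x) = 0 := by
    intro x c hx h
    have hm := A_mem x
    have c0 : c ≠ 0 := by
      rintro rfl
      rw [h, zero_smul, map_zero, add_zero] at hm
      have : e x ∈ W₁ ⊓ W₄ := ⟨hc.e_mem x, hm⟩
      rw [h14, Submodule.mem_bot] at this
      exact hx (hc.inj x 0 (by simp [this])).1
    have c1 : c ≠ 1 := by
      rintro rfl
      rw [h, one_smul] at hm
      have : e x + f x ∈ W₃ ⊓ W₄ := ⟨hc.ef_mem x, hm⟩
      rw [h34, Submodule.mem_bot] at this
      exact hx (hc.inj x x this).1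
    refine ⟨c0, c1, ?_⟩
    have h1 := l4.2 _ hm
    have h2 := eval_uw hB hc l1 l2 l3 1 c x
    rw [one_smul, ← h, h1] at h2
    have h3 : 3 * c * (1 - c) ≠ 0 := mul_ne_zero (mul_ne_zero (by norm_num) c0)
      (sub_ne_zero.2 c1.symm)
    exact (mul_eq_zero.1 (show 3 * c * (1 - c) * B (e x) (e x) (f x) = 0 by
      linear_combination -h2)).resolve_left h3
  have meet : ∀ x, x ≠ 0 → (W₄ ⊓ trl e f x ≠ ⊥ ↔ ∃ c : k, A x = c • x) := by
    intro x hx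
    rw [meets_iff]
    constructor
    · rintro ⟨v, hv, hv', v0⟩
      obtain ⟨y, rfl⟩ := A_surj v hv
      obtain ⟨s, t, h⟩ := mem_trl.1 hv'
      obtain ⟨ha, hb⟩ := hc.inj' h
      have hs : s ≠ 0 := by
        rintro rfl
        rw [zero_smul] at ha
        subst ha
        simp at v0
      refine ⟨t / s, ?_⟩
      rw [ha, map_smul] at hb
      rw [div_eq_inv_mul, mul_smul, ← hb, smul_smul, inv_mul_cancel₀ hs, one_smul]
    · rintro ⟨c, h⟩
      refine ⟨_, A_mem x, mem_trl.2 ⟨1, c, by rw [h, one_smul]⟩, fun h0 => hx (hc.inj _ _ h0).1⟩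
  obtain ⟨c, hcv⟩ := Module.End.exists_eigenvalue (K := k) (A : Module.End k (k × k))
  obtain ⟨v, hv⟩ := hcv.exists_hasEigenvector
  have hv0 : v ≠ 0 := hv.2
  have hAv : A v = c • v := hv.apply_eq_smul
  obtain ⟨w', hi⟩ := exists_indep hv0
  obtain ⟨n, d, hw'⟩ := ind_span hi (A w')
  obtain ⟨c0, c1, gv⟩ := eig v c hv0 hAv
  have hdc : d ≠ c := by
    rintro rfl
    have hp := l4.pol2 hB (A_mem v) (A_mem w')
    rw [hAv, hw'] at hp
    have hx := cross_expand B hB hc l1 l2 l3 v w'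
    have hg' : B (e v) (f v) (f v) = 0 := by
      have hy := cross_expand B hB hc l1 l2 l3 v v
      rw [hB.s2 (f v) (f v) (e v), hB.s1 (f v) (e v) (f v), hB.s2 (e v) (f v) (e v), gv] at hy
      linear_combination hy / 3
    have p1 : ∀ x y, B (e v) (e x) (e y) = 0 := fun x y =>
      l1.pol hB (hc.e_mem _) (hc.e_mem _) (hc.e_mem _)
    have p2 : ∀ x y, B (f v) (f x) (f y) = 0 := fun x y =>
      l2.pol hB (hc.f_mem _) (hc.f_mem _) (hc.f_mem _)
    simp only [map_add, map_smul, LinearMap.add_apply, LinearMap.smul_apply, smul_eq_mul, p1, p2,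
      hB.s1 (f v) (e v), gv, hg'] at hp
    refine no_double B hB hc l1 l2 l3 hi gv ?_
    have h3 : d * (1 - d) ≠ 0 := mul_ne_zero c0 (sub_ne_zero.2 c1.symm)
    refine (mul_eq_zero.1 (?_ : d * (1 - d) * _ = 0)).resolve_left h3
    linear_combination hp - d ^ 2 * hx
  have hdc' : d - c ≠ 0 := sub_ne_zero.2 hdc
  let z : k × k := w' + (n / (d - c)) • v
  have hAz : A z = d • z := by
    simp only [z, map_add, map_smul, hw', hAv, smul_add, smul_smul]
    rw [add_right_comm, ← add_smul, add_comm (d • w')]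
    congr 2
    field_simp
    ring
  have hi2 : v.1 * z.2 - v.2 * z.1 ≠ 0 := by
    convert hi using 1
    simp [z]; ring
  clear_value z
  have hz0 : z ≠ 0 := by rintro rfl; simp at hi2
  refine ⟨trl e f v, trl e f z, fun h => hi2 (trl_inj hc h), fun m => ?_⟩
  have hiff : (LineB B m ∧ W₁ ⊓ m ≠ ⊥ ∧ W₂ ⊓ m ≠ ⊥ ∧ W₃ ⊓ m ≠ ⊥ ∧ W₄ ⊓ m ≠ ⊥) ↔
    ((LineB B m ∧ W₁ ⊓ m ≠ ⊥ ∧ W₂ ⊓ m ≠ ⊥ ∧ W₃ ⊓ m ≠ ⊥) ∧ W₄ ⊓ m ≠ ⊥) := by tauto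
  rw [hiff, trl_iff hB hc l1 l2 l3]
  constructor
  · rintro ⟨⟨x, hx, -, rfl⟩, h4⟩
    obtain ⟨r, hr⟩ := (meet x hx).1 h4
    obtain ⟨s, t, hst⟩ := ind_span hi2 x
    have h1 : (s * (c - r)) • v + (t * (d - r)) • z = 0 := by
      have : A x - r • x = 0 := sub_eq_zero.2 hr
      rw [← this, hst, map_add, map_smul, map_smul, hAv, hAz]
      module
    have h2 := congrArg Prod.fst h1
    have h3 := congrArg Prod.snd h1
    simp at h2 h3
    have e1 : s * (c - r) = 0 := by
      refine (mul_eq_zero.1 (?_ : s * (c - r) * (v.1 * z.2 - v.2 * z.1) = 0)).resolve_right hi2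
      linear_combination z.2 * h2 - z.1 * h3
    have e2 : t * (d - r) = 0 := by
      refine (mul_eq_zero.1 (?_ : t * (d - r) * (v.1 * z.2 - v.2 * z.1) = 0)).resolve_right hi2
      linear_combination v.1 * h3 - v.2 * h2
    rcases mul_eq_zero.1 e1 with hs | hs
    · right
      refine trl_eq hc hx hz0 ?_
      rw [hst, hs]; simp; ring
    · have ht : t = 0 := by
        refine (mul_eq_zero.1 e2).resolve_right fun h => hdc ?_
        linear_combination h - hs
      left
      refine trl_eq hc hx hv0 ?_
      rw [hst, ht]; simp; ring
  · rintro (rfl | rfl)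
    · exact ⟨⟨v, hv0, gv, rfl⟩, (meet v hv0).2 ⟨c, hAv⟩⟩
    · exact ⟨⟨z, hz0, (eig z d hz0 hAz).2.2, rfl⟩, (meet z hz0).2 ⟨d, hAz⟩⟩

theorem exists_second {W : Submodule k V} (hW : Module.finrank k W = 2) {a : V} (ha : a ∈ W)
    (a0 : a ≠ 0) : ∃ b ∈ W, (∀ s t : k, s • a + t • b = 0 → s = 0 ∧ t = 0) ∧
      ∀ v ∈ W, ∃ s t : k, v = s • a + t • b := by
  have hb : ∃ b ∈ W, b ∉ Submodule.span k {a} := by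
    by_contra! hcon
    have h1 : W ≤ Submodule.span k {a} := hcon
    have h2 := Submodule.finrank_mono h1
    rw [hW, finrank_span_singleton a0] at h2
    omega
  obtain ⟨b, hbW, hb⟩ := hb
  have hi : ∀ s t : k, s • a + t • b = 0 → s = 0 ∧ t = 0 := by
    intro s t h
    have ht : t = 0 := by
      by_contra ht
      apply hb
      rw [Submodule.mem_span_singleton]
      refine ⟨-(t⁻¹ * s), ?_⟩
      have h2 : t • b = -(s • a) := eq_neg_of_add_eq_zero_right h
      have h3 : b = t⁻¹ • (t • b) := by rw [smul_smul, inv_mul_cancel₀ ht, one_smul]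
      rw [h3, h2, neg_smul, mul_smul, smul_neg]
    subst ht
    rw [zero_smul, add_zero, smul_eq_zero] at h
    exact ⟨h.resolve_right a0, rfl⟩
  refine ⟨b, hbW, hi, ?_⟩
  have hs : Submodule.span k {a, b} = W := by
    apply Submodule.eq_of_le_of_finrank_eq
    · rw [Submodule.span_le]
      rintro v (rfl | rfl) <;> assumption
    · rw [finrank_pair hi, hW]
  intro v hv
  rw [← hs, Submodule.mem_span_pair] at hv
  obtain ⟨s, t, h⟩ := hv
  exact ⟨s, t, h.symm⟩

theorem conj_line (hV : Module.finrank k V = 4) {B : V →ₗ[k] V →ₗ[k] V →ₗ[k] k} (hB : Cub B)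
    {W x : Submodule k V} (lW : LineB B W) (lx : LineB B x) (hWx : W ⊓ x ≠ ⊥) (hne : W ≠ x) :
    ∃ x' : Submodule k V, LineB B x' ∧ W ⊓ x' ≠ ⊥ ∧ x ⊓ x' ≠ ⊥ ∧
      ∀ m, LineB B m → W ⊓ m = ⊥ → m ⊓ x = ⊥ → m ⊓ x' ≠ ⊥ := by
  obtain ⟨a, aW, ax, a0⟩ := meets_iff.1 hWx
  obtain ⟨b, bW, hiW, hW⟩ := exists_second lW.1 aW a0
  obtain ⟨c, cx, hix, hx⟩ := exists_second lx.1 ax a0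
  have cW : c ∉ W := by
    intro hcW
    apply hne
    symm
    apply Submodule.eq_of_le_of_finrank_eq
    · intro v hv
      obtain ⟨s, t, rfl⟩ := hx v hv
      exact W.add_mem (W.smul_mem _ aW) (W.smul_mem _ hcW)
    · rw [lx.1, lW.1]
  have ind : ∀ r s t : k, r • a + s • b + t • c = 0 → r = 0 ∧ s = 0 ∧ t = 0 := by
    intro r s t h
    have ht : t = 0 := by
      by_contra ht
      apply cW
      have h2 : t • c = -(r • a + s • b) := eq_neg_of_add_eq_zero_right h
      have h3 : c = t⁻¹ • (t • c) := by rw [smul_smul, inv_mul_cancel₀ ht, one_smul]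
      rw [h3, h2]
      exact W.smul_mem _ (W.neg_mem (W.add_mem (W.smul_mem _ aW) (W.smul_mem _ bW)))
    subst ht
    rw [zero_smul, add_zero] at h
    exact ⟨(hiW _ _ h).1, (hiW _ _ h).2, rfl⟩
  have hPmem : ∀ v ∈ W ⊔ x, ∃ r s t : k, v = r • a + s • b + t • c := by
    intro v hv
    obtain ⟨p, hp, q, hq, rfl⟩ := Submodule.mem_sup.1 hv
    obtain ⟨s, t, rfl⟩ := hW p hp
    obtain ⟨s', t', rfl⟩ := hx q hq
    exact ⟨s + s', t, t', by module⟩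
  have hdim := Submodule.finrank_sup_add_finrank_inf_eq W x
  rw [lW.1, lx.1] at hdim
  have hpos : 0 < Module.finrank k (W ⊓ x : Submodule k V) := by
    rw [Nat.pos_iff_ne_zero]
    intro h
    exact hWx (Submodule.finrank_eq_zero.1 h)
  have hlt : Module.finrank k (W ⊓ x : Submodule k V) < 2 := by
    by_contra! hge
    have h1 : W ⊓ x = W := Submodule.eq_of_le_of_finrank_le inf_le_left (by rw [lW.1]; exact hge)
    have h2 : W ⊓ x = x := Submodule.eq_of_le_of_finrank_le inf_le_right (by rw [lx.1]; exact hge)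
    exact hne (h1.symm.trans h2)
  have hP3 : Module.finrank k (W ⊔ x : Submodule k V) = 3 := by omega
  -- relations
  have r1 := lW.pol hB aW aW aW
  have r2 := lW.pol hB aW aW bW
  have r3 := lW.pol hB aW bW bW
  have r4 := lW.pol hB bW bW bW
  have r5 := lx.pol hB ax ax cx
  have r6 := lx.pol hB ax cx cx
  have r7 := lx.pol hB cx cx cx
  have hF : ∀ r s t : k, B (r • a + s • b + t • c) (r • a + s • b + t • c)
      (r • a + s • b + t • c) =
      3 * (s * t * (2 * B a b c * r + B b b c * s + B b c c * t)) := by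
    intro r s t
    simp only [map_add, map_smul, LinearMap.add_apply, LinearMap.smul_apply, smul_eq_mul,
      hB.s1 b a, hB.s1 c a, hB.s1 c b, hB.s2 a b a, hB.s2 a c a, hB.s2 a c b, hB.s2 b b a,
      hB.s2 b c a, hB.s2 b c b, hB.s2 c c a, hB.s2 c c b, r1, r2, r3, r4, r5, r6, r7]
    ring
  have hLM : B a b c ≠ 0 ∨ B b b c ≠ 0 := by
    by_contra! hcon
    obtain ⟨hL, hM⟩ := hcon
    have hd : ∃ d, d ∉ W ⊔ x := by
      by_contra! hcon
      have : W ⊔ x = ⊤ := by rw [eq_top_iff]; exact fun v _ => hcon v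
      rw [this, finrank_top, hV] at hP3
      omega
    obtain ⟨d, hd⟩ := hd
    have htop : (W ⊔ x) ⊔ Submodule.span k {d} = ⊤ := by
      apply Submodule.eq_top_of_finrank_eq
      have h1 : W ⊔ x < (W ⊔ x) ⊔ Submodule.span k {d} := by
        refine lt_of_le_of_ne le_sup_left fun h => hd ?_
        rw [h]
        exact Submodule.mem_sup_right (Submodule.mem_span_singleton_self d)
      have h2 := Submodule.finrank_lt_finrank_of_lt h1
      have h3 := Submodule.finrank_le ((W ⊔ x) ⊔ Submodule.span k {d})
      omega
    obtain ⟨w, z, hw, hq⟩ := quad_factor (B a a d) (2 * B a b d) (B b b d)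
    have h0 : w.1 • a + w.2 • b = 0 := by
      apply hB.ns
      intro v
      have hv : v ∈ (W ⊔ x) ⊔ Submodule.span k {d} := by rw [htop]; trivial
      obtain ⟨p, hp, q, hq', rfl⟩ := Submodule.mem_sup.1 hv
      obtain ⟨r, s, t, rfl⟩ := hPmem p hp
      obtain ⟨n, rfl⟩ := Submodule.mem_span_singleton.1 hq'
      have hq2 := hq w.1 w.2
      simp only [map_add, map_smul, LinearMap.add_apply, LinearMap.smul_apply, smul_eq_mul,
        hB.s1 b a, hB.s2 a b a, hB.s2 b b a, r1, r2, r3, r4, r5, hL, hM]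
      linear_combination n * hq2
    obtain ⟨h1, h2⟩ := hiW _ _ h0
    exact hw (Prod.ext h1 h2)
  -- the residual line
  have key : ∃ p q : V, (∀ s t : k, s • p + t • q = 0 → s = 0 ∧ t = 0) ∧
      (∀ s t : k, B (s • p + t • q) (s • p + t • q) (s • p + t • q) = 0) ∧
      (∃ v ∈ W, v ≠ 0 ∧ ∃ s t : k, s • p + t • q = v) ∧
      (∃ v ∈ x, v ≠ 0 ∧ ∃ s t : k, s • p + t • q = v) ∧
      ∀ r s t : k, 2 * B a b c * r + B b b c * s + B b c c * t = 0 →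
        ∃ n n' : k, n • p + n' • q = r • a + s • b + t • c := by
    by_cases hL : B a b c = 0
    · have hM : B b b c ≠ 0 := hLM.resolve_left (fun h => h hL)
      refine ⟨a, (-B b c c) • b + (B b b c) • c, ?_, ?_, ⟨a, aW, a0, 1, 0, by simp⟩,
        ⟨a, ax, a0, 1, 0, by simp⟩, ?_⟩
      · intro s t h
        obtain ⟨h1, h2, h3⟩ := ind s (t * (-B b c c)) (t * B b b c) (by rw [← h]; module)
        exact ⟨h1, (mul_eq_zero.1 h3).resolve_right hM⟩
      · intro s t
        have := hF s (t * (-B b c c)) (t * B b b c)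
        rw [show s • a + t • ((-B b c c) • b + (B b b c) • c) =
          s • a + (t * (-B b c c)) • b + (t * B b b c) • c by module, this, hL]
        ring
      · intro r s t h
        rw [hL] at h
        refine ⟨r, t / B b b c, ?_⟩
        have hs : s = t / B b b c * (-B b c c) := by
          field_simp
          linear_combination h
        have ht : t = t / B b b c * B b b c := by field_simp
        calc _ = r • a + (t / B b b c * (-B b c c)) • b + (t / B b b c * B b b c) • c := by module
          _ = _ := by rw [← hs, ← ht]
    · have h2L : 2 * B a b c ≠ 0 := mul_ne_zero two_ne_zero hL
      refine ⟨(-B b b c) • a + (2 * B a b c) • b, (-B b c c) • a + (2 * B a b c) • c, ?_, ?_,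
        ⟨(-B b b c) • a + (2 * B a b c) • b, W.add_mem (W.smul_mem _ aW) (W.smul_mem _ bW),
          fun h => h2L (hiW _ _ h).2, 1, 0, by simp⟩,
        ⟨(-B b c c) • a + (2 * B a b c) • c, x.add_mem (x.smul_mem _ ax) (x.smul_mem _ cx),
          fun h => h2L (hix _ _ h).2, 0, 1, by simp⟩, ?_⟩
      · intro s t h
        obtain ⟨h1, h2, h3⟩ := ind (s * (-B b b c) + t * (-B b c c)) (s * (2 * B a b c))
          (t * (2 * B a b c)) (by rw [← h]; module)
        exact ⟨(mul_eq_zero.1 h2).resolve_right h2L, (mul_eq_zero.1 h3).resolve_right h2L⟩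
      · intro s t
        have := hF (s * (-B b b c) + t * (-B b c c)) (s * (2 * B a b c)) (t * (2 * B a b c))
        rw [show s • ((-B b b c) • a + (2 * B a b c) • b) + t • ((-B b c c) • a +
          (2 * B a b c) • c) = (s * (-B b b c) + t * (-B b c c)) • a + (s * (2 * B a b c)) • b +
          (t * (2 * B a b c)) • c by module, this]
        ring
      · intro r s t h
        refine ⟨s / (2 * B a b c), t / (2 * B a b c), ?_⟩
        have hs : s = s / (2 * B a b c) * (2 * B a b c) := by field_simp
        have ht : t = t / (2 * B a b c) * (2 * B a b c) := by field_simp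
        have hr : r = s / (2 * B a b c) * (-B b b c) + t / (2 * B a b c) * (-B b c c) := by
          field_simp
          linear_combination h
        calc _ = (s / (2 * B a b c) * (-B b b c) + t / (2 * B a b c) * (-B b c c)) • a +
              (s / (2 * B a b c) * (2 * B a b c)) • b +
              (t / (2 * B a b c) * (2 * B a b c)) • c := by module
          _ = _ := by rw [← hr, ← hs, ← ht]
  obtain ⟨p, q, hpq, hFpq, ⟨v, vW, v0, hv⟩, ⟨v', vx, v0', hv'⟩, hall⟩ := key
  refine ⟨Submodule.span k {p, q}, ⟨finrank_pair hpq, ?_⟩,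
    meets_iff.2 ⟨v, vW, Submodule.mem_span_pair.2 hv, v0⟩,
    meets_iff.2 ⟨v', vx, Submodule.mem_span_pair.2 hv', v0'⟩, ?_⟩
  · intro v hv
    obtain ⟨s, t, rfl⟩ := Submodule.mem_span_pair.1 hv
    exact hFpq s t
  · intro m lm hWm hmx
    have hmP : m ⊓ (W ⊔ x) ≠ ⊥ := by
      intro h
      have h1 := Submodule.finrank_sup_add_finrank_inf_eq m (W ⊔ x)
      rw [h, finrank_bot, lm.1, hP3] at h1
      have h3 := Submodule.finrank_le (m ⊔ (W ⊔ x))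
      omega
    obtain ⟨y, ym, yP, y0⟩ := meets_iff.1 hmP
    obtain ⟨r, s, t, rfl⟩ := hPmem y yP
    have hs : s ≠ 0 := by
      rintro rfl
      apply y0
      have : r • a + (0 : k) • b + t • c ∈ m ⊓ x := ⟨ym, by
        rw [zero_smul, add_zero]
        exact x.add_mem (x.smul_mem _ ax) (x.smul_mem _ cx)⟩
      rwa [hmx, Submodule.mem_bot] at this
    have ht : t ≠ 0 := by
      rintro rfl
      apply y0
      have : r • a + s • b + (0 : k) • c ∈ W ⊓ m := ⟨by
        rw [zero_smul, add_zero]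
        exact W.add_mem (W.smul_mem _ aW) (W.smul_mem _ bW), ym⟩
      rwa [hWm, Submodule.mem_bot] at this
    have h0 := lm.2 _ ym
    rw [hF] at h0
    have h1 : 2 * B a b c * r + B b b c * s + B b c c * t = 0 := by
      simpa [hs, ht] using h0
    exact meets_iff.2 ⟨_, ym, Submodule.mem_span_pair.2 (hall r s t h1), y0⟩

end geom

/-- the incidence data of a six -/
structure Comb {α : Type*} (M : Fin 6 → α → Prop) (Adj : α → α → Prop) : Prop where
  T3 : ∀ i j l, i ≠ j → i ≠ l → j ≠ l → ∃ a b c, a ≠ b ∧ a ≠ c ∧ b ≠ c ∧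
    ∀ m, (M i m ∧ M j m ∧ M l m) ↔ (m = a ∨ m = b ∨ m = c)
  T4 : ∀ i j l n, i ≠ j → i ≠ l → j ≠ l → i ≠ n → j ≠ n → l ≠ n → ∃ a b, a ≠ b ∧
    ∀ m, (M i m ∧ M j m ∧ M l m ∧ M n m) ↔ (m = a ∨ m = b)
  D : ∀ i j l, i ≠ j → i ≠ l → j ≠ l → ∀ a b, a ≠ b → M i a → M j a → M l a →
    M i b → M j b → M l b → ¬ Adj a b
  C : ∀ i j, i ≠ j → ∀ x, M i x → M j x → ∃ y, M i y ∧ Adj x y ∧ ∀ l, l ≠ i → ¬ M l x → M l y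

namespace Comb
variable {α : Type*} {M : Fin 6 → α → Prop} {Adj : α → α → Prop}

theorem perm (h : Comb M Adj) (σ : Fin 6 → Fin 6) (hσ : Function.Injective σ) :
    Comb (fun i => M (σ i)) Adj where
  T3 i j l h1 h2 h3 := h.T3 _ _ _ (hσ.ne h1) (hσ.ne h2) (hσ.ne h3)
  T4 i j l n h1 h2 h3 h4 h5 h6 := h.T4 _ _ _ _ (hσ.ne h1) (hσ.ne h2) (hσ.ne h3) (hσ.ne h4)
    (hσ.ne h5) (hσ.ne h6)
  D i j l h1 h2 h3 := h.D _ _ _ (hσ.ne h1) (hσ.ne h2) (hσ.ne h3)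
  C i j h1 x hi hj := by
    obtain ⟨y, a, b, c⟩ := h.C _ _ (hσ.ne h1) x hi hj
    exact ⟨y, a, b, fun l hl => c _ (hσ.ne hl)⟩

theorem S1 (h : Comb M Adj) {u v : α} (huv : u ≠ v) (hu : ∀ i, M i u) (hv : ∀ i, M i v) :
    False := by
  obtain ⟨a, b, c, hab, hac, hbc, hT⟩ := h.T3 0 1 2 (by decide) (by decide) (by decide)
  have hx : ∃ x, x ≠ u ∧ x ≠ v ∧ M 0 x ∧ M 1 x ∧ M 2 x := by
    have h1 := (hT u).1 ⟨hu _, hu _, hu _⟩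
    have h2 := (hT v).1 ⟨hv _, hv _, hv _⟩
    have ha := (hT a).2 (by simp)
    have hb := (hT b).2 (by simp)
    have hc := (hT c).2 (by simp)
    by_contra! hcon
    have := hcon a
    have := hcon b
    have := hcon c
    grind
  obtain ⟨x, xu, xv, x0, x1, x2⟩ := hx
  have key : ∀ n, n ≠ 0 → n ≠ 1 → n ≠ 2 → ¬ M n x := by
    intro n n0 n1 n2 hn
    obtain ⟨p, q, hpq, hT4⟩ := h.T4 0 1 2 n (by decide) (by decide) (by decide) n0.symm n1.symm
      n2.symm
    have h1 := (hT4 u).1 ⟨hu _, hu _, hu _, hu _⟩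
    have h2 := (hT4 v).1 ⟨hv _, hv _, hv _, hv _⟩
    have h3 := (hT4 x).1 ⟨x0, x1, x2, hn⟩
    grind
  obtain ⟨y, y0, hxy, hy⟩ := h.C 0 1 (by decide) x x0 x1
  have yu : y ≠ u := by
    rintro rfl
    exact h.D 0 1 2 (by decide) (by decide) (by decide) x y xu x0 x1 x2 (hu _) (hu _) (hu _) hxy
  have yv : y ≠ v := by
    rintro rfl
    exact h.D 0 1 2 (by decide) (by decide) (by decide) x y xv x0 x1 x2 (hv _) (hv _) (hv _) hxy
  obtain ⟨p, q, hpq, hT4⟩ := h.T4 0 3 4 5 (by decide) (by decide) (by decide) (by decide)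
    (by decide) (by decide)
  have h1 := (hT4 u).1 ⟨hu _, hu _, hu _, hu _⟩
  have h2 := (hT4 v).1 ⟨hv _, hv _, hv _, hv _⟩
  have h3 := (hT4 y).1 ⟨y0, hy 3 (by decide) (key 3 (by decide) (by decide) (by decide)),
    hy 4 (by decide) (key 4 (by decide) (by decide) (by decide)),
    hy 5 (by decide) (key 5 (by decide) (by decide) (by decide))⟩
  grind

theorem E (h : Comb M Adj) {u v : α} (huv : u ≠ v) (hu : ∀ i, i ≠ 5 → M i u)
    (hv : ∀ i, i ≠ 5 → M i v) (hv5 : ¬ M 5 v) :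
    M 5 u ∧ ∃ x, M 0 x ∧ M 1 x ∧ M 2 x ∧ M 5 x ∧ ¬ M 3 x ∧ ¬ M 4 x := by
  obtain ⟨a, b, c, hab, hac, hbc, hT⟩ := h.T3 0 1 2 (by decide) (by decide) (by decide)
  obtain ⟨p, q, hpq, h3⟩ := h.T4 0 1 2 3 (by decide) (by decide) (by decide) (by decide)
    (by decide) (by decide)
  obtain ⟨r, s, hrs, h4⟩ := h.T4 0 1 2 4 (by decide) (by decide) (by decide) (by decide)
    (by decide) (by decide)
  obtain ⟨y, z, hyz, h5⟩ := h.T4 0 1 2 5 (by decide) (by decide) (by decide) (by decide)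
    (by decide) (by decide)
  have u0 := hu 0 (by decide)
  have u1 := hu 1 (by decide)
  have u2 := hu 2 (by decide)
  have u3 := hu 3 (by decide)
  have u4 := hu 4 (by decide)
  have v0 := hv 0 (by decide)
  have v1 := hv 1 (by decide)
  have v2 := hv 2 (by decide)
  have v3 := hv 3 (by decide)
  have v4 := hv 4 (by decide)
  have Tu := (hT u).1 ⟨u0, u1, u2⟩
  have Tv := (hT v).1 ⟨v0, v1, v2⟩
  have y5 := (h5 y).2 (by simp)
  have z5 := (h5 z).2 (by simp)
  have Ty := (hT y).1 ⟨y5.1, y5.2.1, y5.2.2.1⟩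
  have Tz := (hT z).1 ⟨z5.1, z5.2.1, z5.2.2.1⟩
  have yv : y ≠ v := by rintro rfl; exact hv5 y5.2.2.2
  have zv : z ≠ v := by rintro rfl; exact hv5 z5.2.2.2
  have n3 : ∀ x, x ≠ u → x ≠ v → M 0 x ∧ M 1 x ∧ M 2 x → ¬ M 3 x := by
    intro x xu xv hx hx3
    have a1 := (h3 x).1 ⟨hx.1, hx.2.1, hx.2.2, hx3⟩
    have a2 := (h3 u).1 ⟨u0, u1, u2, u3⟩
    have a3 := (h3 v).1 ⟨v0, v1, v2, v3⟩
    grind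
  have n4 : ∀ x, x ≠ u → x ≠ v → M 0 x ∧ M 1 x ∧ M 2 x → ¬ M 4 x := by
    intro x xu xv hx hx4
    have a1 := (h4 x).1 ⟨hx.1, hx.2.1, hx.2.2, hx4⟩
    have a2 := (h4 u).1 ⟨u0, u1, u2, u4⟩
    have a3 := (h4 v).1 ⟨v0, v1, v2, v4⟩
    grind
  by_cases yu : y = u
  · subst yu
    refine ⟨y5.2.2.2, z, z5.1, z5.2.1, z5.2.2.1, z5.2.2.2, n3 z hyz.symm zv ?_, n4 z hyz.symm zv ?_⟩
    <;> tauto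
  · have zu : z = u := by grind
    subst zu
    refine ⟨z5.2.2.2, y, y5.1, y5.2.1, y5.2.2.1, y5.2.2.2, n3 y hyz yv ?_, n4 y hyz yv ?_⟩
    <;> tauto

theorem S2' (h : Comb M Adj) {u v : α} (huv : u ≠ v) (hu : ∀ i, i ≠ 5 → M i u)
    (hv : ∀ i, i ≠ 5 → M i v) (hv5 : ¬ M 5 v) : False := by
  obtain ⟨hu5, x, x0, x1, x2, x5, x3, x4⟩ := h.E huv hu hv hv5
  have perm_ne : ∀ σ : Fin 6 → Fin 6, Function.Injective σ → σ 5 = 5 → ∀ i, i ≠ 5 → σ i ≠ 5 :=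
    fun σ hσ h5 i hi hi' => hi (hσ (hi'.trans h5.symm))
  have i1 : Function.Injective (![0, 1, 3, 2, 4, 5] : Fin 6 → Fin 6) := by decide
  have i2 : Function.Injective (![0, 1, 4, 2, 3, 5] : Fin 6 → Fin 6) := by decide
  obtain ⟨-, y, y0, y1, y3, y5, y2, y4⟩ := (h.perm _ i1).E huv
    (fun i hi => hu _ (perm_ne _ i1 rfl i hi)) (fun i hi => hv _ (perm_ne _ i1 rfl i hi)) hv5
  obtain ⟨-, z, z0, z1, z4, z5, z2, z3⟩ := (h.perm _ i2).E huv
    (fun i hi => hu _ (perm_ne _ i2 rfl i hi)) (fun i hi => hv _ (perm_ne _ i2 rfl i hi)) hv5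
  change M 0 y at y0
  change M 1 y at y1
  change M 3 y at y3
  change M 5 y at y5
  change ¬ M 2 y at y2
  change ¬ M 4 y at y4
  change M 0 z at z0
  change M 1 z at z1
  change M 4 z at z4
  change M 5 z at z5
  change ¬ M 2 z at z2
  change ¬ M 3 z at z3
  obtain ⟨a, b, c, hab, hac, hbc, hT⟩ := h.T3 0 1 5 (by decide) (by decide) (by decide)
  have Tu := (hT u).1 ⟨hu 0 (by decide), hu 1 (by decide), hu5⟩
  have Tx := (hT x).1 ⟨x0, x1, x5⟩
  have Ty := (hT y).1 ⟨y0, y1, y5⟩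
  have Tz := (hT z).1 ⟨z0, z1, z5⟩
  have xu : x ≠ u := by rintro rfl; exact x3 (hu 3 (by decide))
  have yu : y ≠ u := by rintro rfl; exact y2 (hu 2 (by decide))
  have zu : z ≠ u := by rintro rfl; exact z2 (hu 2 (by decide))
  have xy : x ≠ y := by rintro rfl; exact y2 x2
  have xz : x ≠ z := by rintro rfl; exact z2 x2
  have yz : y ≠ z := by rintro rfl; exact z3 y3
  clear hT
  grind

theorem S2 (h : Comb M Adj) {u v : α} (hu : ∀ i, i ≠ 5 → M i u)
    (hv : ∀ i, i ≠ 5 → M i v) : u = v := by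
  by_contra huv
  by_cases hv5 : M 5 v
  · by_cases hu5 : M 5 u
    · refine h.S1 huv (fun i => ?_) (fun i => ?_)
      · by_cases hi : i = 5
        · exact hi ▸ hu5
        · exact hu i hi
      · by_cases hi : i = 5
        · exact hi ▸ hv5
        · exact hv i hi
    · exact h.S2' (Ne.symm huv) hv hu hu5
  · exact h.S2' huv hu hv hv5

theorem S2g (h : Comb M Adj) (j : Fin 6) {u v : α} (hu : ∀ i, i ≠ j → M i u)
    (hv : ∀ i, i ≠ j → M i v) : u = v := by
  have hs := (Equiv.swap j 5).injective
  have hne : ∀ i, i ≠ 5 → Equiv.swap j 5 i ≠ j := by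
    intro i hi h'
    exact hi (hs (h'.trans (Equiv.swap_apply_right j 5).symm))
  exact (h.perm _ hs).S2 (fun i hi => hu _ (hne i hi)) (fun i hi => hv _ (hne i hi))

theorem ex (h : Comb M Adj) : ∃ g, ∀ i, i ≠ 5 → M i g := by
  obtain ⟨a, b, c, hab, hac, hbc, hT⟩ := h.T3 0 1 2 (by decide) (by decide) (by decide)
  obtain ⟨p, q, hpq, h3⟩ := h.T4 0 1 2 3 (by decide) (by decide) (by decide) (by decide)
    (by decide) (by decide)
  obtain ⟨r, s, hrs, h4⟩ := h.T4 0 1 2 4 (by decide) (by decide) (by decide) (by decide)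
    (by decide) (by decide)
  have p3 := (h3 p).2 (by simp)
  have q3 := (h3 q).2 (by simp)
  have r4 := (h4 r).2 (by simp)
  have s4 := (h4 s).2 (by simp)
  have Tp := (hT p).1 ⟨p3.1, p3.2.1, p3.2.2.1⟩
  have Tq := (hT q).1 ⟨q3.1, q3.2.1, q3.2.2.1⟩
  have Tr := (hT r).1 ⟨r4.1, r4.2.1, r4.2.2.1⟩
  have Ts := (hT s).1 ⟨s4.1, s4.2.1, s4.2.2.1⟩
  have : ∃ g, (g = p ∨ g = q) ∧ (g = r ∨ g = s) := by
    by_contra! hcon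
    have := hcon p
    have := hcon q
    clear hT h3 h4 p3 q3 r4 s4 hcon
    grind
  obtain ⟨g, g1, g2⟩ := this
  have g3 := (h3 g).2 g1
  have g4 := (h4 g).2 g2
  refine ⟨g, fun i hi => ?_⟩
  fin_cases i
  · exact g3.1
  · exact g3.2.1
  · exact g3.2.2.1
  · exact g3.2.2.2
  · exact g4.2.2.2
  · exact absurd rfl hi

theorem exg (h : Comb M Adj) (j : Fin 6) : ∃ g, ∀ i, i ≠ j → M i g := by
  obtain ⟨g, hg⟩ := (h.perm _ (Equiv.swap j 5).injective).ex
  refine ⟨g, fun i hi => ?_⟩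
  have := hg (Equiv.swap j 5 i) (by
    intro h'
    apply hi
    have := congrArg (Equiv.swap j 5) h'
    simpa using this)
  simpa using this

theorem no_six (h : Comb M Adj) (g : α) (hg : ∀ i, M i g) : False := by
  have other : ∀ n : Fin 6, 3 ≤ n → ∃ x, x ≠ g ∧ M 0 x ∧ M 1 x ∧ M 2 x ∧ M n x := by
    intro n hn
    have n0 : 0 ≠ n := by rintro rfl; exact absurd hn (by decide)
    have n1 : 1 ≠ n := by rintro rfl; exact absurd hn (by decide)
    have n2 : 2 ≠ n := by rintro rfl; exact absurd hn (by decide)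
    obtain ⟨p, q, hpq, h3⟩ := h.T4 0 1 2 n (by decide) (by decide) (by decide) n0 n1 n2
    by_cases hp : p = g
    · exact ⟨q, fun h => hpq (hp.trans h.symm), (h3 q).2 (by simp)⟩
    · exact ⟨p, hp, (h3 p).2 (by simp)⟩
  obtain ⟨x, xg, x0, x1, x2, x3⟩ := other 3 (by decide)
  obtain ⟨y, yg, y0, y1, y2, y4⟩ := other 4 (by decide)
  obtain ⟨z, zg, z0, z1, z2, z5⟩ := other 5 (by decide)
  have xy : x ≠ y := by
    rintro rfl
    refine xg (h.S2g 5 (fun i hi => ?_) (fun i _ => hg i))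
    fin_cases i <;> first | assumption | exact absurd rfl hi
  have xz : x ≠ z := by
    rintro rfl
    refine xg (h.S2g 4 (fun i hi => ?_) (fun i _ => hg i))
    fin_cases i <;> first | assumption | exact absurd rfl hi
  have yz : y ≠ z := by
    rintro rfl
    refine yg (h.S2g 3 (fun i hi => ?_) (fun i _ => hg i))
    fin_cases i <;> first | assumption | exact absurd rfl hi
  obtain ⟨a, b, c, hab, hac, hbc, hT⟩ := h.T3 0 1 2 (by decide) (by decide) (by decide)
  have Tg := (hT g).1 ⟨hg _, hg _, hg _⟩
  have Tx := (hT x).1 ⟨x0, x1, x2⟩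
  have Ty := (hT y).1 ⟨y0, y1, y2⟩
  have Tz := (hT z).1 ⟨z0, z1, z2⟩
  clear hT
  grind

end Comb

/-- **Schläfli.** Every six on a smooth cubic surface extends uniquely to a double six:
given an ordered 6-tuple `ℓ` of pairwise disjoint lines on the surface, there is a unique
ordered 6-tuple `ℓ'` of pairwise disjoint lines such that `ℓ i` and `ℓ' i` are disjoint
for every `i`, while `ℓ i` meets `ℓ' j` whenever `i ≠ j`. -/
theorem six_extends_uniquely_to_double_six
    (k : Type) [Field k] [IsAlgClosed k] [CharZero k]
    (F : MvPolynomial (Fin 4) k) (hhom : F.IsHomogeneous 3)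
    (hsmooth : ∀ v : Fin 4 → k, (∀ i : Fin 4, eval v (pderiv i F) = 0) → v = 0)
    (ℓ : Fin 6 → Submodule k (Fin 4 → k))
    (hline : ∀ i, IsLineOn F (ℓ i))
    (hdisj : ∀ i j, i ≠ j → ℓ i ⊓ ℓ j = ⊥) :
    ∃! ℓ' : Fin 6 → Submodule k (Fin 4 → k),
      (∀ i, IsLineOn F (ℓ' i)) ∧
      (∀ i j, i ≠ j → ℓ' i ⊓ ℓ' j = ⊥) ∧
      (∀ i, ℓ i ⊓ ℓ' i = ⊥) ∧
      (∀ i j, i ≠ j → ℓ i ⊓ ℓ' j ≠ ⊥) := by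
  obtain ⟨B, s1, s2, hev, hns⟩ := exists_polar F hhom hsmooth
  have hB : Cub B := ⟨s1, s2, hns⟩
  have hV : Module.finrank k (Fin 4 → k) = 4 := by simp
  have hL : ∀ W, IsLineOn F W ↔ LineB B W := by
    intro W
    simp only [IsLineOn, LineB, hev]
  simp only [hL] at hline ⊢
  have hcomb : Comb (fun i m => LineB B m ∧ ℓ i ⊓ m ≠ ⊥) (fun a b => a ⊓ b ≠ ⊥) := by
    refine ⟨?_, ?_, ?_, ?_⟩
    · intro i j l hij hil hjl
      obtain ⟨a, b, c, h1, h2, h3, h⟩ := three hV hB (hline i) (hline j) (hline l)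
        (hdisj _ _ hij) (hdisj _ _ hil) (hdisj _ _ hjl)
      refine ⟨a, b, c, h1, h2, h3, fun m => ?_⟩
      rw [← h]; tauto
    · intro i j l n hij hil hjl hin hjn hln
      obtain ⟨a, b, h1, h⟩ := four hV hB (hline i) (hline j) (hline l) (hline n)
        (hdisj _ _ hij) (hdisj _ _ hil) (hdisj _ _ hjl)
        (hdisj _ _ hin) (hdisj _ _ hjn) (hdisj _ _ hln)
      refine ⟨a, b, h1, fun m => ?_⟩
      rw [← h]; tauto
    · intro i j l hij hil hjl a b hab ai aj al bi bj bl hadj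
      exact hadj (trans_disjoint hV hB (hline i) (hline j) (hline l)
        (hdisj _ _ hij) (hdisj _ _ hil) (hdisj _ _ hjl)
        ⟨ai.1, ai.2, aj.2, al.2⟩ ⟨bi.1, bi.2, bj.2, bl.2⟩ hab)
    · intro i j hij x hi hj
      have hne : ℓ i ≠ x := by
        rintro rfl
        exact hj.2 (hdisj _ _ hij.symm)
      obtain ⟨y, ly, h1, h2, h3⟩ := conj_line hV hB (hline i) hi.1 hi.2 hne
      refine ⟨y, ⟨ly, h1⟩, h2, fun l hl hlx => ⟨ly, h3 _ (hline l) (hdisj _ _ hl.symm) ?_⟩⟩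
      by_contra hcon
      exact hlx ⟨hi.1, hcon⟩
  choose g hg using hcomb.exg
  have hskew : ∀ i, ℓ i ⊓ g i = ⊥ := by
    intro i
    by_contra hcon
    obtain ⟨j, hj⟩ := exists_ne i
    refine hcomb.no_six (g i) fun n => ?_
    by_cases hn : n = i
    · subst hn
      exact ⟨(hg n j hj).1, hcon⟩
    · exact hg i n hn
  have hgl : ∀ i, LineB B (g i) := by
    intro i
    obtain ⟨j, hj⟩ := exists_ne i
    exact (hg i j hj).1
  refine ⟨g, ⟨hgl, ?_, hskew, fun i j hij => (hg j i hij).2⟩, ?_⟩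
  · intro i j hij
    by_contra hcon
    have hne : g i ≠ g j := by
      intro h
      exact (hg i j hij.symm).2 (h ▸ hskew j)
    have hex : ∀ i j : Fin 6, ∃ p q r : Fin 6, p ≠ q ∧ p ≠ r ∧ q ≠ r ∧
        p ≠ i ∧ q ≠ i ∧ r ≠ i ∧ p ≠ j ∧ q ≠ j ∧ r ≠ j := by decide
    obtain ⟨p, q, r, hpq, hpr, hqr, pi, qi, ri, pj, qj, rj⟩ := hex i j
    exact hcomb.D p q r hpq hpr hqr (g i) (g j) hne (hg i p pi) (hg i q qi) (hg i r ri)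
      (hg j p pj) (hg j q qj) (hg j r rj) hcon
  · rintro g' ⟨h1, -, -, h4⟩
    funext j
    exact hcomb.S2g j (fun i hi => ⟨h1 j, h4 i j hi⟩) (hg j)
end
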